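/- Let τ and τ' be points of the Siegel upper half-space H_3 such that θ_m(τ) ≠ 0 and θ_m(τ') ≠ 0 for every even characteristic m ∈ {0,1}³ × {0,1}³. Suppose that for every odd characteristic n ∈ {0,1}³ × {0,1}³ there exists λ_n ∈ ℂ, λ_n ≠ 0, such that grad_z θ_n(τ', z)|_{z=0} = λ_n · grad_z θ_n(τ, z)|_{z=0} (i.e. the two curves determined by τ and τ' have the same 28 bitangent lines, viewed as points of ℙ²(ℂ)). Then there exists γ = (a b; c d) ∈ Sp(6, ℤ) with γ ≡ I₆ mod 2 such that cτ + d is invertible and τ' = (aτ + b)(cτ + d)⁻¹. -/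

import Mathlib

open scoped BigOperators
open Complex Matrix

noncomputable section

/-- The Siegel upper half-space: complex symmetric `g × g` matrices with
positive definite imaginary part. -/
def IsSiegel {g : ℕ} (τ : Matrix (Fin g) (Fin g) ℂ) : Prop :=
  τ.IsSymm ∧ Matrix.PosDef (Matrix.of fun i j => (τ i j).im)

/-- The `p`-th term of the Riemann theta series with characteristic `m`. -/
def thetaTerm {g : ℕ} (m : (Fin g → ℤ) × (Fin g → ℤ))
    (τ : Matrix (Fin g) (Fin g) ℂ) (z : Fin g → ℂ) (p : Fin g → ℤ) : ℂ :=
  Complex.exp ((Real.pi : ℂ) * Complex.I *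
      (∑ i, ∑ j, ((p i : ℂ) + (m.1 i : ℂ) / 2) * τ i j * ((p j : ℂ) + (m.1 j : ℂ) / 2))
    + 2 * (Real.pi : ℂ) * Complex.I *
      (∑ i, ((p i : ℂ) + (m.1 i : ℂ) / 2) * (z i + (m.2 i : ℂ) / 2)))

/-- The Riemann theta function with characteristic `m`. -/
def theta {g : ℕ} (m : (Fin g → ℤ) × (Fin g → ℤ))
    (τ : Matrix (Fin g) (Fin g) ℂ) (z : Fin g → ℂ) : ℂ :=
  ∑' p : Fin g → ℤ, thetaTerm m τ z p

/-- The gradient `grad_z θ_m(τ, z)|_{z = 0}`. -/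
def thetaGrad {g : ℕ} (m : (Fin g → ℤ) × (Fin g → ℤ))
    (τ : Matrix (Fin g) (Fin g) ℂ) : Fin g → ℂ :=
  fun j => fderiv ℂ (fun z => theta m τ z) 0 (Pi.single j 1)

/-- The Jacobian determinant `D(n₁, …, n_g)(τ)`. -/
def jacDet {g : ℕ} (n : Fin g → (Fin g → ℤ) × (Fin g → ℤ))
    (τ : Matrix (Fin g) (Fin g) ℂ) : ℂ :=
  ((Real.pi : ℂ) ^ g)⁻¹ * Matrix.det (Matrix.of fun i j => thetaGrad (n i) τ j)

/-- A characteristic mod 2 in genus `g`. -/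
abbrev ThetaChar (g : ℕ) := (Fin g → ZMod 2) × (Fin g → ZMod 2)

/-- Lift of a mod-2 characteristic to the integer representative with entries in `{0,1}`. -/
def charLift {g : ℕ} (m : ThetaChar g) : (Fin g → ℤ) × (Fin g → ℤ) :=
  (fun i => ((m.1 i).val : ℤ), fun i => ((m.2 i).val : ℤ))

/-- `m'·m''` computed on the `{0,1}` representatives. -/
def charDot {g : ℕ} (m : ThetaChar g) : ℕ := ∑ i, (m.1 i).val * (m.2 i).val

/-- The parity `e(m) = (-1)^{m'·m''}` of a characteristic. -/
def charParity {g : ℕ} (m : ThetaChar g) : ℤ := (-1) ^ charDot m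

def IsOddChar {g : ℕ} (m : ThetaChar g) : Prop := charParity m = -1

def IsEvenChar {g : ℕ} (m : ThetaChar g) : Prop := charParity m = 1

/-- A tuple of characteristics is azygetic if
`e(nᵢ)e(nⱼ)e(nₖ)e(nᵢ+nⱼ+nₖ) = -1` for all `i < j < k`. -/
def Azygetic {g k : ℕ} (n : Fin k → ThetaChar g) : Prop :=
  ∀ i j l : Fin k, i < j → j < l →
    charParity (n i) * charParity (n j) * charParity (n l) *
      charParity (n i + n j + n l) = -1

/-- An Aronhold set in genus 3: seven pairwise distinct odd characteristics such
that, together with their sum, they form an azygetic 8-tuple. -/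
def IsAronhold (n : Fin 7 → ThetaChar 3) : Prop :=
  Function.Injective n ∧ (∀ i, IsOddChar (n i)) ∧
    Azygetic (Fin.snoc n (∑ i, n i) : Fin 8 → ThetaChar 3)

/-- The standard symplectic form matrix `J = (0 I; -I 0)` over a ring. -/
def Jmat (g : ℕ) (R : Type*) [Ring R] :
    Matrix (Fin g ⊕ Fin g) (Fin g ⊕ Fin g) R :=
  Matrix.fromBlocks 0 1 (-1) 0

/-- The blocks `(a b; c d)` form a symplectic matrix over `R`. -/
def IsSymplectic {g : ℕ} {R : Type*} [Ring R]
    (a b c d : Matrix (Fin g) (Fin g) R) : Prop :=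
  (Matrix.fromBlocks a b c d)ᵀ * Jmat g R * Matrix.fromBlocks a b c d = Jmat g R

/-- The action of `Sp(2g, ℤ)` on mod-2 characteristics. -/
def charAction {g : ℕ} (a b c d : Matrix (Fin g) (Fin g) ℤ) (m : ThetaChar g) : ThetaChar g :=
  (fun i => (∑ j, ((d i j : ZMod 2)) * m.1 j) - (∑ j, ((c i j : ZMod 2)) * m.2 j)
      + (((c * dᵀ) i i : ℤ) : ZMod 2),
   fun i => -(∑ j, ((b i j : ZMod 2)) * m.1 j) + (∑ j, ((a i j : ZMod 2)) * m.2 j)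
      + (((a * bᵀ) i i : ℤ) : ZMod 2))

/-- The Jacobian determinant in genus 3, for three mod-2 odd characteristics. -/
def D3 (n1 n2 n3 : ThetaChar 3) (τ : Matrix (Fin 3) (Fin 3) ℂ) : ℂ :=
  jacDet ![charLift n1, charLift n2, charLift n3] τ

end

theorem Matrix.PosDef.exists_mul_sum_sq_le {g : ℕ} {Y : Matrix (Fin g) (Fin g) ℝ}
    (hY : Y.PosDef) :
    ∃ δ : ℝ, 0 < δ ∧ ∀ w : Fin g → ℝ, δ * ∑ i, w i ^ 2 ≤ ∑ i, ∑ j, w i * Y i j * w j := by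
  have hform : ∀ w : Fin g → ℝ, ∑ i, ∑ j, w i * Y i j * w j = star w ⬝ᵥ (Y *ᵥ w) := by
    intro w
    simp only [dotProduct, mulVec, Pi.star_apply, star_trivial, Finset.mul_sum, mul_assoc]
  have hpos : ∀ w : Fin g → ℝ, w ≠ 0 → 0 < ∑ i, ∑ j, w i * Y i j * w j := by
    intro w hw
    rw [hform]
    exact (Matrix.posDef_iff_dotProduct_mulVec.1 hY).2 hw
  rcases Nat.eq_zero_or_pos g with rfl | hg
  · exact ⟨1, one_pos, fun w => by simp⟩
  have : Nonempty (Fin g) := ⟨⟨0, hg⟩⟩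
  obtain ⟨w₀, hw₀, hmin⟩ := (isCompact_sphere (0 : Fin g → ℝ) 1).exists_isMinOn
    (NormedSpace.sphere_nonempty.2 zero_le_one)
    (f := fun w : Fin g → ℝ => ∑ i, ∑ j, w i * Y i j * w j) (by fun_prop)
  have hw₀0 : w₀ ≠ 0 := by
    rintro rfl
    simp at hw₀
  set δ := ∑ i, ∑ j, w₀ i * Y i j * w₀ j with hδ
  have hδpos : 0 < δ := hpos w₀ hw₀0
  have hgpos : (0 : ℝ) < g := by exact_mod_cast hg
  refine ⟨δ / g, by positivity, fun w => ?_⟩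
  by_cases hw : w = 0
  · simp [hw]
  have hn : 0 < ‖w‖ := norm_pos_iff.2 hw
  have h1 := hmin (show (‖w‖⁻¹ • w) ∈ Metric.sphere (0 : Fin g → ℝ) 1 by
    simp [norm_smul, hn.ne'])
  have h2 : ∑ i, ∑ j, (‖w‖⁻¹ • w) i * Y i j * (‖w‖⁻¹ • w) j
      = (‖w‖⁻¹) ^ 2 * ∑ i, ∑ j, w i * Y i j * w j := by
    simp only [Finset.mul_sum, Pi.smul_apply, smul_eq_mul]
    exact Finset.sum_congr rfl fun i _ => Finset.sum_congr rfl fun j _ => by ring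
  have h3 : δ * ‖w‖ ^ 2 ≤ ∑ i, ∑ j, w i * Y i j * w j := by
    simp only [Set.mem_ofPred_eq] at h1
    rw [h2, ← hδ, inv_pow, ← div_eq_inv_mul, le_div_iff₀ (by positivity)] at h1
    exact h1
  have h4 : ∑ i, w i ^ 2 ≤ g * ‖w‖ ^ 2 := by
    calc ∑ i, w i ^ 2 ≤ ∑ _i : Fin g, ‖w‖ ^ 2 := Finset.sum_le_sum fun i _ => by
          rw [← sq_abs (w i)]
          exact pow_le_pow_left₀ (abs_nonneg _) (norm_le_pi_norm w i) 2
      _ = g * ‖w‖ ^ 2 := by simp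
  calc δ / g * ∑ i, w i ^ 2 ≤ δ / g * (g * ‖w‖ ^ 2) := by gcongr
    _ = δ * ‖w‖ ^ 2 := by field_simp
    _ ≤ _ := h3

theorem summable_prod_pi {g : ℕ} {f : ℤ → ℝ} (hf : Summable f) (h0 : ∀ n, 0 ≤ f n) :
    Summable fun u : Fin g → ℤ => ∏ i, f (u i) := by
  induction g with
  | zero => exact (hasSum_fintype _).summable
  | succ n ih =>
    rw [← (Fin.consEquiv fun _ : Fin (n + 1) => ℤ).summable_iff]
    refine (hf.mul_of_nonneg ih h0 fun u => Finset.prod_nonneg fun i _ => h0 _).congr fun p => ?_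
    simp [Fin.consEquiv, Fin.prod_univ_succ]

theorem summable_exp_neg_abs_int : Summable fun n : ℤ => Real.exp (-|(n : ℝ)|) := by
  refine Summable.of_nat_of_neg ?_ ?_ <;>
  · refine Real.summable_exp_neg_nat.congr fun n => ?_
    simp

noncomputable section

/-- The term of the theta series with real shift `c`. -/
def shiftTerm {g : ℕ} (c : Fin g → ℝ) (T : Matrix (Fin g) (Fin g) ℂ) (z : Fin g → ℂ)
    (u : Fin g → ℤ) : ℂ :=
  cexp ((Real.pi : ℂ) * I * (∑ i, ∑ j, ((u i : ℂ) + c i) * T i j * ((u j : ℂ) + c j))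
    + 2 * (Real.pi : ℂ) * I * ∑ i, ((u i : ℂ) + c i) * z i)

/-- The theta series with real shift `c` of the summation lattice. -/
def shiftTheta {g : ℕ} (c : Fin g → ℝ) (T : Matrix (Fin g) (Fin g) ℂ) (z : Fin g → ℂ) : ℂ :=
  ∑' u : Fin g → ℤ, shiftTerm c T z u

end

theorem norm_shiftTerm {g : ℕ} (c : Fin g → ℝ) (T : Matrix (Fin g) (Fin g) ℂ) (z : Fin g → ℂ)
    (u : Fin g → ℤ) :
    ‖shiftTerm c T z u‖ =
      Real.exp (-Real.pi * (∑ i, ∑ j, ((u i : ℝ) + c i) * (T i j).im * ((u j : ℝ) + c j))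
        - 2 * Real.pi * ∑ i, ((u i : ℝ) + c i) * (z i).im) := by
  have hw : ∀ i, ((u i : ℂ) + c i) = (((u i : ℝ) + c i : ℝ) : ℂ) := fun i => by push_cast; rfl
  rw [shiftTerm, Complex.norm_exp]
  simp only [hw]
  congr 1
  have e2 : ∀ s : ℂ, ((Real.pi : ℂ) * I * s).re = -Real.pi * s.im := by
    intro s; simp
  have e3 : ∀ s : ℂ, (2 * (Real.pi : ℂ) * I * s).re = -(2 * Real.pi * s.im) := by
    intro s
    rw [show 2 * (Real.pi : ℂ) * I * s = (Real.pi : ℂ) * I * (2 * s) by ring, e2]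
    simp; ring
  rw [add_re, e2, e3]
  simp only [im_sum, im_ofReal_mul, im_mul_ofReal]
  ring

theorem norm_shiftTerm_mul_le {g : ℕ} (c : Fin g → ℝ) {T : Matrix (Fin g) (Fin g) ℂ}
    (hT : IsSiegel T) (R : ℝ) :
    ∃ b : (Fin g → ℤ) → ℝ, Summable b ∧ ∀ z : Fin g → ℂ, ‖z‖ ≤ R → ∀ u,
      ‖shiftTerm c T z u‖ * Real.exp (2 * Real.pi * ∑ i, |(u i : ℝ) + c i|) ≤ b u := by
  obtain ⟨δ, hδ, hle⟩ := hT.2.exists_mul_sum_sq_le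
  set A := Real.pi * δ with hA
  have hApos : 0 < A := by positivity
  set B := 2 * Real.pi * R + 2 * Real.pi with hB
  refine ⟨fun u => ∏ i, (Real.exp ((B + 1) ^ 2 / (4 * A) + ∑ i, |c i|) * Real.exp (-|(u i : ℝ)|)),
    summable_prod_pi (f := fun n : ℤ => Real.exp ((B + 1) ^ 2 / (4 * A) + ∑ i, |c i|) *
      Real.exp (-|(n : ℝ)|)) (summable_exp_neg_abs_int.mul_left _) (fun n => by positivity), ?_⟩
  intro z hz u
  rw [norm_shiftTerm, ← Real.exp_add]
  simp only [← Real.exp_add, ← Real.exp_sum]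
  apply Real.exp_le_exp.2
  have h1 := hle fun i => (u i : ℝ) + c i
  simp only [Matrix.of_apply] at h1
  have h2 : -∑ i, ((u i : ℝ) + c i) * (z i).im ≤ ∑ i, |(u i : ℝ) + c i| * R := by
    rw [← Finset.sum_neg_distrib]
    refine Finset.sum_le_sum fun i _ => ?_
    have h3 : |(z i).im| ≤ R := (Complex.abs_im_le_norm _).trans ((norm_le_pi_norm z i).trans hz)
    calc -(((u i : ℝ) + c i) * (z i).im) ≤ |((u i : ℝ) + c i) * (z i).im| := neg_le_abs _
      _ = |(u i : ℝ) + c i| * |(z i).im| := abs_mul _ _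
      _ ≤ _ := by gcongr
  have hpi := Real.pi_pos
  calc _ ≤ -A * ∑ i, ((u i : ℝ) + c i) ^ 2 + 2 * Real.pi * (∑ i, |(u i : ℝ) + c i| * R)
        + 2 * Real.pi * ∑ i, |(u i : ℝ) + c i| := by
        rw [hA]
        have := mul_le_mul_of_nonneg_left h1 hpi.le
        have := mul_le_mul_of_nonneg_left h2 (by positivity : 0 ≤ 2 * Real.pi)
        nlinarith
    _ = ∑ i, (-A * ((u i : ℝ) + c i) ^ 2 + B * |(u i : ℝ) + c i|) := by
        rw [Finset.sum_add_distrib, ← Finset.mul_sum, ← Finset.mul_sum, ← Finset.sum_mul, hB]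
        ring
    _ ≤ _ := by
        refine Finset.sum_le_sum fun i _ => ?_
        have h4 : |(u i : ℝ)| ≤ |(u i : ℝ) + c i| + |c i| := by
          have := abs_sub ((u i : ℝ) + c i) (c i)
          simpa using this
        have h5 : |c i| ≤ ∑ i, |c i| :=
          Finset.single_le_sum (f := fun i => |c i|) (fun i _ => abs_nonneg _) (Finset.mem_univ i)
        set t := |(u i : ℝ) + c i| with ht
        rw [← sq_abs ((u i : ℝ) + c i), ← ht]
        have h6 : -A * t ^ 2 + (B + 1) * t ≤ (B + 1) ^ 2 / (4 * A) := by
          rw [le_div_iff₀ (by positivity)]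
          nlinarith [sq_nonneg (2 * A * t - (B + 1))]
        linarith

theorem summable_shiftTerm {g : ℕ} (c : Fin g → ℝ) {T : Matrix (Fin g) (Fin g) ℂ}
    (hT : IsSiegel T) (z : Fin g → ℂ) : Summable fun u => ‖shiftTerm c T z u‖ := by
  obtain ⟨b, hb, hle⟩ := norm_shiftTerm_mul_le c hT ‖z‖
  refine Summable.of_nonneg_of_le (fun _ => norm_nonneg _) (fun u => ?_) hb
  refine le_trans ?_ (hle z le_rfl u)
  refine le_mul_of_one_le_right (norm_nonneg _) (Real.one_le_exp ?_)
  have := Real.pi_pos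
  positivity

theorem differentiable_shiftTheta {g : ℕ} (c : Fin g → ℝ) {T : Matrix (Fin g) (Fin g) ℂ}
    (hT : IsSiegel T) : Differentiable ℂ (shiftTheta c T) := by
  intro z₀
  obtain ⟨b, hb, hle⟩ := norm_shiftTerm_mul_le c hT (‖z₀‖ + 1)
  let F : (Fin g → ℤ) → (Fin g → ℂ) → (Fin g → ℂ) →L[ℂ] ℂ := fun u z =>
    shiftTerm c T z u • ((2 * (Real.pi : ℂ) * I) •
      ∑ i, ((u i : ℂ) + c i) • (ContinuousLinearMap.proj i : (Fin g → ℂ) →L[ℂ] ℂ))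
  have hF : ∀ u z, HasFDerivAt (fun z => shiftTerm c T z u) (F u z) z := by
    intro u z
    have h1 : HasFDerivAt (fun z : Fin g → ℂ => ∑ i, ((u i : ℂ) + c i) * z i)
        (∑ i, ((u i : ℂ) + c i) • (ContinuousLinearMap.proj i : (Fin g → ℂ) →L[ℂ] ℂ)) z := by
      refine HasFDerivAt.fun_sum fun i _ => ?_
      exact ((ContinuousLinearMap.proj (R := ℂ) (φ := fun _ : Fin g => ℂ) i).hasFDerivAt).const_mul _
    exact ((h1.const_mul _).const_add _).cexp
  have hpi := Real.pi_pos
  have hFle : ∀ u z, z ∈ Metric.ball (0 : Fin g → ℂ) (‖z₀‖ + 1) → ‖F u z‖ ≤ b u := by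
    intro u z hz
    refine le_trans ?_ (hle z (by simpa using (Metric.mem_ball.1 hz).le) u)
    rw [norm_smul]
    refine mul_le_mul_of_nonneg_left ?_ (norm_nonneg _)
    have h0 : (0 : ℝ) ≤ 2 * Real.pi * ∑ i, |(u i : ℝ) + c i| := by positivity
    refine le_trans (ContinuousLinearMap.opNorm_le_bound _ h0 fun v => ?_)
      ((le_add_of_nonneg_right zero_le_one).trans (Real.add_one_le_exp _))
    simp only [_root_.smul_apply, _root_.sum_apply,
      ContinuousLinearMap.proj_apply, smul_eq_mul]
    have h2 : ‖2 * (Real.pi : ℂ) * I‖ = 2 * Real.pi := by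
      simp [abs_of_pos hpi]
    rw [norm_mul, h2, mul_assoc (2 * Real.pi) _ ‖v‖]
    refine mul_le_mul_of_nonneg_left ?_ (by positivity : (0 : ℝ) ≤ 2 * Real.pi)
    rw [Finset.sum_mul]
    refine (norm_sum_le _ _).trans (Finset.sum_le_sum fun i _ => ?_)
    rw [norm_mul]
    have h3 : ‖(u i : ℂ) + c i‖ = |(u i : ℝ) + c i| := by
      rw [show (u i : ℂ) + c i = (((u i : ℝ) + c i : ℝ) : ℂ) by push_cast; rfl, Complex.norm_real,
        Real.norm_eq_abs]
    rw [h3]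
    exact mul_le_mul_of_nonneg_left (norm_le_pi_norm v i) (abs_nonneg _)
  have hz₀ : z₀ ∈ Metric.ball (0 : Fin g → ℂ) (‖z₀‖ + 1) := by simp
  exact (hasFDerivAt_tsum_of_isPreconnected hb Metric.isOpen_ball
    (convex_ball _ _).isPreconnected (fun u z _ => hF u z) hFle hz₀
    (summable_shiftTerm c hT z₀).of_norm hz₀).differentiableAt

theorem theta_eq_shiftTheta {g : ℕ} (m : (Fin g → ℤ) × (Fin g → ℤ))
    (τ : Matrix (Fin g) (Fin g) ℂ) (z : Fin g → ℂ) :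
    theta m τ z =
      shiftTheta (fun i => (m.1 i : ℝ) / 2) τ (fun i => z i + (m.2 i : ℂ) / 2) := by
  simp [theta, shiftTheta, thetaTerm, shiftTerm]

section shift

variable {g : ℕ} (c : Fin g → ℝ) (T : Matrix (Fin g) (Fin g) ℂ) (z : Fin g → ℂ)

theorem shiftTheta_add_int (n : Fin g → ℤ) :
    shiftTheta (fun i => c i + n i) T z = shiftTheta c T z := by
  rw [shiftTheta, shiftTheta, ← (Equiv.addRight n).tsum_eq (shiftTerm c T z)]
  refine tsum_congr fun u => ?_
  simp only [shiftTerm, Equiv.coe_addRight, Pi.add_apply, ofReal_add, ofReal_intCast, Int.cast_add]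
  simp only [add_assoc, add_comm ((c _ : ℝ) : ℂ)]

theorem shiftTheta_neg :
    shiftTheta (fun i => -c i) T (fun i => -z i) = shiftTheta c T z := by
  rw [shiftTheta, shiftTheta, ← (Equiv.neg (Fin g → ℤ)).tsum_eq (shiftTerm c T z)]
  refine tsum_congr fun u => ?_
  simp only [shiftTerm, Equiv.neg_apply, Pi.neg_apply, ofReal_neg, Int.cast_neg]
  congr 3
  · refine Finset.sum_congr rfl fun i _ => Finset.sum_congr rfl fun j _ => by ring
  · refine Finset.sum_congr rfl fun i _ => by ring

theorem exp_two_pi_I_mul_int (k : ℤ) : cexp (2 * (Real.pi : ℂ) * I * k) = 1 := by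
  rw [show 2 * (Real.pi : ℂ) * I * k = k * (2 * (Real.pi : ℂ) * I) by ring]
  exact Complex.exp_int_mul_two_pi_mul_I k

theorem shiftTheta_add_period (n : Fin g → ℤ) :
    shiftTheta c T (fun i => z i + n i) =
      cexp (2 * (Real.pi : ℂ) * I * ∑ i, (c i : ℂ) * n i) * shiftTheta c T z := by
  rw [shiftTheta, shiftTheta, ← tsum_mul_left]
  refine tsum_congr fun u => ?_
  have h := exp_two_pi_I_mul_int (∑ i, u i * n i)
  rw [shiftTerm, shiftTerm, ← one_mul (cexp (2 * (Real.pi : ℂ) * I * _) * _), ← h,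
    ← Complex.exp_add, ← Complex.exp_add]
  congr 1
  push_cast
  simp only [mul_add, add_mul, Finset.sum_add_distrib]
  ring

theorem shiftTheta_add_tau (hT : T.IsSymm) (k : Fin g → ℤ) :
    shiftTheta c T (fun i => z i + ∑ j, T i j * k j) =
      cexp (-((Real.pi : ℂ) * I * ∑ i, ∑ j, (k i : ℂ) * T i j * k j)
        - 2 * (Real.pi : ℂ) * I * ∑ i, (k i : ℂ) * z i) * shiftTheta c T z := by
  rw [shiftTheta, shiftTheta, ← (Equiv.addRight k).tsum_eq (shiftTerm c T z), ← tsum_mul_left]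
  refine tsum_congr fun u => ?_
  rw [shiftTerm, shiftTerm, ← Complex.exp_add]
  congr 1
  simp only [Equiv.coe_addRight, Pi.add_apply, Int.cast_add]
  have hs : ∀ w : Fin g → ℂ, ∑ i, ∑ j, (k i : ℂ) * T i j * w j = ∑ i, ∑ j, w i * T i j * k j := by
    intro w
    rw [Finset.sum_comm]
    refine Finset.sum_congr rfl fun i _ => Finset.sum_congr rfl fun j _ => ?_
    rw [hT.apply i j]
    ring
  have e1 : ∑ i, ∑ j, ((u i : ℂ) + k i + c i) * T i j * ((u j : ℂ) + k j + c j)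
      = ∑ i, ∑ j, ((u i : ℂ) + c i) * T i j * ((u j : ℂ) + c j)
        + 2 * ∑ i, ∑ j, ((u i : ℂ) + c i) * T i j * k j + ∑ i, ∑ j, (k i : ℂ) * T i j * k j := by
    rw [two_mul, ← add_assoc]
    nth_rewrite 2 [← hs fun i => (u i : ℂ) + c i]
    simp only [← Finset.sum_add_distrib]
    exact Finset.sum_congr rfl fun i _ => Finset.sum_congr rfl fun j _ => by ring
  have e2 : ∑ i, ((u i : ℂ) + c i) * (z i + ∑ j, T i j * k j)
      = ∑ i, ((u i : ℂ) + c i) * z i + ∑ i, ∑ j, ((u i : ℂ) + c i) * T i j * k j := by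
    simp only [mul_add, Finset.sum_add_distrib, Finset.mul_sum, mul_assoc]
  have e3 : ∑ i, ((u i : ℂ) + k i + c i) * z i
      = ∑ i, ((u i : ℂ) + c i) * z i + ∑ i, (k i : ℂ) * z i := by
    rw [← Finset.sum_add_distrib]
    exact Finset.sum_congr rfl fun i _ => by ring
  rw [e1, e2, e3]
  ring

end shift

/-- The representative in `{0, 1}` of a class mod 2. -/
def binLift {g : ℕ} (σ : Fin g → ZMod 2) : Fin g → ℤ := fun i => (σ i).val

theorem binLift_emod_two (x : ℤ) : ∃ k : ℤ, x = ((x : ZMod 2).val : ℤ) + 2 * k := by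
  refine ⟨x / 2, ?_⟩
  have h : ((x : ZMod 2).val : ℤ) = x % 2 := by
    have := ZMod.val_intCast (n := 2) x
    simpa using this
  rw [h]
  omega

theorem sumDiff_bijective (g : ℕ) :
    Function.Bijective fun p : (Fin g → ZMod 2) × (Fin g → ℤ) × (Fin g → ℤ) =>
      ((p.2.1 + p.2.2 + binLift p.1, p.2.1 - p.2.2) : (Fin g → ℤ) × (Fin g → ℤ)) := by
  constructor
  · rintro ⟨σ, u, v⟩ ⟨σ', u', v'⟩ h
    simp only [Prod.mk.injEq, funext_iff, Pi.add_apply, Pi.sub_apply, binLift] at h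
    obtain ⟨h1, h2⟩ := h
    have hlt : ∀ x : ZMod 2, x.val < 2 := fun x => ZMod.val_lt x
    have h3 : σ = σ' := by
      funext i
      apply ZMod.val_injective 2
      have := h1 i
      have := h2 i
      have := hlt (σ i)
      have := hlt (σ' i)
      omega
    subst h3
    refine Prod.ext rfl (Prod.ext (funext fun i => ?_) (funext fun i => ?_)) <;>
    · have := h1 i
      have := h2 i
      dsimp only
      omega
  · rintro ⟨p, q⟩
    choose k hk using fun i => binLift_emod_two (p i + q i)
    refine ⟨(fun i => ((p i + q i : ℤ) : ZMod 2), k, k - q), Prod.ext (funext fun i => ?_)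
      (funext fun i => ?_)⟩
    · have := hk i
      simp only [Pi.add_apply, Pi.sub_apply, binLift]
      omega
    · simp

theorem IsSiegel.two_smul {g : ℕ} {T : Matrix (Fin g) (Fin g) ℂ} (hT : IsSiegel T) :
    IsSiegel ((2 : ℂ) • T) := by
  refine ⟨?_, ?_⟩
  · rw [Matrix.IsSymm, Matrix.transpose_smul, hT.1.eq]
  · convert hT.2.smul (two_pos : (0 : ℝ) < 2) using 1
    ext i j
    simp

theorem shiftTheta_mul_shiftTheta {g : ℕ} (c d : Fin g → ℝ) {T : Matrix (Fin g) (Fin g) ℂ}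
    (hT : IsSiegel T) (x y : Fin g → ℂ) :
    shiftTheta c T (fun i => x i + y i) * shiftTheta d T (fun i => x i - y i) =
      ∑ σ : Fin g → ZMod 2,
        shiftTheta (fun i => (binLift σ i + c i + d i) / 2) ((2 : ℂ) • T) (fun i => 2 * x i) *
        shiftTheta (fun i => (binLift σ i + c i - d i) / 2) ((2 : ℂ) • T) (fun i => 2 * y i) := by
  have hsum := summable_mul_of_summable_norm (summable_shiftTerm c hT fun i => x i + y i)
    (summable_shiftTerm d hT fun i => x i - y i)
  have hT2 := hT.two_smul
  let e := Equiv.ofBijective _ (sumDiff_bijective g)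
  have hterm : ∀ (σ : Fin g → ZMod 2) (u v : Fin g → ℤ),
      shiftTerm c T (fun i => x i + y i) (u + v + binLift σ) *
        shiftTerm d T (fun i => x i - y i) (u - v) =
      shiftTerm (fun i => (binLift σ i + c i + d i) / 2) ((2 : ℂ) • T) (fun i => 2 * x i) u *
      shiftTerm (fun i => (binLift σ i + c i - d i) / 2) ((2 : ℂ) • T) (fun i => 2 * y i) v := by
    intro σ u v
    simp only [shiftTerm, ← Complex.exp_add]
    congr 1
    simp only [Finset.mul_sum, ← Finset.sum_add_distrib]
    refine Finset.sum_congr rfl fun i _ => ?_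
    have : ∀ A B C D E F G H : ℂ, A + E + (B + F) = C + G + (D + H) ↔
      A + B + (E + F) = C + D + (G + H) := by
        intros; constructor <;> intro h <;> linear_combination h
    rw [this]
    congr 1
    · rw [← Finset.sum_add_distrib, ← Finset.sum_add_distrib]
      refine Finset.sum_congr rfl fun j _ => ?_
      simp only [Pi.add_apply, Pi.sub_apply, Matrix.smul_apply, smul_eq_mul]
      push_cast
      ring
    · simp only [Pi.add_apply, Pi.sub_apply]
      push_cast
      ring
  have hsum' : Summable fun p => shiftTerm c T (fun i => x i + y i) (e p).1 *
      shiftTerm d T (fun i => x i - y i) (e p).2 := (e.summable_iff).2 hsum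
  rw [shiftTheta, shiftTheta, tsum_mul_tsum_of_summable_norm (summable_shiftTerm c hT _)
    (summable_shiftTerm d hT _), ← e.tsum_eq, hsum'.tsum_prod, tsum_fintype]
  refine Finset.sum_congr rfl fun σ _ => ?_
  rw [shiftTheta, shiftTheta, tsum_mul_tsum_of_summable_norm (summable_shiftTerm _ hT2 _)
    (summable_shiftTerm _ hT2 _)]
  exact tsum_congr fun p => hterm σ p.1 p.2

noncomputable section

/-- The sign character of `ℤ/2`. -/
def sgn (x : ZMod 2) : ℂ := (-1) ^ x.val

/-- The quadratic form `m' · m''` on characteristics. -/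
def chq {g : ℕ} (m : ThetaChar g) : ZMod 2 := m.1 ⬝ᵥ m.2

/-- The symplectic pairing on characteristics. -/
def chp {g : ℕ} (m n : ThetaChar g) : ZMod 2 := m.1 ⬝ᵥ n.2 + m.2 ⬝ᵥ n.1

/-- The theta function whose characteristic is given mod 2. -/
def thetaC {g : ℕ} (τ : Matrix (Fin g) (Fin g) ℂ) (m : ThetaChar g) (z : Fin g → ℂ) : ℂ :=
  theta (charLift m) τ z

/-- The second order theta functions entering the addition formula with difference `a`. -/
def thetaSq {g : ℕ} (a : ThetaChar g) (T : Matrix (Fin g) (Fin g) ℂ) (z : Fin g → ℂ)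
    (σ : Fin g → ZMod 2) : ℂ :=
  shiftTheta (fun i => (binLift σ i + (binLift a.1 i : ℝ) / 2) / 2) ((2 : ℂ) • T)
    (fun i => 2 * z i + (binLift a.2 i : ℂ) / 2)

/-- The bilinear form attached to a characteristic by the Heisenberg representation. -/
def heis {g : ℕ} (m : ThetaChar g) (X Y : (Fin g → ZMod 2) → ℂ) : ℂ :=
  ∑ σ, sgn (m.2 ⬝ᵥ σ) * X (σ + m.1) * Y σ

end

@[simp] theorem sgn_zero : sgn 0 = 1 := by simp [sgn]

@[simp] theorem sgn_one : sgn 1 = -1 := by simp [sgn, ZMod.val_one]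

theorem zmod_two_cases (x : ZMod 2) : x = 0 ∨ x = 1 := by
  revert x; decide

theorem sgn_add (x y : ZMod 2) : sgn (x + y) = sgn x * sgn y := by
  rcases zmod_two_cases x with rfl | rfl <;> rcases zmod_two_cases y with rfl | rfl <;>
    simp [show (1 + 1 : ZMod 2) = 0 from rfl]

theorem sgn_mul_self (x : ZMod 2) : sgn x * sgn x = 1 := by
  rcases zmod_two_cases x with rfl | rfl <;> simp

theorem sgn_ne_zero (x : ZMod 2) : sgn x ≠ 0 := left_ne_zero_of_mul_eq_one (sgn_mul_self x)

theorem sgn_intCast (k : ℤ) : sgn (k : ZMod 2) = cexp ((Real.pi : ℂ) * I * k) := by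
  obtain ⟨j, hj⟩ := binLift_emod_two k
  rw [hj]
  push_cast
  rw [show (Real.pi : ℂ) * I * ((((k : ZMod 2).val : ℕ) : ℂ) + 2 * j) =
    (Real.pi : ℂ) * I * ((k : ZMod 2).val : ℕ) + j * (2 * (Real.pi : ℂ) * I) by ring,
    Complex.exp_add, Complex.exp_int_mul_two_pi_mul_I, mul_one]
  rcases zmod_two_cases (k : ZMod 2) with h | h
  · simp [h, show (2 : ZMod 2) = 0 from rfl]
  · simp [h, ZMod.val_one, show (2 : ZMod 2) = 0 from rfl, Complex.exp_pi_mul_I]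

theorem intCast_binLift {g : ℕ} (σ : Fin g → ZMod 2) (i : Fin g) :
    ((binLift σ i : ℤ) : ZMod 2) = σ i := by
  simp [binLift]

theorem sgn_dotProduct {g : ℕ} (σ ρ : Fin g → ZMod 2) :
    sgn (σ ⬝ᵥ ρ) =
      cexp ((Real.pi : ℂ) * I * ∑ i, ((binLift σ i : ℤ) : ℂ) * ((binLift ρ i : ℤ) : ℂ)) := by
  have h : σ ⬝ᵥ ρ = ((∑ i, binLift σ i * binLift ρ i : ℤ) : ZMod 2) := by
    simp [dotProduct, intCast_binLift]
  rw [h, sgn_intCast]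
  push_cast
  rfl

theorem binLift_add {g : ℕ} (σ ρ : Fin g → ZMod 2) :
    ∃ k : Fin g → ℤ, ∀ i, binLift σ i + binLift ρ i = binLift (σ + ρ) i + 2 * k i := by
  choose k hk using fun i => binLift_emod_two (binLift σ i + binLift ρ i)
  refine ⟨k, fun i => ?_⟩
  have := hk i
  simp only [Int.cast_add, intCast_binLift] at this
  exact this

theorem thetaC_eq {g : ℕ} (τ : Matrix (Fin g) (Fin g) ℂ) (m : ThetaChar g) (z : Fin g → ℂ) :
    thetaC τ m z = shiftTheta (fun i => (binLift m.1 i : ℝ) / 2) τ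
      (fun i => z i + (binLift m.2 i : ℂ) / 2) :=
  theta_eq_shiftTheta _ _ _

theorem differentiable_thetaC {g : ℕ} {τ : Matrix (Fin g) (Fin g) ℂ} (hτ : IsSiegel τ)
    (m : ThetaChar g) : Differentiable ℂ (thetaC τ m) := by
  have h : thetaC τ m = fun z => shiftTheta (fun i => (binLift m.1 i : ℝ) / 2) τ
      (fun i => z i + (binLift m.2 i : ℂ) / 2) := funext fun z => thetaC_eq τ m z
  rw [h]
  exact (differentiable_shiftTheta _ hτ).comp (by fun_prop)

theorem thetaC_neg {g : ℕ} (τ : Matrix (Fin g) (Fin g) ℂ) (m : ThetaChar g) (z : Fin g → ℂ) :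
    thetaC τ m (-z) = sgn (chq m) * thetaC τ m z := by
  rw [thetaC_eq, thetaC_eq, ← shiftTheta_neg]
  have h1 := shiftTheta_add_period (fun i => (binLift m.1 i : ℝ) / 2) τ
    (fun i => z i - (binLift m.2 i : ℂ) / 2) (binLift m.2)
  have h2 := shiftTheta_add_int (fun i => -((binLift m.1 i : ℝ) / 2)) τ
    (fun i => z i - (binLift m.2 i : ℂ) / 2) (binLift m.1)
  have e1 : (fun i => z i - (binLift m.2 i : ℂ) / 2 + (binLift m.2 i : ℂ)) =
      fun i => z i + (binLift m.2 i : ℂ) / 2 := by funext i; ring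
  have e2 : (fun i => -((binLift m.1 i : ℝ) / 2) + (binLift m.1 i : ℝ)) =
      fun i => (binLift m.1 i : ℝ) / 2 := by funext i; ring
  have e3 : (fun i => -((-z) i + (binLift m.2 i : ℂ) / 2)) =
      fun i => z i - (binLift m.2 i : ℂ) / 2 := by funext i; simp; ring
  rw [e1] at h1
  rw [e2] at h2
  rw [e3, ← h2, h1, ← mul_assoc]
  have e4 : sgn (chq m) = cexp (2 * (Real.pi : ℂ) * I *
      ∑ i, ((((binLift m.1 i : ℝ) / 2 : ℝ)) : ℂ) * ((binLift m.2 i : ℤ) : ℂ)) := by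
    rw [chq, sgn_dotProduct, Finset.mul_sum, Finset.mul_sum]
    congr 1
    refine Finset.sum_congr rfl fun i _ => ?_
    push_cast
    ring
  rw [← e4, sgn_mul_self, one_mul]

theorem thetaC_add_period {g : ℕ} (τ : Matrix (Fin g) (Fin g) ℂ) (m : ThetaChar g)
    (z : Fin g → ℂ) (l : Fin g → ℤ) :
    thetaC τ m (fun i => z i + l i) =
      sgn (m.1 ⬝ᵥ fun i => (l i : ZMod 2)) * thetaC τ m z := by
  rw [thetaC_eq, thetaC_eq]
  have h1 := shiftTheta_add_period (fun i => (binLift m.1 i : ℝ) / 2) τ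
    (fun i => z i + (binLift m.2 i : ℂ) / 2) l
  simp only [add_right_comm (z _) _ (l _ : ℂ)] at h1
  rw [h1]
  congr 1
  have h : (m.1 ⬝ᵥ fun i => (l i : ZMod 2)) = ((∑ i, binLift m.1 i * l i : ℤ) : ZMod 2) := by
    simp [dotProduct, intCast_binLift]
  rw [h, sgn_intCast]
  push_cast
  rw [Finset.mul_sum, Finset.mul_sum]
  congr 1
  exact Finset.sum_congr rfl fun i _ => by ring

theorem thetaC_add_tau {g : ℕ} {τ : Matrix (Fin g) (Fin g) ℂ} (hτ : τ.IsSymm) (m : ThetaChar g)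
    (z : Fin g → ℂ) (k : Fin g → ℤ) :
    thetaC τ m (fun i => z i + ∑ j, τ i j * k j) =
      sgn (m.2 ⬝ᵥ fun i => (k i : ZMod 2)) *
      (cexp (-((Real.pi : ℂ) * I * ∑ i, ∑ j, (k i : ℂ) * τ i j * k j)
        - 2 * (Real.pi : ℂ) * I * ∑ i, (k i : ℂ) * z i) * thetaC τ m z) := by
  rw [thetaC_eq, thetaC_eq]
  have h1 := shiftTheta_add_tau (fun i => (binLift m.1 i : ℝ) / 2) τ
    (fun i => z i + (binLift m.2 i : ℂ) / 2) hτ k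
  have e : ∀ i, z i + ∑ j, τ i j * (k j : ℂ) + (binLift m.2 i : ℂ) / 2 =
    z i + (binLift m.2 i : ℂ) / 2 + ∑ j, τ i j * (k j : ℂ) := fun i => by ring
  simp only [e]
  rw [h1, ← mul_assoc]
  congr 1
  have h : (m.2 ⬝ᵥ fun i => (k i : ZMod 2)) = ((-∑ i, binLift m.2 i * k i : ℤ) : ZMod 2) := by
    simp [dotProduct, intCast_binLift]
  rw [h, sgn_intCast, ← Complex.exp_add]
  congr 1
  push_cast
  simp only [mul_add, Finset.sum_add_distrib]
  have : ∑ x, (k x : ℂ) * ((binLift m.2 x : ℂ) / 2) =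
      (∑ x, (binLift m.2 x : ℂ) * (k x : ℂ)) / 2 := by
    rw [Finset.sum_div]
    exact Finset.sum_congr rfl fun i _ => by ring
  rw [this]
  ring

theorem thetaC_addition {g : ℕ} (n a : ThetaChar g) :
    ∃ c : ℂ, c ≠ 0 ∧ ∀ T : Matrix (Fin g) (Fin g) ℂ, IsSiegel T → ∀ x y : Fin g → ℂ,
      thetaC T (n + a) (x + y) * thetaC T n (x - y) =
        c * heis n (thetaSq a T x) (thetaSq a T y) := by
  obtain ⟨k₁, hk₁⟩ := binLift_add n.1 a.1
  obtain ⟨k₂, hk₂⟩ := binLift_add n.2 a.2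
  choose k hk using fun σ => binLift_add σ n.1
  refine ⟨(cexp (2 * (Real.pi : ℂ) * I * ∑ i, (((binLift (n + a).1 i : ℝ) / 2 : ℝ) : ℂ) *
    (k₂ i : ℂ)))⁻¹ * cexp (2 * (Real.pi : ℂ) * I *
      ∑ i, ((binLift n.1 i : ℂ) + (binLift a.1 i : ℂ) / 2) / 2 * (binLift n.2 i : ℂ)),
    mul_ne_zero (inv_ne_zero (Complex.exp_ne_zero _)) (Complex.exp_ne_zero _), ?_⟩
  intro T hT x y
  have h1 : cexp (2 * (Real.pi : ℂ) * I * ∑ i, (((binLift (n + a).1 i : ℝ) / 2 : ℝ) : ℂ) *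
      (k₂ i : ℂ)) * thetaC T (n + a) (x + y) =
      shiftTheta (fun i => ((binLift n.1 i : ℝ) + (binLift a.1 i : ℝ)) / 2) T
        (fun i => x i + y i + ((binLift n.2 i : ℂ) + (binLift a.2 i : ℂ)) / 2) := by
    rw [thetaC_eq, ← shiftTheta_add_period, ← shiftTheta_add_int _ _ _ k₁]
    congr 1
    · funext i
      have := hk₁ i
      rw [Prod.fst_add]
      rw [← Int.cast_add, this]
      push_cast
      ring
    · funext i
      have := hk₂ i
      rw [Prod.snd_add, ← Int.cast_add, this]
      push_cast
      simp only [Pi.add_apply]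
      ring
  rw [mul_assoc, eq_inv_mul_iff_mul_eq₀ (Complex.exp_ne_zero _), ← mul_assoc, h1, thetaC_eq]
  have h2 := shiftTheta_mul_shiftTheta
    (fun i => ((binLift n.1 i : ℝ) + (binLift a.1 i : ℝ)) / 2) (fun i => (binLift n.1 i : ℝ) / 2) hT
    (fun i => x i + (2 * (binLift n.2 i : ℂ) + (binLift a.2 i : ℂ)) / 4)
    (fun i => y i + (binLift a.2 i : ℂ) / 4)
  have e1 : (fun i => x i + (2 * (binLift n.2 i : ℂ) + (binLift a.2 i : ℂ)) / 4 +
      (y i + (binLift a.2 i : ℂ) / 4)) =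
      fun i => x i + y i + ((binLift n.2 i : ℂ) + (binLift a.2 i : ℂ)) / 2 := by
    funext i; ring
  have e2 : (fun i => x i + (2 * (binLift n.2 i : ℂ) + (binLift a.2 i : ℂ)) / 4 -
      (y i + (binLift a.2 i : ℂ) / 4)) = fun i => (x - y) i + (binLift n.2 i : ℂ) / 2 := by
    funext i; simp only [Pi.sub_apply]; ring
  rw [e1, e2] at h2
  rw [h2, heis, Finset.mul_sum]
  refine Finset.sum_congr rfl fun σ _ => ?_
  have h3 : shiftTheta (fun i => ((binLift σ i : ℝ) + ((binLift n.1 i : ℝ) + (binLift a.1 i : ℝ)) / 2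
        - (binLift n.1 i : ℝ) / 2) / 2) ((2 : ℂ) • T)
        (fun i => 2 * (y i + (binLift a.2 i : ℂ) / 4)) = thetaSq a T y σ := by
    rw [thetaSq]
    congr 1
    · funext i; ring
    · funext i; ring
  have h4 : shiftTheta (fun i => ((binLift σ i : ℝ) + ((binLift n.1 i : ℝ) + (binLift a.1 i : ℝ)) / 2
        + (binLift n.1 i : ℝ) / 2) / 2) ((2 : ℂ) • T)
        (fun i => 2 * (x i + (2 * (binLift n.2 i : ℂ) + (binLift a.2 i : ℂ)) / 4)) =
      cexp (2 * (Real.pi : ℂ) * I *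
        ∑ i, ((binLift n.1 i : ℂ) + (binLift a.1 i : ℂ) / 2) / 2 * (binLift n.2 i : ℂ)) *
        (sgn (n.2 ⬝ᵥ σ) * thetaSq a T x (σ + n.1)) := by
    rw [thetaSq, ← shiftTheta_add_int (fun i => ((binLift (σ + n.1) i : ℝ) +
      (binLift a.1 i : ℝ) / 2) / 2) _ _ (k σ)]
    have e3 : (fun i => ((binLift (σ + n.1) i : ℝ) + (binLift a.1 i : ℝ) / 2) / 2 + (k σ i : ℝ)) =
        fun i => ((binLift σ i : ℝ) + ((binLift n.1 i : ℝ) + (binLift a.1 i : ℝ)) / 2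
        + (binLift n.1 i : ℝ) / 2) / 2 := by
      funext i
      have := hk σ i
      have : (binLift σ i : ℝ) + binLift n.1 i = binLift (σ + n.1) i + 2 * k σ i := by
        exact_mod_cast this
      linarith
    have e4 : (fun i => 2 * (x i + (2 * (binLift n.2 i : ℂ) + (binLift a.2 i : ℂ)) / 4)) =
      fun i => (2 * x i + (binLift a.2 i : ℂ) / 2) + (binLift n.2 i : ℂ) := by funext i; ring
    rw [e3, e4, shiftTheta_add_period, ← mul_assoc]
    congr 1
    rw [sgn_dotProduct, ← Complex.exp_add, Finset.mul_sum, Finset.mul_sum, Finset.mul_sum,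
      ← Finset.sum_add_distrib]
    congr 1
    refine Finset.sum_congr rfl fun i _ => ?_
    push_cast
    ring
  rw [h3, h4]
  ring

theorem sum_sgn_dotProduct {g : ℕ} (v : Fin g → ZMod 2) :
    ∑ h : Fin g → ZMod 2, sgn (h ⬝ᵥ v) = if v = 0 then (2 : ℂ) ^ g else 0 := by
  split_ifs with hv
  · simp [hv]
  · obtain ⟨i, hi⟩ := Function.ne_iff.1 hv
    have hi1 : v i = 1 := (zmod_two_cases (v i)).resolve_left hi
    have h := Equiv.sum_comp (Equiv.addRight (Pi.single i 1 : Fin g → ZMod 2))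
      fun h => sgn (h ⬝ᵥ v)
    simp only [Equiv.coe_addRight, add_dotProduct, sgn_add, single_dotProduct, hi1, mul_one,
      sgn_one, Finset.sum_neg_distrib, mul_neg] at h
    linear_combination (-1 / 2 : ℂ) * h

theorem chr_add_self {g : ℕ} (x : Fin g → ZMod 2) : x + x = 0 := by
  funext i; exact CharTwo.add_self_eq_zero _

theorem heis_mul_heis {g : ℕ} (m r : ThetaChar g) (X Y Z W : (Fin g → ZMod 2) → ℂ) :
    (2 : ℂ) ^ g * (heis m X Y * heis r Z W) = sgn ((m + r).2 ⬝ᵥ r.1) *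
      ∑ h : ThetaChar g, sgn (m.2 ⬝ᵥ h.1 + h.2 ⬝ᵥ r.1) *
        (heis (m + r + h) X Z * heis h Y W) := by
  symm
  calc _ = sgn ((m + r).2 ⬝ᵥ r.1) * ∑ h₁ : Fin g → ZMod 2, ∑ α : Fin g → ZMod 2,
        ∑ β : Fin g → ZMod 2, (∑ h₂ : Fin g → ZMod 2, sgn (h₂ ⬝ᵥ (r.1 + α + β))) *
        (sgn (m.2 ⬝ᵥ h₁) * sgn ((m + r).2 ⬝ᵥ α) * X (α + (m.1 + r.1 + h₁)) * Z α *
          Y (β + h₁) * W β) := by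
        congr 1
        rw [Fintype.sum_prod_type]
        refine Finset.sum_congr rfl fun h₁ _ => ?_
        conv_rhs => rw [Finset.sum_comm]
        simp only [Finset.sum_mul, heis, Finset.mul_sum]
        rw [Finset.sum_comm]
        refine Finset.sum_congr rfl fun α _ => ?_
        rw [Finset.sum_comm]
        refine Finset.sum_congr rfl fun β _ => Finset.sum_congr rfl fun h₂ _ => ?_
        simp only [Prod.fst_add, Prod.snd_add, dotProduct_add, add_dotProduct, sgn_add]
        ring
    _ = sgn ((m + r).2 ⬝ᵥ r.1) * ∑ h₁ : Fin g → ZMod 2, ∑ β : Fin g → ZMod 2, (2 : ℂ) ^ g *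
        (sgn (m.2 ⬝ᵥ h₁) * sgn ((m + r).2 ⬝ᵥ (β + r.1)) * X (β + h₁ + m.1) * Z (β + r.1) *
          Y (β + h₁) * W β) := by
        congr 1
        refine Finset.sum_congr rfl fun h₁ _ => ?_
        rw [Finset.sum_comm]
        refine Finset.sum_congr rfl fun β _ => ?_
        rw [Finset.sum_eq_single (β + r.1)]
        · rw [sum_sgn_dotProduct, if_pos]
          · congr 3
            rw [show β + r.1 + (m.1 + r.1 + h₁) = (β + h₁ + m.1) + (r.1 + r.1) by abel,
              chr_add_self, add_zero]
          · rw [show r.1 + (β + r.1) + β = (r.1 + r.1) + (β + β) by abel, chr_add_self,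
              chr_add_self, add_zero]
        · intro α _ hα
          rw [sum_sgn_dotProduct, if_neg, zero_mul]
          intro h0
          apply hα
          funext i
          have h1 := congr_fun h0 i
          simp only [Pi.add_apply, Pi.zero_apply] at h1 ⊢
          generalize α i = x at *
          generalize β i = y at *
          generalize r.1 i = z at *
          revert x y z
          decide
        · simp
    _ = _ := by
        rw [heis, heis, Finset.sum_mul_sum, Finset.sum_comm, Finset.mul_sum]
        conv_rhs => rw [Finset.sum_comm, Finset.mul_sum]
        refine Finset.sum_congr rfl fun β _ => ?_
        conv_rhs => rw [← Equiv.sum_comp (Equiv.addLeft β)]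
        rw [Finset.mul_sum, Finset.mul_sum]
        refine Finset.sum_congr rfl fun h₁ _ => ?_
        simp only [Equiv.coe_addLeft, Prod.snd_add, dotProduct_add, add_dotProduct, sgn_add]
        have h1 := sgn_mul_self (m.2 ⬝ᵥ r.1)
        have h2 := sgn_mul_self (r.2 ⬝ᵥ r.1)
        linear_combination (2 ^ g * sgn (m.2 ⬝ᵥ h₁) * sgn (m.2 ⬝ᵥ β) * sgn (r.2 ⬝ᵥ β) *
          X (β + h₁ + m.1) * Z (β + r.1) * Y (β + h₁) * W β) *
          (sgn (r.2 ⬝ᵥ r.1) * sgn (r.2 ⬝ᵥ r.1) * h1 + h2)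

theorem chp_comm {g : ℕ} (x y : ThetaChar g) : chp x y = chp y x := by
  simp only [chp, dotProduct_comm x.1, dotProduct_comm x.2]
  exact add_comm _ _

theorem chp_add_left {g : ℕ} (x y z : ThetaChar g) : chp (x + y) z = chp x z + chp y z := by
  simp only [chp, Prod.fst_add, Prod.snd_add, add_dotProduct]
  abel

theorem chp_add_right {g : ℕ} (x y z : ThetaChar g) : chp x (y + z) = chp x y + chp x z := by
  rw [chp_comm, chp_add_left, chp_comm y, chp_comm z]

theorem chq_add {g : ℕ} (x y : ThetaChar g) : chq (x + y) = chq x + chq y + chp x y := by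
  simp only [chq, chp, Prod.fst_add, Prod.snd_add, add_dotProduct, dotProduct_add,
    dotProduct_comm x.2]
  abel

theorem sum_heis_mul_heis {g : ℕ} (m r h₀ : ThetaChar g) {ι : Type*} [Fintype ι] (l : ι → ThetaChar g)
    (X Y Z W : (Fin g → ZMod 2) → ℂ) :
    (2 : ℂ) ^ g * ∑ i, (sgn ((m + r).2 ⬝ᵥ (l i).1 + chp (l i) h₀)) *
        (heis (m + l i) X Y * heis (r + l i) Z W) =
      ∑ h, sgn ((m + r).2 ⬝ᵥ r.1 + (m.2 ⬝ᵥ h.1 + h.2 ⬝ᵥ r.1)) *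
        (∑ i, sgn (chp (l i) (h + h₀))) * (heis (m + r + h) X Z * heis h Y W) := by
  simp only [Finset.mul_sum, Finset.sum_mul]
  rw [Finset.sum_comm]
  refine Finset.sum_congr rfl fun i _ => ?_
  generalize l i = l
  have e : m + l + (r + l) = m + r := by
    rw [show m + l + (r + l) = m + r + (l + l) by abel]
    rw [show l + l = 0 from Prod.ext (chr_add_self _) (chr_add_self _), add_zero]
  have h := heis_mul_heis (m + l) (r + l) X Y Z W
  rw [e] at h
  rw [mul_left_comm, h, Finset.mul_sum, Finset.mul_sum]
  refine Finset.sum_congr rfl fun h _ => ?_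
  rw [← mul_assoc, ← mul_assoc]
  congr 1
  simp only [Prod.fst_add, Prod.snd_add, add_dotProduct, dotProduct_add, sgn_add, chp]
  rw [dotProduct_comm l.1 h.2]
  have h1 := sgn_mul_self (m.2 ⬝ᵥ l.1)
  have h2 := sgn_mul_self (r.2 ⬝ᵥ l.1)
  linear_combination (sgn (l.1 ⬝ᵥ h₀.2) * sgn (l.2 ⬝ᵥ h₀.1) * sgn (m.2 ⬝ᵥ r.1) *
    sgn (r.2 ⬝ᵥ r.1) * sgn (m.2 ⬝ᵥ h.1) * sgn (l.2 ⬝ᵥ h.1) * sgn (h.2 ⬝ᵥ r.1) *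
    sgn (h.2 ⬝ᵥ l.1)) * (sgn (r.2 ⬝ᵥ l.1) * sgn (r.2 ⬝ᵥ l.1) * h1 + h2)

theorem riemann_relation {g : ℕ} (a m r h₀ : ThetaChar g) {ι : Type*} [Fintype ι]
    (l : ι → ThetaChar g) :
    ∃ c d : ThetaChar g → ℂ, (∀ l, c l ≠ 0) ∧ (∀ h, d h ≠ 0) ∧
      ∀ τ : Matrix (Fin g) (Fin g) ℂ, IsSiegel τ → ∀ x y : Fin g → ℂ,
        ∑ i, c (l i) * (thetaC τ (m + l i + a) (x + y) * thetaC τ (m + l i) (x - y) *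
            (thetaC τ (r + l i + a) 0 * thetaC τ (r + l i) 0)) =
          ∑ h, d h * (∑ i, sgn (chp (l i) (h + h₀))) *
            (thetaC τ (m + r + h + a) x * thetaC τ (m + r + h) x *
              (thetaC τ (h + a) y * thetaC τ h y)) := by
  choose k hk0 hk using fun n : ThetaChar g => thetaC_addition n a
  refine ⟨fun l => (2 : ℂ) ^ g * sgn ((m + r).2 ⬝ᵥ l.1 + chp l h₀) * (k (m + l))⁻¹ * (k (r + l))⁻¹,
    fun h => sgn ((m + r).2 ⬝ᵥ r.1 + (m.2 ⬝ᵥ h.1 + h.2 ⬝ᵥ r.1)) * (k (m + r + h))⁻¹ * (k h)⁻¹,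
    fun l => ?_, fun h => ?_, fun τ hτ x y => ?_⟩
  · exact mul_ne_zero (mul_ne_zero (mul_ne_zero (pow_ne_zero _ two_ne_zero) (sgn_ne_zero _))
      (inv_ne_zero (hk0 _))) (inv_ne_zero (hk0 _))
  · exact mul_ne_zero (mul_ne_zero (sgn_ne_zero _) (inv_ne_zero (hk0 _))) (inv_ne_zero (hk0 _))
  · have h1 := sum_heis_mul_heis m r h₀ l (thetaSq a τ x) (thetaSq a τ y) (thetaSq a τ 0)
      (thetaSq a τ 0)
    have h2 : ∀ n (u v : Fin g → ℂ), heis n (thetaSq a τ u) (thetaSq a τ v) =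
        (k n)⁻¹ * (thetaC τ (n + a) (u + v) * thetaC τ n (u - v)) := fun n u v => by
      rw [hk n τ hτ u v, inv_mul_cancel_left₀ (hk0 n)]
    simp only [h2, add_zero, sub_zero] at h1
    rw [Finset.mul_sum] at h1
    calc _ = _ := Finset.sum_congr rfl fun l _ => by ring
      _ = _ := h1
      _ = _ := Finset.sum_congr rfl fun h _ => by ring

noncomputable section

/-- The derivative of a theta function at `z` in the direction `v`. -/
def thetaD {g : ℕ} (τ : Matrix (Fin g) (Fin g) ℂ) (m : ThetaChar g) (v z : Fin g → ℂ) : ℂ :=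
  fderiv ℂ (thetaC τ m) z v

end

section

variable {g : ℕ} {τ : Matrix (Fin g) (Fin g) ℂ}

theorem hasDerivAt_thetaC_line (hτ : IsSiegel τ) (m : ThetaChar g) (x v : Fin g → ℂ) (t : ℂ) :
    HasDerivAt (fun t : ℂ => thetaC τ m (x + t • v)) (thetaD τ m v (x + t • v)) t := by
  have h1 : HasDerivAt (fun t : ℂ => x + t • v) v t := by
    simpa using ((hasDerivAt_id t).smul_const v).const_add x
  exact ((differentiable_thetaC hτ m (x + t • v)).hasFDerivAt).comp_hasDerivAt t h1

theorem thetaD_neg (τ : Matrix (Fin g) (Fin g) ℂ) (m : ThetaChar g) (v z : Fin g → ℂ) :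
    thetaD τ m (-v) z = -thetaD τ m v z := by
  simp [thetaD]

theorem thetaC_zero_of_odd {m : ThetaChar g} (hm : chq m = 1) : thetaC τ m 0 = 0 := by
  have h := thetaC_neg τ m 0
  rw [neg_zero, hm, sgn_one] at h
  linear_combination (1 / 2 : ℂ) * h

theorem thetaD_zero_of_even (hτ : IsSiegel τ) {m : ThetaChar g} (hm : chq m = 0)
    (v : Fin g → ℂ) : thetaD τ m v 0 = 0 := by
  have h1 := hasDerivAt_thetaC_line hτ m 0 v 0
  have h2 := hasDerivAt_thetaC_line hτ m 0 (-v) 0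
  have e : (fun t : ℂ => thetaC τ m (0 + t • -v)) = fun t : ℂ => thetaC τ m (0 + t • v) := by
    funext t
    have := thetaC_neg τ m (t • v)
    rw [hm, sgn_zero, one_mul] at this
    rw [zero_add, zero_add, smul_neg, this]
  rw [e] at h2
  have h3 := h1.unique h2
  simp only [zero_smul, add_zero, thetaD_neg] at h3
  linear_combination (1 / 2 : ℂ) * h3

end

theorem riemann_relation_deriv {g : ℕ} (a m r h₀ : ThetaChar g) {ι : Type*} [Fintype ι]
    (l : ι → ThetaChar g) :
    ∃ c d : ThetaChar g → ℂ, (∀ l, c l ≠ 0) ∧ (∀ h, d h ≠ 0) ∧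
      ∀ τ : Matrix (Fin g) (Fin g) ℂ, IsSiegel τ → ∀ x v : Fin g → ℂ,
        ∑ i, c (l i) * ((thetaD τ (m + l i + a) v x * thetaC τ (m + l i) x -
            thetaC τ (m + l i + a) x * thetaD τ (m + l i) v x) *
            (thetaC τ (r + l i + a) 0 * thetaC τ (r + l i) 0)) =
          ∑ h, d h * (∑ i, sgn (chp (l i) (h + h₀))) *
            (thetaC τ (m + r + h + a) x * thetaC τ (m + r + h) x *
              (thetaD τ (h + a) v 0 * thetaC τ h 0 + thetaC τ (h + a) 0 * thetaD τ h v 0)) := by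
  obtain ⟨c, d, hc, hd, H⟩ := riemann_relation a m r h₀ l
  refine ⟨c, d, hc, hd, fun τ hτ x v => ?_⟩
  have hL : HasDerivAt (fun t : ℂ => ∑ i, c (l i) *
      (thetaC τ (m + l i + a) (x + t • v) * thetaC τ (m + l i) (x - t • v) *
            (thetaC τ (r + l i + a) 0 * thetaC τ (r + l i) 0)))
      (∑ i, c (l i) * ((thetaD τ (m + l i + a) v x * thetaC τ (m + l i) x -
            thetaC τ (m + l i + a) x * thetaD τ (m + l i) v x) *
            (thetaC τ (r + l i + a) 0 * thetaC τ (r + l i) 0))) 0 := by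
    refine HasDerivAt.fun_sum fun i _ => HasDerivAt.const_mul _ (HasDerivAt.mul_const ?_ _)
    have h1 := hasDerivAt_thetaC_line hτ (m + l i + a) x v 0
    have h2 := hasDerivAt_thetaC_line hτ (m + l i) x (-v) 0
    simp only [smul_neg, ← sub_eq_add_neg, thetaD_neg] at h2
    refine (h1.fun_mul h2).congr_deriv ?_
    simp only [zero_smul, sub_zero, add_zero]
    ring
  have hR : HasDerivAt (fun t : ℂ => ∑ h, d h * (∑ i, sgn (chp (l i) (h + h₀))) *
            (thetaC τ (m + r + h + a) x * thetaC τ (m + r + h) x *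
              (thetaC τ (h + a) (t • v) * thetaC τ h (t • v))))
      (∑ h, d h * (∑ i, sgn (chp (l i) (h + h₀))) *
            (thetaC τ (m + r + h + a) x * thetaC τ (m + r + h) x *
              (thetaD τ (h + a) v 0 * thetaC τ h 0 + thetaC τ (h + a) 0 * thetaD τ h v 0))) 0 := by
    refine HasDerivAt.fun_sum fun h _ => HasDerivAt.const_mul _ (HasDerivAt.const_mul _ ?_)
    have h1 := hasDerivAt_thetaC_line hτ (h + a) 0 v 0
    have h2 := hasDerivAt_thetaC_line hτ h 0 v 0
    simp only [zero_add] at h1 h2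
    exact (h1.fun_mul h2).congr_deriv (by simp only [zero_smul])
  simp only [H τ hτ] at hL
  exact hL.unique hR

theorem riemann_relation_one {g : ℕ} (a m r : ThetaChar g) :
    ∃ d : ThetaChar g → ℂ,
      ∀ τ : Matrix (Fin g) (Fin g) ℂ, IsSiegel τ → ∀ x y : Fin g → ℂ,
        thetaC τ (m + a) (x + y) * thetaC τ m (x - y) * (thetaC τ (r + a) 0 * thetaC τ r 0) =
          ∑ h, d h * (thetaC τ (m + r + h + a) x * thetaC τ (m + r + h) x *
              (thetaC τ (h + a) y * thetaC τ h y)) := by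
  obtain ⟨c, d, hc, hd, H⟩ := riemann_relation a m r 0 (fun _ : Unit => 0)
  refine ⟨fun h => (c 0)⁻¹ * d h, fun τ hτ x y => ?_⟩
  have h1 := H τ hτ x y
  simp only [Finset.univ_unique, Finset.sum_singleton, add_zero, chp, Prod.fst_zero, Prod.snd_zero,
    zero_dotProduct, sgn_zero, mul_one] at h1
  simp only [mul_assoc ((c 0)⁻¹), ← Finset.mul_sum]
  rw [← h1, inv_mul_cancel_left₀ (hc 0)]

theorem riemann_relation_deriv_one {g : ℕ} (a m r : ThetaChar g) :
    ∃ d : ThetaChar g → ℂ,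
      ∀ τ : Matrix (Fin g) (Fin g) ℂ, IsSiegel τ → ∀ x v : Fin g → ℂ,
        (thetaD τ (m + a) v x * thetaC τ m x - thetaC τ (m + a) x * thetaD τ m v x) *
            (thetaC τ (r + a) 0 * thetaC τ r 0) =
          ∑ h, d h * (thetaC τ (m + r + h + a) x * thetaC τ (m + r + h) x *
              (thetaD τ (h + a) v 0 * thetaC τ h 0 + thetaC τ (h + a) 0 * thetaD τ h v 0)) := by
  obtain ⟨c, d, hc, hd, H⟩ := riemann_relation_deriv a m r 0 (fun _ : Unit => 0)
  refine ⟨fun h => (c 0)⁻¹ * d h, fun τ hτ x y => ?_⟩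
  have h1 := H τ hτ x y
  simp only [Finset.univ_unique, Finset.sum_singleton, add_zero, chp, Prod.fst_zero, Prod.snd_zero,
    zero_dotProduct, sgn_zero, mul_one] at h1
  simp only [mul_assoc ((c 0)⁻¹), ← Finset.mul_sum]
  rw [← h1, inv_mul_cancel_left₀ (hc 0)]

/-- If a product of two entire functions vanishes and one of them is nonzero somewhere,
the other one vanishes identically. -/
theorem eq_zero_of_mul_eq_zero_entire {g : ℕ} {F G : (Fin g → ℂ) → ℂ} (hF : Differentiable ℂ F)
    (hG : Differentiable ℂ G) (hFG : ∀ z, F z * G z = 0) {z₀ : Fin g → ℂ} (h0 : F z₀ ≠ 0) :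
    ∀ z, G z = 0 := by
  intro z
  let L : ℂ → (Fin g → ℂ) := fun t => z₀ + t • (z - z₀)
  have hL : Differentiable ℂ L := by fun_prop
  have hGL : AnalyticOnNhd ℂ (G ∘ L) Set.univ :=
    (hG.comp hL).differentiableOn.analyticOnNhd isOpen_univ
  have hev : ∀ᶠ t in nhds (0 : ℂ), (G ∘ L) t = 0 := by
    have hne : ∀ᶠ t in nhds (0 : ℂ), F (L t) ≠ 0 := by
      refine (hF.comp hL).continuous.continuousAt.eventually_ne ?_
      simpa [L] using h0
    filter_upwards [hne] with t ht
    exact (mul_eq_zero.1 (hFG (L t))).resolve_left ht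
  have h1 := hGL.eqOn_zero_of_preconnected_of_eventuallyEq_zero isPreconnected_univ
    (Set.mem_univ 0) hev (Set.mem_univ 1)
  simpa [L] using h1

theorem exists_thetaC_ne_zero {g : ℕ} {τ : Matrix (Fin g) (Fin g) ℂ} (hτ : IsSiegel τ)
    (h0 : thetaC τ 0 0 ≠ 0) (x : Fin g → ℂ) : ∃ m, thetaC τ m x ≠ 0 := by
  by_contra! hx
  obtain ⟨d, H⟩ := riemann_relation_one (0 : ThetaChar g) 0 0
  have hd := differentiable_thetaC hτ (0 : ThetaChar g)
  have h1 : ∀ y, thetaC τ 0 (x + y) * thetaC τ 0 (x - y) = 0 := by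
    intro y
    have h2 := H τ hτ x y
    simp only [add_zero, zero_add, hx, mul_zero, zero_mul, Finset.sum_const_zero] at h2
    exact (mul_eq_zero.1 h2).resolve_right (mul_ne_zero h0 h0)
  have h2 := eq_zero_of_mul_eq_zero_entire (F := fun y => thetaC τ 0 (x + y))
    (G := fun y => thetaC τ 0 (x - y)) (hd.comp (by fun_prop)) (hd.comp (by fun_prop)) h1
    (z₀ := -x) (by simpa using h0) x
  exact h0 (by simpa using h2)

theorem chp_smul_left {g : ℕ} (e : ZMod 2) (x y : ThetaChar g) : chp (e • x) y = e * chp x y := by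
  simp [chp, mul_add]

theorem chp_smul_right {g : ℕ} (e : ZMod 2) (x y : ThetaChar g) : chp x (e • y) = e * chp x y := by
  rw [chp_comm, chp_smul_left, chp_comm]

theorem chp_self {g : ℕ} (x : ThetaChar g) : chp x x = 0 := by
  rw [chp, dotProduct_comm x.2]
  exact CharTwo.add_self_eq_zero _

theorem chp_zero_right {g : ℕ} (x : ThetaChar g) : chp x 0 = 0 := by
  simp [chp]

theorem chp_zero_left {g : ℕ} (x : ThetaChar g) : chp 0 x = 0 := by
  simp [chp]

theorem chq_zero {g : ℕ} : chq (0 : ThetaChar g) = 0 := by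
  simp [chq]

theorem chq_smul {g : ℕ} (e : ZMod 2) (x : ThetaChar g) : chq (e • x) = e * chq x := by
  rcases zmod_two_cases e with rfl | rfl <;> simp [chq_zero]

theorem char_add_self {g : ℕ} (x : ThetaChar g) : x + x = 0 :=
  Prod.ext (chr_add_self _) (chr_add_self _)

theorem eq_of_char_add_eq_zero {g : ℕ} {x y : ThetaChar g} (h : x + y = 0) : x = y := by
  have h1 : x + y + y = y := by rw [h, zero_add]
  rwa [add_assoc, char_add_self, add_zero] at h1

theorem eq_zero_of_chp_eq_zero {g : ℕ} {x : ThetaChar g} (hx : ∀ y, chp x y = 0) : x = 0 := by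
  ext i
  · simpa [chp] using hx (0, Pi.single i 1)
  · simpa [chp] using hx (Pi.single i 1, 0)

/-- A symplectic basis `(a, b), (l₁, l₂), (g₁, g₂)` adapted to the quadratic form
`x ↦ chq (ρ + x)` of an even characteristic `ρ`. -/
structure IsFrame (ρ a b l₁ l₂ g₁ g₂ : ThetaChar 3) : Prop where
  qρ : chq ρ = 0
  qa : chq (ρ + a) = 0
  qb : chq (ρ + b) = 1
  ql₁ : chq (ρ + l₁) = 1
  ql₂ : chq (ρ + l₂) = 1
  qg₁ : chq (ρ + g₁) = 1
  qg₂ : chq (ρ + g₂) = 1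
  ab : chp a b = 1
  l₁l₂ : chp l₁ l₂ = 1
  g₁g₂ : chp g₁ g₂ = 1
  al₁ : chp a l₁ = 0
  al₂ : chp a l₂ = 0
  ag₁ : chp a g₁ = 0
  ag₂ : chp a g₂ = 0
  bl₁ : chp b l₁ = 0
  bl₂ : chp b l₂ = 0
  bg₁ : chp b g₁ = 0
  bg₂ : chp b g₂ = 0
  l₁g₁ : chp l₁ g₁ = 0
  l₁g₂ : chp l₁ g₂ = 0
  l₂g₁ : chp l₂ g₁ = 0
  l₂g₂ : chp l₂ g₂ = 0

namespace IsFrame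

variable {ρ a b l₁ l₂ g₁ g₂ : ThetaChar 3}

theorem eq_zero (F : IsFrame ρ a b l₁ l₂ g₁ g₂) {w : ThetaChar 3} (ha : chp w a = 0) (hb : chp w b = 0) (hl₁ : chp w l₁ = 0)
    (hl₂ : chp w l₂ = 0) (hg₁ : chp w g₁ = 0) (hg₂ : chp w g₂ = 0) : w = 0 := by
  let φ : (Fin 6 → ZMod 2) → ThetaChar 3 := fun e =>
    e 0 • a + e 1 • b + e 2 • l₁ + e 3 • l₂ + e 4 • g₁ + e 5 • g₂
  have hφ : Function.Injective φ := by
    intro e f hef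
    have key : ∀ x, chp (φ e) x = chp (φ f) x := fun x => by rw [hef]
    have ka := key a
    have kb := key b
    have kl₁ := key l₁
    have kl₂ := key l₂
    have kg₁ := key g₁
    have kg₂ := key g₂
    simp only [φ, chp_add_left, chp_smul_left, chp_self, F.ab, F.l₁l₂, F.g₁g₂, F.al₁, F.al₂, F.ag₁,
      F.ag₂, F.bl₁, F.bl₂, F.bg₁, F.bg₂, F.l₁g₁, F.l₁g₂, F.l₂g₁, F.l₂g₂, chp_comm b a,
      chp_comm l₂ l₁, chp_comm g₂ g₁, chp_comm l₁ a, chp_comm l₂ a, chp_comm g₁ a, chp_comm g₂ a,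
      chp_comm l₁ b, chp_comm l₂ b, chp_comm g₁ b, chp_comm g₂ b, chp_comm g₁ l₁, chp_comm g₁ l₂,
      chp_comm g₂ l₁, chp_comm g₂ l₂, mul_zero, mul_one, add_zero, zero_add]
      at ka kb kl₁ kl₂ kg₁ kg₂
    funext i
    fin_cases i <;> assumption
  have hs : Function.Surjective φ :=
    ((Fintype.bijective_iff_injective_and_card φ).2 ⟨hφ, by simp [ThetaChar, ZMod.card]⟩).2
  refine eq_zero_of_chp_eq_zero fun y => ?_
  obtain ⟨e, rfl⟩ := hs y
  simp only [φ, chp_comm w, chp_add_left, chp_smul_left] at *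
  simp [*]

theorem eq_of_orthogonal (F : IsFrame ρ a b l₁ l₂ g₁ g₂) {x : ThetaChar 3} (h₁ : chp l₁ x = 0) (h₂ : chp l₂ x = 0)
    (h₃ : chp b x = 0) : x = chp x g₂ • g₁ + chp x g₁ • g₂ + chp x a • b := by
  refine eq_of_char_add_eq_zero (F.eq_zero ?_ ?_ ?_ ?_ ?_ ?_) <;>
  simp only [chp_add_left, chp_smul_left, chp_self, F.ab, F.l₁l₂, F.g₁g₂, F.al₁, F.al₂, F.ag₁,
      F.ag₂, F.bl₁, F.bl₂, F.bg₁, F.bg₂, F.l₁g₁, F.l₁g₂, F.l₂g₁, F.l₂g₂, chp_comm b a,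
      chp_comm l₂ l₁, chp_comm g₂ g₁, chp_comm l₁ a, chp_comm l₂ a, chp_comm g₁ a, chp_comm g₂ a,
      chp_comm l₁ b, chp_comm l₂ b, chp_comm g₁ b, chp_comm g₂ b, chp_comm g₁ l₁, chp_comm g₁ l₂,
      chp_comm g₂ l₁, chp_comm g₂ l₂, chp_comm x l₁, chp_comm x l₂, chp_comm x b, h₁, h₂, h₃,
      mul_zero, mul_one, add_zero, zero_add, CharTwo.add_self_eq_zero]

theorem chq_left (F : IsFrame ρ a b l₁ l₂ g₁ g₂) (e₁ e₂ e₃ e₄ : ZMod 2) :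
    chq (ρ + (e₁ • l₁ + e₂ • l₂ + e₃ • b + e₄ • a)) = e₁ + e₂ + e₁ * e₂ + e₃ + e₃ * e₄ := by
  have h₁ := F.ql₁
  have h₂ := F.ql₂
  have h₃ := F.qb
  have h₄ := F.qa
  simp only [chq_add, F.qρ, zero_add] at h₁ h₂ h₃ h₄
  simp only [chq_add, chq_smul, chp_add_left, chp_add_right, chp_smul_left, chp_smul_right,
    F.qρ, chp_comm b a, F.ab, F.l₁l₂, F.al₁, F.al₂, F.bl₁, F.bl₂, mul_zero, add_zero, zero_add,
    mul_one, chp_comm l₁ b, chp_comm l₂ b, chp_comm l₁ a, chp_comm l₂ a, chp_comm l₂ l₁] at *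
  linear_combination e₁ * h₁ + e₂ * h₂ + e₃ * h₃ + e₄ * h₄

theorem chq_right (F : IsFrame ρ a b l₁ l₂ g₁ g₂) (e₁ e₂ e₃ e₄ : ZMod 2) :
    chq (ρ + l₁ + (e₁ • g₁ + e₂ • g₂ + e₃ • b + e₄ • a)) =
      1 + e₁ + e₂ + e₁ * e₂ + e₃ + e₃ * e₄ := by
  have h₁ := F.qg₁
  have h₂ := F.qg₂
  have h₃ := F.qb
  have h₄ := F.qa
  have h₅ := F.ql₁
  simp only [chq_add, F.qρ, zero_add] at h₁ h₂ h₃ h₄ h₅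
  simp only [chq_add, chq_smul, chp_add_left, chp_add_right, chp_smul_left, chp_smul_right,
    F.qρ, chp_comm b a, F.ab, F.g₁g₂, F.ag₁, F.ag₂, F.bg₁, F.bg₂, mul_zero, add_zero, zero_add,
    mul_one, chp_comm g₁ b, chp_comm g₂ b, chp_comm g₁ a, chp_comm g₂ a, chp_comm g₂ g₁,
    chp_comm g₁ l₁, chp_comm g₂ l₁, F.l₁g₁, F.l₁g₂, F.bl₁, F.al₁, chp_comm l₁ b,
    chp_comm l₁ a] at *
  linear_combination e₁ * h₁ + e₂ * h₂ + e₃ * h₃ + e₄ * h₄ + h₅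

end IsFrame

theorem IsFrame.exists_relation {ρ a b l₁ l₂ g₁ g₂ : ThetaChar 3}
    (F : IsFrame ρ a b l₁ l₂ g₁ g₂) :
    ∃ k : ThetaChar 3 → ℂ, (∀ y, k y ≠ 0) ∧
      ∀ τ : Matrix (Fin 3) (Fin 3) ℂ, IsSiegel τ → ∀ v : Fin 3 → ℂ,
        ∑ y ∈ ({0, l₁ + g₁, l₁ + g₂, l₁ + g₁ + g₂} : Finset (ThetaChar 3)),
          k y * (thetaC τ (ρ + y) 0 * thetaC τ (ρ + y + a) 0 * thetaC τ (ρ + b + y + a) 0 *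
            thetaD τ (ρ + b + y) v 0) = 0 := by
  set h₀ : ThetaChar 3 := ρ + b + l₁ + g₁ with hh₀
  let l : (Fin 3 → ZMod 2) → ThetaChar 3 := fun e => e 0 • l₁ + e 1 • l₂ + e 2 • b + 0 • a
  obtain ⟨c, d, hc, hd, H⟩ := riemann_relation_deriv a (ρ + b) ρ h₀ l
  refine ⟨fun y => if y = 0 then c 0 else 8 * d (ρ + b + y), fun y => ?_, fun τ hτ v => ?_⟩
  · dsimp only
    split_ifs
    exacts [hc 0, mul_ne_zero (by norm_num) (hd _)]
  have H1 := H τ hτ 0 v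
  have hL : ∑ i, c (l i) * ((thetaD τ (ρ + b + l i + a) v 0 * thetaC τ (ρ + b + l i) 0 -
            thetaC τ (ρ + b + l i + a) 0 * thetaD τ (ρ + b + l i) v 0) *
            (thetaC τ (ρ + l i + a) 0 * thetaC τ (ρ + l i) 0)) =
      -(c 0 * (thetaC τ (ρ + 0) 0 * thetaC τ (ρ + 0 + a) 0 * thetaC τ (ρ + b + 0 + a) 0 *
            thetaD τ (ρ + b + 0) v 0)) := by
    rw [Finset.sum_eq_single (0 : Fin 3 → ZMod 2)]
    · have h1 := thetaC_zero_of_odd (τ := τ) F.qb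
      simp only [l, Pi.zero_apply, zero_smul, add_zero, h1]
      ring
    · intro e _ he
      have q1 : chq (ρ + l e) = e 0 + e 1 + e 0 * e 1 + e 2 := by
        have := F.chq_left (e 0) (e 1) (e 2) 0
        simpa [l] using this
      have q2 : chq (ρ + l e + a) = e 0 + e 1 + e 0 * e 1 + e 2 + e 2 := by
        have := F.chq_left (e 0) (e 1) (e 2) 1
        simpa [l, add_assoc] using this
      have : thetaC τ (ρ + l e) 0 = 0 ∨ thetaC τ (ρ + l e + a) 0 = 0 := by
        by_contra! hne
        have n1 := (zmod_two_cases (chq (ρ + l e))).resolve_right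
          fun h => hne.1 (thetaC_zero_of_odd h)
        have n2 := (zmod_two_cases (chq (ρ + l e + a))).resolve_right
          fun h => hne.2 (thetaC_zero_of_odd h)
        rw [q1] at n1
        rw [q2] at n2
        apply he
        funext i
        have : e 0 = 0 ∧ e 1 = 0 ∧ e 2 = 0 := by
          revert n1 n2
          generalize e 0 = x
          generalize e 1 = y
          generalize e 2 = z
          revert x y z
          decide
        fin_cases i
        exacts [this.1, this.2.1, this.2.2]
      rcases this with h | h <;> rw [h] <;> ring
    · simp
  have hR : ∑ h, d h * (∑ i, sgn (chp (l i) (h + h₀))) *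
            (thetaC τ (ρ + b + ρ + h + a) 0 * thetaC τ (ρ + b + ρ + h) 0 *
              (thetaD τ (h + a) v 0 * thetaC τ h 0 + thetaC τ (h + a) 0 * thetaD τ h v 0)) =
      ∑ y ∈ ({l₁ + g₁, l₁ + g₂, l₁ + g₁ + g₂} : Finset (ThetaChar 3)),
          8 * d (ρ + b + y) * (thetaC τ (ρ + y) 0 * thetaC τ (ρ + y + a) 0 *
            thetaC τ (ρ + b + y + a) 0 * thetaD τ (ρ + b + y) v 0) := by
    have hb : ∀ y, ρ + b + ρ + (ρ + b + y) = ρ + y := by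
      intro y
      calc ρ + b + ρ + (ρ + b + y) = (ρ + ρ) + (b + b) + ρ + y := by abel
        _ = ρ + y := by rw [char_add_self, char_add_self, zero_add, zero_add]
    rw [← Equiv.sum_comp (Equiv.addLeft (ρ + b))]
    simp only [Equiv.coe_addLeft, hb]
    have hsgn : ∀ x, ∑ i, sgn (chp (l i) x) =
        if chp l₁ x = 0 ∧ chp l₂ x = 0 ∧ chp b x = 0 then (8 : ℂ) else 0 := by
      intro x
      have := sum_sgn_dotProduct ![chp l₁ x, chp l₂ x, chp b x]
      simp only [dotProduct, Fin.sum_univ_three] at this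
      simp only [l, chp_add_left, chp_smul_left, zero_smul, add_zero]
      simp only [← ite_and, show ((2 : ℂ) ^ 3) = 8 by norm_num] at this
      refine Eq.trans this (if_congr ?_ rfl rfl)
      rw [funext_iff, Fin.forall_fin_succ, Fin.forall_fin_succ, Fin.forall_fin_succ]
      simp
    have hx : ∀ y, ρ + b + y + h₀ = y + l₁ + g₁ := by
      intro y
      calc ρ + b + y + h₀ = (ρ + ρ) + (b + b) + (y + l₁ + g₁) := by rw [hh₀]; abel
        _ = _ := by rw [char_add_self, char_add_self, zero_add, zero_add]
    simp only [hsgn, hx]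
    refine ((Finset.sum_congr rfl fun y hy => ?_).trans
      (Finset.sum_subset (Finset.subset_univ _) fun y _ hy => ?_)).symm
    · have hq : chq (ρ + b + y) = 1 := by
        have q : ∀ e₁ e₂, chq (ρ + b + (l₁ + (e₁ • g₁ + e₂ • g₂))) = 1 + 1 + e₁ + e₂ + e₁ * e₂ := by
          intro e₁ e₂
          have := F.chq_right e₁ e₂ 1 0
          rw [show ρ + b + (l₁ + (e₁ • g₁ + e₂ • g₂)) =
            ρ + l₁ + (e₁ • g₁ + e₂ • g₂ + (1 : ZMod 2) • b + (0 : ZMod 2) • a) by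
              rw [one_smul, zero_smul]; abel, this]
          ring
        simp only [Finset.mem_insert, Finset.mem_singleton] at hy
        rcases hy with rfl | rfl | rfl
        · have := q 1 0
          simp only [one_smul, zero_smul, add_zero] at this
          rw [this]; decide
        · have := q 0 1
          simp only [one_smul, zero_smul, zero_add] at this
          rw [this]; decide
        · have := q 1 1
          simp only [one_smul, ← add_assoc] at this ⊢
          rw [this]; decide
      have hc : chp l₁ (y + l₁ + g₁) = 0 ∧ chp l₂ (y + l₁ + g₁) = 0 ∧
          chp b (y + l₁ + g₁) = 0 := by
        simp only [Finset.mem_insert, Finset.mem_singleton] at hy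
        rcases hy with rfl | rfl | rfl <;>
        simp only [chp_add_right, F.l₁g₁, F.l₁g₂, F.l₂g₁, F.l₂g₂, F.bl₁, F.bg₁, F.bg₂, chp_self,
          add_zero, CharTwo.add_self_eq_zero, and_self]
      rw [if_pos hc, thetaC_zero_of_odd hq]
      ring
    · split_ifs with hc
      · obtain ⟨e₁, e₂, e₃, he⟩ : ∃ e₁ e₂ e₃ : ZMod 2,
            y = l₁ + (e₁ • g₁ + e₂ • g₂ + e₃ • b + (0 : ZMod 2) • a) := by
          obtain ⟨u₁, u₂, u₃, hu⟩ : ∃ u₁ u₂ u₃ : ZMod 2,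
            y + l₁ + g₁ = u₁ • g₁ + u₂ • g₂ + u₃ • b :=
              ⟨_, _, _, F.eq_of_orthogonal hc.1 hc.2.1 hc.2.2⟩
          refine ⟨u₁ + 1, u₂, u₃, ?_⟩
          rw [add_smul, one_smul, zero_smul, add_zero]
          calc y = y + (l₁ + l₁) + (g₁ + g₁) := by
                rw [char_add_self, char_add_self, add_zero, add_zero]
            _ = l₁ + ((y + l₁ + g₁) + g₁) := by abel
            _ = _ := by rw [hu]; abel
        have q1 := F.chq_right e₁ e₂ e₃ 0
        have q2 := F.chq_right e₁ e₂ e₃ 1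
        rw [add_assoc ρ l₁, ← he] at q1
        rw [show ρ + l₁ + (e₁ • g₁ + e₂ • g₂ + e₃ • b + (1 : ZMod 2) • a) = ρ + y + a by
          rw [he, one_smul, zero_smul]; abel] at q2
        have : thetaC τ (ρ + y) 0 = 0 ∨ thetaC τ (ρ + y + a) 0 = 0 := by
          by_contra! hne
          have n1 := (zmod_two_cases (chq (ρ + y))).resolve_right
            fun h => hne.1 (thetaC_zero_of_odd h)
          have n2 := (zmod_two_cases (chq (ρ + y + a))).resolve_right
            fun h => hne.2 (thetaC_zero_of_odd h)
          rw [q1] at n1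
          rw [q2] at n2
          have : e₃ = 0 ∧ (e₁ = 1 ∧ e₂ = 0 ∨ e₁ = 0 ∧ e₂ = 1 ∨ e₁ = 1 ∧ e₂ = 1) := by
            clear * - n1 n2
            revert e₁ e₂ e₃
            decide
          apply hy
          rcases this with ⟨rfl, ⟨rfl, rfl⟩ | ⟨rfl, rfl⟩ | ⟨rfl, rfl⟩⟩ <;>
            simp [he, add_assoc]
        rcases this with h | h <;> rw [h] <;> ring
      · ring
  rw [hL, hR] at H1
  have hy : ∀ y ∈ ({l₁ + g₁, l₁ + g₂, l₁ + g₁ + g₂} : Finset (ThetaChar 3)), y ≠ 0 := by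
    intro y hy h0
    have h1 : chp l₂ y = 0 := by rw [h0, chp_zero_right]
    simp only [Finset.mem_insert, Finset.mem_singleton] at hy
    rcases hy with rfl | rfl | rfl <;>
      simp [chp_add_right, F.l₁l₂, F.l₂g₁, F.l₂g₂, chp_comm l₂ l₁] at h1
  have hs := Finset.sum_congr (s₁ := ({l₁ + g₁, l₁ + g₂, l₁ + g₁ + g₂} : Finset (ThetaChar 3))) rfl
    fun y h => congrArg (· * (thetaC τ (ρ + y) 0 * thetaC τ (ρ + y + a) 0 *
      thetaC τ (ρ + b + y + a) 0 * thetaD τ (ρ + b + y) v 0))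
      (if_neg (hy y h) : (if y = 0 then c 0 else 8 * d (ρ + b + y)) = _)
  beta_reduce at hs ⊢
  rw [Finset.sum_insert (fun h => hy 0 h rfl), if_pos rfl, hs, ← H1]
  ring

/-- The genus three characteristic whose entries are the six lowest binary digits of `n`. -/
def binChar (n : ℕ) : ThetaChar 3 :=
  (fun i => if n.testBit i then 1 else 0, fun i => if n.testBit (i + 3) then 1 else 0)

/-- The parity of `binChar n`. -/
def binOdd (n : ℕ) : Bool :=
  ((n.testBit 0 && n.testBit 3) ^^ (n.testBit 1 && n.testBit 4)) ^^ (n.testBit 2 && n.testBit 5)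

/-- The symplectic pairing of `binChar m` and `binChar n`. -/
def binPair (m n : ℕ) : Bool := (binOdd (m ^^^ n) ^^ binOdd m) ^^ binOdd n

theorem ite_xor (x y : Bool) :
    (if (x ^^ y) then (1 : ZMod 2) else 0) = (if x then 1 else 0) + if y then 1 else 0 := by
  revert x y; decide

theorem ite_band (x y : Bool) :
    (if (x && y) then (1 : ZMod 2) else 0) = (if x then 1 else 0) * if y then 1 else 0 := by
  revert x y; decide

theorem binChar_xor (m n : ℕ) : binChar (m ^^^ n) = binChar m + binChar n := by
  ext i <;> simp only [binChar, Nat.testBit_xor, Prod.fst_add, Prod.snd_add, Pi.add_apply, ite_xor]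

theorem chq_binChar (n : ℕ) : chq (binChar n) = if binOdd n then 1 else 0 := by
  rw [binOdd, ite_xor, ite_xor, ite_band, ite_band, ite_band]
  simp only [chq, binChar, dotProduct, Fin.sum_univ_three]
  rfl

theorem chp_binChar (m n : ℕ) : chp (binChar m) (binChar n) = if binPair m n then 1 else 0 := by
  have h := chq_add (binChar m) (binChar n)
  rw [← binChar_xor, chq_binChar, chq_binChar, chq_binChar] at h
  rw [binPair, ite_xor, ite_xor]
  generalize chp (binChar m) (binChar n) = u at h ⊢
  generalize binOdd (m ^^^ n) = x at h ⊢
  generalize binOdd m = y at h ⊢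
  generalize binOdd n = z at h ⊢
  revert x y z u
  decide

theorem exists_binChar (x : ThetaChar 3) : ∃ n < 64, binChar n = x := by
  revert x; decide +kernel

/-- Boolean version of `IsFrame`. -/
def binFrame (ρ a b l₁ l₂ g₁ g₂ : ℕ) : Bool :=
  !binOdd ρ && !binOdd (ρ ^^^ a) && binOdd (ρ ^^^ b) && binOdd (ρ ^^^ l₁) && binOdd (ρ ^^^ l₂) &&
  binOdd (ρ ^^^ g₁) && binOdd (ρ ^^^ g₂) && binPair a b && binPair l₁ l₂ && binPair g₁ g₂ &&
  !binPair a l₁ && !binPair a l₂ && !binPair a g₁ && !binPair a g₂ &&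
  !binPair b l₁ && !binPair b l₂ && !binPair b g₁ && !binPair b g₂ &&
  !binPair l₁ g₁ && !binPair l₁ g₂ && !binPair l₂ g₁ && !binPair l₂ g₂

theorem isFrame_binChar {ρ a b l₁ l₂ g₁ g₂ : ℕ} (h : binFrame ρ a b l₁ l₂ g₁ g₂ = true) :
    IsFrame (binChar ρ) (binChar a) (binChar b) (binChar l₁) (binChar l₂) (binChar g₁)
      (binChar g₂) := by
  simp only [binFrame, Bool.and_eq_true, Bool.not_eq_true'] at h
  constructor <;> simp only [← binChar_xor, chq_binChar, chp_binChar, h] <;> rfl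

/-- Whether `n`, `x`, `y`, `z` are the odd characteristics of a frame relation. -/
def binRelated (n x y z : ℕ) : Bool :=
  !binOdd (n ^^^ x ^^^ y) && !binOdd (n ^^^ x ^^^ z) && !binOdd (n ^^^ y ^^^ z) &&
  !binOdd (x ^^^ y ^^^ z) && (List.range 64).any fun ρ => !binOdd ρ && binOdd (ρ ^^^ (n ^^^ x ^^^ y ^^^ z)) &&
    binOdd (ρ ^^^ (y ^^^ z)) && binOdd (ρ ^^^ (x ^^^ z)) &&
    (List.range 64).any fun a => !binOdd (ρ ^^^ a) && binPair a (ρ ^^^ n) &&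
      (List.range 64).any fun l₂ =>
        binFrame ρ a (ρ ^^^ n) (n ^^^ x ^^^ y ^^^ z) l₂ (y ^^^ z) (x ^^^ z)

/-- A set of characteristics which contains, with three odd characteristics of any frame relation,
also the remaining one. -/
def FrameClosed (K : ThetaChar 3 → Prop) : Prop :=
  ∀ ρ a b l₁ l₂ g₁ g₂, IsFrame ρ a b l₁ l₂ g₁ g₂ → K (ρ + b + (l₁ + g₁)) → K (ρ + b + (l₁ + g₂)) →
    K (ρ + b + (l₁ + g₁ + g₂)) → K (ρ + b)

theorem FrameClosed.of_binRelated {K : ThetaChar 3 → Prop} (hK : FrameClosed K) {n x y z : ℕ}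
    (h : binRelated n x y z = true) (hx : K (binChar x)) (hy : K (binChar y))
    (hz : K (binChar z)) : K (binChar n) := by
  simp only [binRelated, List.any_eq_true, Bool.and_eq_true] at h
  obtain ⟨-, ρ, -, -, a, -, -, l₂, -, h⟩ := h
  have key := hK _ _ _ _ _ _ _ (isFrame_binChar h)
  simp only [← binChar_xor] at key
  have e0 : ρ ^^^ (ρ ^^^ n) = n := by simp
  have e1 : ρ ^^^ (ρ ^^^ n) ^^^ ((n ^^^ x ^^^ y ^^^ z) ^^^ (y ^^^ z)) = x := by
    apply Nat.eq_of_testBit_eq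
    intro i
    simp only [Nat.testBit_xor]
    cases n.testBit i <;> cases x.testBit i <;> cases y.testBit i <;> cases z.testBit i <;>
      cases ρ.testBit i <;> rfl
  have e2 : ρ ^^^ (ρ ^^^ n) ^^^ ((n ^^^ x ^^^ y ^^^ z) ^^^ (x ^^^ z)) = y := by
    apply Nat.eq_of_testBit_eq
    intro i
    simp only [Nat.testBit_xor]
    cases n.testBit i <;> cases x.testBit i <;> cases y.testBit i <;> cases z.testBit i <;>
      cases ρ.testBit i <;> rfl
  have e3 : ρ ^^^ (ρ ^^^ n) ^^^ ((n ^^^ x ^^^ y ^^^ z) ^^^ (y ^^^ z) ^^^ (x ^^^ z)) = z := by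
    apply Nat.eq_of_testBit_eq
    intro i
    simp only [Nat.testBit_xor]
    cases n.testBit i <;> cases x.testBit i <;> cases y.testBit i <;> cases z.testBit i <;>
      cases ρ.testBit i <;> rfl
  rw [e1, e2, e3, e0] at key
  exact key hx hy hz

theorem FrameClosed.standard {K : ThetaChar 3 → Prop} (hK : FrameClosed K)
    (h : ∀ n ∈ [9, 13, 63, 41], K (binChar n)) :
    ∀ n : ThetaChar 3, chq n = 1 → K n := by
  let L₀ : List ℕ := [9, 13, 63, 41]
  let L₁ : List ℕ := L₀ ++
    [18, 19, 22, 23, 26, 30, 36, 37, 38, 39, 44, 46, 50, 51, 52, 53, 58, 60]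
  have step : ∀ L : List ℕ, (∀ n ∈ L, K (binChar n)) → ∀ n,
      (L.any fun x => L.any fun y => L.any fun z => binRelated n x y z) = true →
      K (binChar n) := by
    intro L hL n hn
    simp only [List.any_eq_true] at hn
    obtain ⟨x, hx, y, hy, z, hz, hn⟩ := hn
    exact hK.of_binRelated hn (hL x hx) (hL y hy) (hL z hz)
  have c1 : ∀ n ∈ List.range 64, (!(L₁.contains n) || L₀.contains n ||
      L₀.any fun x => L₀.any fun y => L₀.any fun z => binRelated n x y z) = true := by
    decide +kernel
  have c2 : ∀ n ∈ List.range 64, (!(binOdd n) || L₁.contains n ||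
      L₁.any fun x => L₁.any fun y => L₁.any fun z => binRelated n x y z) = true := by
    decide +kernel
  have h1 : ∀ n ∈ List.range 64, n ∈ L₁ → K (binChar n) := by
    intro n hn hn1
    have := c1 n hn
    simp only [Bool.or_eq_true, Bool.not_eq_true', List.contains_eq_mem, decide_eq_false_iff_not,
      decide_eq_true_eq] at this
    rcases this with (h2 | h2) | h2
    exacts [absurd hn1 h2, h n h2, step L₀ h n h2]
  intro m hm
  obtain ⟨n, hn, rfl⟩ := exists_binChar m
  have hn' := List.mem_range.2 hn
  have := c2 n hn'
  simp only [Bool.or_eq_true, Bool.not_eq_true', List.contains_eq_mem, decide_eq_true_eq] at this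
  rcases this with (h2 | h2) | h2
  · rw [chq_binChar, h2] at hm
    exact absurd hm (by decide)
  · exact h1 n hn' h2
  · refine step L₁ (fun k hk => h1 k ?_ hk) n h2
    have : ∀ k ∈ L₁, k ∈ List.range 64 := by decide
    exact this k hk

/-- The linear map carrying the symplectic basis `1, 9, 18, 38, 22, 36` (written in binary)
to the basis `a, b, l₁, l₂, g₁, g₂`. -/
def frameMap (a b l₁ l₂ g₁ g₂ x : ThetaChar 3) : ThetaChar 3 :=
  chp x (binChar 9) • a + chp x (binChar 1) • b + chp x (binChar 38) • l₁ +
    chp x (binChar 18) • l₂ + chp x (binChar 36) • g₁ + chp x (binChar 22) • g₂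

theorem frameMap_add (a b l₁ l₂ g₁ g₂ x y : ThetaChar 3) :
    frameMap a b l₁ l₂ g₁ g₂ (x + y) = frameMap a b l₁ l₂ g₁ g₂ x + frameMap a b l₁ l₂ g₁ g₂ y := by
  simp only [frameMap, chp_add_left, add_smul]
  abel

theorem chp_eq_standard (x y : ThetaChar 3) : chp x y =
    chp x (binChar 9) * chp y (binChar 1) + chp x (binChar 1) * chp y (binChar 9) +
    (chp x (binChar 38) * chp y (binChar 18) + chp x (binChar 18) * chp y (binChar 38)) +
    (chp x (binChar 36) * chp y (binChar 22) + chp x (binChar 22) * chp y (binChar 36)) := by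
  obtain ⟨m, hm, rfl⟩ := exists_binChar x
  obtain ⟨n, hn, rfl⟩ := exists_binChar y
  simp only [chp_binChar, ← ite_band, ← ite_xor]
  have : ∀ m < 64, ∀ n < 64, binPair m n =
    ((binPair m 9 && binPair n 1 ^^ binPair m 1 && binPair n 9) ^^
    (binPair m 38 && binPair n 18 ^^ binPair m 18 && binPair n 38) ^^
    (binPair m 36 && binPair n 22 ^^ binPair m 22 && binPair n 36)) := by
    decide +kernel
  rw [this m hm n hn]

theorem chq_eq_standard (x : ThetaChar 3) : chq x =
    chp x (binChar 1) + chp x (binChar 1) * chp x (binChar 9) +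
    (chp x (binChar 38) + chp x (binChar 18) + chp x (binChar 38) * chp x (binChar 18)) +
    (chp x (binChar 36) + chp x (binChar 22) + chp x (binChar 36) * chp x (binChar 22)) := by
  obtain ⟨m, hm, rfl⟩ := exists_binChar x
  simp only [chp_binChar, chq_binChar, ← ite_band, ← ite_xor]
  have : ∀ m < 64, binOdd m =
    ((binPair m 1 ^^ (binPair m 1 && binPair m 9)) ^^
    (binPair m 38 ^^ binPair m 18 ^^ (binPair m 38 && binPair m 18)) ^^
    (binPair m 36 ^^ binPair m 22 ^^ (binPair m 36 && binPair m 22))) := by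
    decide +kernel
  rw [this m hm]

namespace IsFrame

variable {ρ a b l₁ l₂ g₁ g₂ : ThetaChar 3}

theorem chp_frameMap (F : IsFrame ρ a b l₁ l₂ g₁ g₂) (x y : ThetaChar 3) :
    chp (frameMap a b l₁ l₂ g₁ g₂ x) (frameMap a b l₁ l₂ g₁ g₂ y) = chp x y := by
  rw [chp_eq_standard x y]
  simp only [frameMap, chp_add_left, chp_add_right, chp_smul_left, chp_smul_right, chp_self,
      F.ab, F.l₁l₂, F.g₁g₂, F.al₁, F.al₂, F.ag₁,
      F.ag₂, F.bl₁, F.bl₂, F.bg₁, F.bg₂, F.l₁g₁, F.l₁g₂, F.l₂g₁, F.l₂g₂, chp_comm b a,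
      chp_comm l₂ l₁, chp_comm g₂ g₁, chp_comm l₁ a, chp_comm l₂ a, chp_comm g₁ a, chp_comm g₂ a,
      chp_comm l₁ b, chp_comm l₂ b, chp_comm g₁ b, chp_comm g₂ b, chp_comm g₁ l₁, chp_comm g₁ l₂,
      chp_comm g₂ l₁, chp_comm g₂ l₂]
  ring

theorem chq_frameMap (F : IsFrame ρ a b l₁ l₂ g₁ g₂) (x : ThetaChar 3) :
    chq (ρ + frameMap a b l₁ l₂ g₁ g₂ x) = chq x := by
  have h₁ := F.qa
  have h₂ := F.qb
  have h₃ := F.ql₁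
  have h₄ := F.ql₂
  have h₅ := F.qg₁
  have h₆ := F.qg₂
  simp only [chq_add, F.qρ, zero_add] at h₁ h₂ h₃ h₄ h₅ h₆
  rw [chq_eq_standard x]
  simp only [frameMap, chq_add, chq_smul, F.qρ, chp_add_left, chp_add_right, chp_smul_left,
      chp_smul_right, F.ab, F.l₁l₂, F.g₁g₂, F.al₁, F.al₂, F.ag₁,
      F.ag₂, F.bl₁, F.bl₂, F.bg₁, F.bg₂, F.l₁g₁, F.l₁g₂, F.l₂g₁, F.l₂g₂]
  generalize chp x (binChar 9) = x₁
  generalize chp x (binChar 1) = x₂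
  generalize chp x (binChar 38) = x₃
  generalize chp x (binChar 18) = x₄
  generalize chp x (binChar 36) = x₅
  generalize chp x (binChar 22) = x₆
  linear_combination x₁ * h₁ + x₂ * h₂ + x₃ * h₃ + x₄ * h₄ + x₅ * h₅ + x₆ * h₆

theorem map (F : IsFrame ρ a b l₁ l₂ g₁ g₂) {ρ' a' b' l₁' l₂' g₁' g₂' : ThetaChar 3}
    (F' : IsFrame ρ' a' b' l₁' l₂' g₁' g₂') :
    IsFrame (ρ + frameMap a b l₁ l₂ g₁ g₂ ρ') (frameMap a b l₁ l₂ g₁ g₂ a')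
      (frameMap a b l₁ l₂ g₁ g₂ b') (frameMap a b l₁ l₂ g₁ g₂ l₁') (frameMap a b l₁ l₂ g₁ g₂ l₂')
      (frameMap a b l₁ l₂ g₁ g₂ g₁') (frameMap a b l₁ l₂ g₁ g₂ g₂') := by
  obtain ⟨c1, c2, c3, c4, c5, c6, c7, c8, c9, c10, c11, c12, c13, c14, c15, c16, c17, c18, c19,
    c20, c21, c22⟩ := F'
  constructor <;> simp only [add_assoc, ← frameMap_add, F.chp_frameMap, F.chq_frameMap] <;>
    assumption

theorem frameMap_surjective (F : IsFrame ρ a b l₁ l₂ g₁ g₂) :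
    Function.Surjective (frameMap a b l₁ l₂ g₁ g₂) := by
  refine Finite.surjective_of_injective fun x y h => eq_of_char_add_eq_zero ?_
  refine eq_zero_of_chp_eq_zero fun z => ?_
  rw [← F.chp_frameMap, frameMap_add, h, char_add_self, chp_zero_left]

theorem frameClosed (F : IsFrame ρ a b l₁ l₂ g₁ g₂) {K : ThetaChar 3 → Prop} (hK : FrameClosed K)
    (h : ∀ y ∈ ({0, l₁ + g₁, l₁ + g₂, l₁ + g₁ + g₂} : Finset (ThetaChar 3)), K (ρ + b + y))
    (n : ThetaChar 3) (hn : chq n = 1) : K n := by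
  let L := frameMap a b l₁ l₂ g₁ g₂
  have hb : L (binChar 9) = b := by
    simp [L, frameMap, chp_binChar, binPair, binOdd, Nat.testBit]
  have hl₁ : L (binChar 18) = l₁ := by
    simp [L, frameMap, chp_binChar, binPair, binOdd, Nat.testBit]
  have hg₁ : L (binChar 22) = g₁ := by
    simp [L, frameMap, chp_binChar, binPair, binOdd, Nat.testBit]
  have hg₂ : L (binChar 36) = g₂ := by
    simp [L, frameMap, chp_binChar, binPair, binOdd, Nat.testBit]
  have hL : FrameClosed fun x => K (ρ + L x) := by
    intro ρ' a' b' l₁' l₂' g₁' g₂' F' h1 h2 h3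
    have := hK _ _ _ _ _ _ _ (F.map F')
    simp only [add_assoc, ← frameMap_add] at this h1 h2 h3
    exact this h1 h2 h3
  have h4 : ∀ n ∈ [9, 13, 63, 41], K (ρ + L (binChar n)) := by
    have e1 : L (binChar 13) = b + (l₁ + g₁) := by
      rw [← hb, ← hl₁, ← hg₁, ← frameMap_add, ← frameMap_add, ← binChar_xor, ← binChar_xor]
      rfl
    have e2 : L (binChar 63) = b + (l₁ + g₂) := by
      rw [← hb, ← hl₁, ← hg₂, ← frameMap_add, ← frameMap_add, ← binChar_xor, ← binChar_xor]
      rfl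
    have e3 : L (binChar 41) = b + (l₁ + g₁ + g₂) := by
      rw [← hb, ← hl₁, ← hg₁, ← hg₂, ← frameMap_add, ← frameMap_add, ← frameMap_add,
        ← binChar_xor, ← binChar_xor, ← binChar_xor]
      rfl
    intro n hn
    simp only [Finset.mem_insert, Finset.mem_singleton, forall_eq_or_imp, forall_eq] at h
    simp only [List.mem_cons, List.not_mem_nil, or_false] at hn
    rcases hn with rfl | rfl | rfl | rfl
    · rw [hb]; simpa using h.1
    · rw [e1, ← add_assoc]; exact h.2.1
    · rw [e2, ← add_assoc]; exact h.2.2.1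
    · rw [e3, ← add_assoc]; exact h.2.2.2
  obtain ⟨x, hx⟩ := F.frameMap_surjective (ρ + n)
  have hn' : ρ + L x = n := by
    change ρ + frameMap a b l₁ l₂ g₁ g₂ x = n
    rw [hx, ← add_assoc, char_add_self, zero_add]
  have := hL.standard h4 x (by rw [← F.chq_frameMap x]; exact hn' ▸ hn)
  rwa [hn'] at this

end IsFrame

theorem IsSiegel.exists_lattice_near {g : ℕ} {τ : Matrix (Fin g) (Fin g) ℂ} (hτ : IsSiegel τ) :
    ∃ R : ℝ, ∀ z : Fin g → ℂ, ∃ k l : Fin g → ℤ,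
      ‖fun i => z i - (∑ j, τ i j * k j + l i)‖ ≤ R := by
  set Y : Matrix (Fin g) (Fin g) ℝ := Matrix.of fun i j => (τ i j).im
  have hY : IsUnit Y.det := hτ.2.det_pos.ne'.isUnit
  refine ⟨∑ i, ∑ j, ‖τ i j‖ + 1, fun z => ?_⟩
  set y : Fin g → ℝ := Y⁻¹ *ᵥ fun i => (z i).im
  have hy : ∀ i, ∑ j, (τ i j).im * y j = (z i).im := by
    intro i
    have : (Y *ᵥ y) i = (z i).im := by
      simp only [y, Matrix.mulVec_mulVec, Matrix.mul_nonsing_inv Y hY, Matrix.one_mulVec]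
    exact this
  set x : Fin g → ℝ := fun i => (z i).re - ∑ j, (τ i j).re * y j
  refine ⟨fun j => ⌊y j⌋, fun i => ⌊x i⌋, ?_⟩
  have hz : ∀ i, z i = ∑ j, τ i j * y j + x i := by
    intro i
    apply Complex.ext
    · simp [x]
    · simp [hy]
  have h0 : 0 ≤ ∑ i, ∑ j, ‖τ i j‖ + 1 := by positivity
  rw [pi_norm_le_iff_of_nonneg h0]
  intro i
  have e : z i - (∑ j, τ i j * (⌊y j⌋ : ℤ) + (⌊x i⌋ : ℤ)) =
      ∑ j, τ i j * (Int.fract (y j) : ℝ) + (Int.fract (x i) : ℝ) := by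
    rw [hz i]
    simp only [Int.fract, ofReal_sub, mul_sub, Finset.sum_sub_distrib, ofReal_intCast]
    ring
  have hfr : ∀ t : ℝ, ‖((Int.fract t : ℝ) : ℂ)‖ ≤ 1 := by
    intro t
    rw [Complex.norm_real, Real.norm_of_nonneg (Int.fract_nonneg t)]
    exact (Int.fract_lt_one t).le
  rw [e]
  refine (norm_add_le _ _).trans (add_le_add ((norm_sum_le _ _).trans ?_) (hfr _))
  refine le_trans (Finset.sum_le_sum fun j _ => ?_)
    (Finset.single_le_sum (f := fun i => ∑ j, ‖τ i j‖)
      (fun i _ => Finset.sum_nonneg fun j _ => norm_nonneg _) (Finset.mem_univ i))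
  rw [norm_mul]
  exact mul_le_of_le_one_right (norm_nonneg _) (hfr _)

/-- A nowhere vanishing entire function which is multiplied by constants under a full lattice of
translations is the exponential of an affine function. -/
theorem IsSiegel.eq_exp_of_quasiperiodic {g : ℕ} {τ : Matrix (Fin g) (Fin g) ℂ} (hτ : IsSiegel τ)
    {h : (Fin g → ℂ) → ℂ} (hd : Differentiable ℂ h) (h0 : ∀ z, h z ≠ 0)
    (hc : ∀ k l : Fin g → ℤ, ∃ c, ∀ z, h (fun i => z i + (∑ j, τ i j * k j + l i)) = c * h z)
    (v : Fin g → ℂ) : h v = h 0 * cexp (fderiv ℂ h 0 v / h 0) := by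
  obtain ⟨R, hR⟩ := hτ.exists_lattice_near
  obtain ⟨C, hC⟩ : ∃ C, ∀ p ∈ Metric.closedBall (0 : Fin g → ℂ) R ×ˢ Metric.closedBall (0 : ℂ) 1,
      ‖h (p.1 + p.2 • v) / h p.1‖ ≤ C := by
    refine ((isCompact_closedBall _ _).prod (isCompact_closedBall _ _)).exists_bound_of_continuousOn
      (f := fun p : (Fin g → ℂ) × ℂ => h (p.1 + p.2 • v) / h p.1) ?_
    refine ContinuousOn.div ?_ ?_ fun p _ => h0 _
    · exact (hd.continuous.comp (by fun_prop)).continuousOn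
    · exact (hd.continuous.comp continuous_fst).continuousOn
  have hC' : ∀ (z : Fin g → ℂ) (s : ℂ), ‖s‖ ≤ 1 → ‖h (z + s • v)‖ ≤ C * ‖h z‖ := by
    intro z s hs
    obtain ⟨k, l, hkl⟩ := hR z
    obtain ⟨c, hc⟩ := hc k l
    set z₀ : Fin g → ℂ := fun i => z i - (∑ j, τ i j * k j + l i)
    have e1 : z = fun i => z₀ i + (∑ j, τ i j * k j + l i) := by
      funext i; simp [z₀]
    have e2 : z + s • v = fun i => (z₀ + s • v) i + (∑ j, τ i j * k j + l i) := by
      funext i; simp [z₀]; ring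
    have h1 : ‖h (z₀ + s • v) / h z₀‖ ≤ C :=
      hC (z₀, s) ⟨by simpa using hkl, by simpa using hs⟩
    rw [norm_div, div_le_iff₀ (norm_pos_iff.2 (h0 _))] at h1
    rw [e2, hc]
    conv_rhs => rw [e1, hc]
    rw [norm_mul, norm_mul, mul_left_comm]
    exact mul_le_mul_of_nonneg_left h1 (norm_nonneg _)
  set k : ℂ → ℂ := fun t => h (t • v)
  have hk : Differentiable ℂ k := hd.comp (by fun_prop)
  have hk0 : ∀ t, k t ≠ 0 := fun t => h0 _
  have hb : ∀ t, ‖deriv k t / k t‖ ≤ C := by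
    intro t
    rw [norm_div, div_le_iff₀ (norm_pos_iff.2 (hk0 _))]
    have := Complex.norm_deriv_le_of_forall_mem_sphere_norm_le (c := t) (f := k)
      (C := C * ‖k t‖) one_pos hk.diffContOnCl ?_
    · simpa using this
    · intro w hw
      have hw' : ‖w - t‖ ≤ 1 := by
        rw [← dist_eq_norm]; exact (Metric.mem_sphere.1 hw).le
      have := hC' (t • v) (w - t) hw'
      rwa [← add_smul, add_sub_cancel] at this
  have hq : Differentiable ℂ fun t => deriv k t / k t := by
    refine Differentiable.div ?_ hk hk0
    exact hk.contDiff.differentiable_deriv_two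
  have hconst : ∀ t, deriv k t / k t = deriv k 0 / k 0 := fun t =>
    hq.apply_eq_apply_of_bounded (isBounded_iff_forall_norm_le.2 ⟨C, by
      rintro _ ⟨t, rfl⟩; exact hb t⟩) t 0
  set q := deriv k 0 / k 0
  have hder : ∀ t, HasDerivAt (fun t => k t * cexp (-(t * q))) 0 t := by
    intro t
    have h1 := (hk t).hasDerivAt
    have h2 : HasDerivAt (fun t => cexp (-(t * q))) (cexp (-(t * q)) * -(1 * q)) t :=
      (((hasDerivAt_id t).mul_const q).neg).cexp
    refine (h1.fun_mul h2).congr_deriv ?_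
    rw [(div_eq_iff (hk0 t)).1 (hconst t)]
    ring
  have h1 := is_const_of_deriv_eq_zero (fun t => (hder t).differentiableAt)
    (fun t => (hder t).deriv) 1 0
  have h2 : deriv k 0 = fderiv ℂ h 0 v := by
    have h3 : HasDerivAt (fun t : ℂ => t • v) v 0 := by
      simpa using (hasDerivAt_id (0 : ℂ)).smul_const v
    have h4 := (hd ((0 : ℂ) • v)).hasFDerivAt.comp_hasDerivAt 0 h3
    rw [zero_smul] at h4
    exact h4.deriv
  simp only [one_mul, zero_mul, neg_zero, Complex.exp_zero, mul_one] at h1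
  have h5 : k 0 = h 0 := by simp [k]
  have h6 : k 1 = h v := by simp [k]
  have h7 : k 1 = k 0 * cexp q := by
    rw [← h1, mul_assoc, ← Complex.exp_add, neg_add_cancel, Complex.exp_zero, mul_one]
  rw [← h6, h7, ← h5, ← h2]

theorem exists_continuous_log {g : ℕ} {h : (Fin g → ℂ) → ℂ} (hc : Continuous h)
    (h0 : ∀ z, h z ≠ 0) : ∃ H : (Fin g → ℂ) → ℂ, Continuous H ∧ ∀ z, h z = cexp (H z) := by
  obtain ⟨H, ⟨-, hH⟩, -⟩ := Complex.isCoveringMapOn_exp.existsUnique_continuousMap_lifts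
    ⟨h, hc⟩ (Complex.exp_log (h0 0)) h0
  exact ⟨H, H.continuous, fun z => (congrFun hH z).symm⟩

/-- Two projectively equal families of entire functions without common zeros differ by a nowhere
vanishing entire factor. -/
theorem exists_entire_ratio {ι E : Type*} [NormedAddCommGroup E] [NormedSpace ℂ E]
    {X Y : ι → E → ℂ} (hX : ∀ m, Differentiable ℂ (X m)) (hY : ∀ m, Differentiable ℂ (Y m))
    (hX0 : ∀ z, ∃ m, X m z ≠ 0) (hY0 : ∀ z, ∃ m, Y m z ≠ 0)
    (h : ∀ m n z, X m z * Y n z = X n z * Y m z) :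
    ∃ f : E → ℂ, Differentiable ℂ f ∧ (∀ z, f z ≠ 0) ∧ ∀ m z, Y m z = f z * X m z := by
  choose m hm using hX0
  have key : ∀ n z, Y n z = Y (m z) z / X (m z) z * X n z := by
    intro n z
    rw [div_mul_eq_mul_div, eq_div_iff (hm z), mul_comm, h, mul_comm]
  refine ⟨fun z => Y (m z) z / X (m z) z, fun z₀ => ?_, fun z hz => ?_, key⟩
  · have h1 : DifferentiableAt ℂ (fun z => Y (m z₀) z / X (m z₀) z) z₀ := by
      simp only [div_eq_mul_inv]
      exact (hY _ z₀).fun_mul ((hX _ z₀).fun_inv (hm z₀))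
    refine h1.congr_of_eventuallyEq ?_
    filter_upwards [(hX (m z₀)).continuous.continuousAt.eventually_ne (hm z₀)] with z hz
    rw [eq_div_iff hz]
    exact (key _ z).symm
  · obtain ⟨n, hn⟩ := hY0 z
    exact hn (by rw [key n z, show Y (m z) z / X (m z) z = 0 from hz, zero_mul])

noncomputable section

/-- The point `τ k + l` of the period lattice. -/
def latticePoint {g : ℕ} (τ : Matrix (Fin g) (Fin g) ℂ) (k l : Fin g → ℤ) : Fin g → ℂ :=
  fun i => ∑ j, τ i j * k j + l i

/-- The automorphy factor of the theta functions, up to sign. -/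
def thetaFactor {g : ℕ} (τ : Matrix (Fin g) (Fin g) ℂ) (k : Fin g → ℤ) (z : Fin g → ℂ) : ℂ :=
  cexp (-(Real.pi * I * ∑ i, ∑ j, (k i : ℂ) * τ i j * k j) -
    2 * Real.pi * I * ∑ i, (k i : ℂ) * z i)

/-- The sign in the automorphy factor of `θ_m`. -/
def thetaSign {g : ℕ} (m : ThetaChar g) (k l : Fin g → ℤ) : ℂ :=
  sgn ((m.1 ⬝ᵥ fun i => (l i : ZMod 2)) + (m.2 ⬝ᵥ fun i => (k i : ZMod 2)))

end

theorem thetaFactor_ne_zero {g : ℕ} (τ : Matrix (Fin g) (Fin g) ℂ) (k : Fin g → ℤ)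
    (z : Fin g → ℂ) : thetaFactor τ k z ≠ 0 := Complex.exp_ne_zero _

theorem thetaSign_ne_zero {g : ℕ} (m : ThetaChar g) (k l : Fin g → ℤ) : thetaSign m k l ≠ 0 :=
  sgn_ne_zero _

theorem thetaSign_mul_self {g : ℕ} (m : ThetaChar g) (k l : Fin g → ℤ) :
    thetaSign m k l * thetaSign m k l = 1 := sgn_mul_self _

theorem thetaC_add_lattice {g : ℕ} {τ : Matrix (Fin g) (Fin g) ℂ} (hτ : IsSiegel τ)
    (m : ThetaChar g) (k l : Fin g → ℤ) (z : Fin g → ℂ) :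
    thetaC τ m (z + latticePoint τ k l) =
      thetaSign m k l * thetaFactor τ k z * thetaC τ m z := by
  have e : z + latticePoint τ k l = fun i => (fun i => z i + ∑ j, τ i j * k j) i + l i := by
    funext i; simp [latticePoint, add_assoc]
  rw [e, thetaC_add_period, thetaC_add_tau hτ.1, thetaSign, thetaFactor, sgn_add]
  ring

theorem thetaFactor_add {g : ℕ} (τ : Matrix (Fin g) (Fin g) ℂ) (k : Fin g → ℤ)
    (z w : Fin g → ℂ) : thetaFactor τ k (z + w) =
      cexp (-(2 * Real.pi * I * ∑ i, (k i : ℂ) * w i)) * thetaFactor τ k z := by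
  simp only [thetaFactor, ← Complex.exp_add, Pi.add_apply, mul_add, Finset.sum_add_distrib]
  congr 1; ring

/-- A translation under which the theta functions stay projectively proportional is a period. -/
theorem IsSiegel.exists_eq_latticePoint {g : ℕ} {τ : Matrix (Fin g) (Fin g) ℂ} (hτ : IsSiegel τ)
    (h0 : thetaC τ 0 0 ≠ 0) {ε : ThetaChar g → ℂ} (hε : ∀ m, ε m ≠ 0) {w : Fin g → ℂ}
    (hw : ∀ m n z, thetaC τ m z * (ε n * thetaC τ n (z + w)) =
      thetaC τ n z * (ε m * thetaC τ m (z + w))) :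
    ∃ k l : Fin g → ℤ, w = latticePoint τ k l := by
  obtain ⟨f, hf, hf0, hfe⟩ := exists_entire_ratio (X := thetaC τ)
    (Y := fun m z => ε m * thetaC τ m (z + w)) (differentiable_thetaC hτ)
    (fun m => ((differentiable_thetaC hτ m).comp (by fun_prop)).const_mul _)
    (exists_thetaC_ne_zero hτ h0)
    (fun z => (exists_thetaC_ne_zero hτ h0 (z + w)).imp fun m hm => mul_ne_zero (hε m) hm) hw
  have hper : ∀ (k l : Fin g → ℤ) (z), f (z + latticePoint τ k l) =
      cexp (-(2 * Real.pi * I * ∑ i, (k i : ℂ) * w i)) * f z := by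
    intro k l z
    obtain ⟨m, hm⟩ := exists_thetaC_ne_zero hτ h0 z
    have h1 := hfe m (z + latticePoint τ k l)
    have h2 := hfe m z
    rw [add_right_comm, thetaC_add_lattice hτ, thetaC_add_lattice hτ, thetaFactor_add] at h1
    refine mul_right_cancel₀ (mul_ne_zero (mul_ne_zero (thetaSign_ne_zero m k l)
      (thetaFactor_ne_zero τ k z)) hm) ?_
    rw [← h1]
    linear_combination (thetaSign m k l * thetaFactor τ k z *
      cexp (-(2 * Real.pi * I * ∑ i, (k i : ℂ) * w i))) * h2
  have hexp := hτ.eq_exp_of_quasiperiodic hf hf0 fun k l => ⟨_, hper k l⟩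
  set ℓ : Fin g → ℂ := fun j => fderiv ℂ f 0 (Pi.single j 1) / f 0
  have hℓ : ∀ v, fderiv ℂ f 0 v / f 0 = ∑ j, v j * ℓ j := by
    intro v
    conv_lhs => rw [pi_eq_sum_univ' v]
    simp [ℓ, map_sum, Finset.sum_div, mul_div_assoc]
  have hlat : ∀ k l : Fin g → ℤ, ∃ n : ℤ, ∑ j, latticePoint τ k l j * ℓ j =
      -(2 * Real.pi * I * ∑ i, (k i : ℂ) * w i) + n * (2 * Real.pi * I) := by
    intro k l
    have h1 := hper k l 0
    rw [zero_add, hexp, mul_comm, hℓ] at h1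
    exact Complex.exp_eq_exp_iff_exists_int.1 (mul_right_cancel₀ (hf0 0) h1)
  have hπ : (2 * Real.pi * I : ℂ) ≠ 0 := Complex.two_pi_I_ne_zero
  choose p hp using fun j => hlat 0 (Pi.single j 1)
  choose q hq using fun j => hlat (Pi.single j 1) 0
  have hp' : ∀ j, ℓ j = p j * (2 * Real.pi * I) := by
    intro j
    have := hp j
    simpa [latticePoint, Pi.single_apply] using this
  have hq' : ∀ j, ∑ i, τ i j * ℓ i = -(2 * Real.pi * I * w j) + q j * (2 * Real.pi * I) := by
    intro j
    have := hq j
    simpa [latticePoint, Pi.single_apply] using this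
  refine ⟨-p, q, funext fun j => mul_left_cancel₀ hπ ?_⟩
  have h3 := hq' j
  simp only [hp'] at h3
  have h4 : ∑ i, τ i j * (p i * (2 * Real.pi * I)) =
      2 * Real.pi * I * ∑ i, τ j i * p i := by
    rw [Finset.mul_sum]
    refine Finset.sum_congr rfl fun i _ => ?_
    rw [hτ.1.apply j i]; ring
  rw [h4] at h3
  simp only [latticePoint, Pi.neg_apply, Int.cast_neg, mul_neg, Finset.sum_neg_distrib]
  linear_combination h3

/-- Entire solutions of the same homogeneous quadratic Wronskian system with the same initial value
are projectively equal. -/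
theorem eq_of_quadratic_wronskian {ι κ : Type*} [Fintype ι] [Fintype κ] {X Y : ι → ℂ → ℂ} {o : ι}
    (hX : ∀ m, Differentiable ℂ (X m)) (hY : ∀ m, Differentiable ℂ (Y m))
    (h0 : X o 0 ≠ 0) (hi : ∀ m, Y m 0 = X m 0) (c : ι → κ → ℂ) (p q : ι → κ → ι)
    (hXw : ∀ m t, deriv (X m) t * X o t - X m t * deriv (X o) t =
      ∑ h, c m h * (X (p m h) t * X (q m h) t))
    (hYw : ∀ m t, deriv (Y m) t * Y o t - Y m t * deriv (Y o) t =
      ∑ h, c m h * (Y (p m h) t * Y (q m h) t)) (m : ι) (t : ℂ) :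
    X m t * Y o t = Y m t * X o t := by
  set v : (ι → ℂ) → ι → ℂ := fun x m => ∑ h, c m h * (x (p m h) * x (q m h))
  have hv : ContDiff ℝ 1 v := by
    refine contDiff_pi.2 fun m => ContDiff.sum fun h _ => ?_
    fun_prop
  have sol : ∀ Z : ι → ℂ → ℂ, (∀ m, Differentiable ℂ (Z m)) → Z o 0 ≠ 0 →
      (∀ m t, deriv (Z m) t * Z o t - Z m t * deriv (Z o) t =
        ∑ h, c m h * (Z (p m h) t * Z (q m h) t)) →
      ∀ᶠ s : ℝ in nhds 0, HasDerivAt (fun (s : ℝ) m => Z m s / Z o s)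
        (v fun m => Z m s / Z o s) s := by
    intro Z hZ hZ0 hZw
    have hne : ∀ᶠ s : ℝ in nhds 0, Z o s ≠ 0 :=
      ((hZ o).continuous.comp continuous_ofReal).continuousAt.eventually_ne (by simpa using hZ0)
    filter_upwards [hne] with s hs
    refine hasDerivAt_pi.2 fun m => ?_
    refine ((((hZ m s).hasDerivAt.div (hZ o s).hasDerivAt hs)).comp_ofReal).congr_deriv ?_
    rw [hZw, Finset.sum_div]
    refine Finset.sum_congr rfl fun h _ => ?_
    field_simp
  set x₀ : ι → ℂ := fun m => X m 0 / X o 0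
  obtain ⟨K, s, hs, hK⟩ := (hv.contDiffAt (x := x₀)).exists_lipschitzOnWith
  have hX1 := sol X hX h0 hXw
  have hY1 := sol Y hY (by rwa [hi]) hYw
  have mem : ∀ Z : ι → ℂ → ℂ, (∀ m, Z m 0 = X m 0) →
      (∀ᶠ s : ℝ in nhds 0, HasDerivAt (fun (s : ℝ) m => Z m s / Z o s)
        (v fun m => Z m s / Z o s) s) →
      ∀ᶠ r : ℝ in nhds 0, (fun m => Z m r / Z o r) ∈ s := by
    intro Z hZ hZ1
    have h1 := hZ1.self_of_nhds.continuousAt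
    refine h1.preimage_mem_nhds ?_
    simpa [hZ] using hs
  have heq := ODE_solution_unique_of_eventually (v := fun _ => v) (s := fun _ => s) (t₀ := (0 : ℝ))
    (.of_forall fun _ => hK) (hX1.and (mem X (fun _ => rfl) hX1)) (hY1.and (mem Y hi hY1))
    (by simp [hi])
  have hne : ∀ Z : ℂ → ℂ, Differentiable ℂ Z → Z 0 ≠ 0 → ∀ᶠ s : ℝ in nhds 0, Z s ≠ 0 :=
    fun Z hZ hZ0 =>
      (hZ.continuous.comp continuous_ofReal).continuousAt.eventually_ne (by simpa using hZ0)
  have hreal : ∀ᶠ s : ℝ in nhds 0, X m s * Y o s = Y m s * X o s := by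
    filter_upwards [heq, hne _ (hX o) h0, hne _ (hY o) (by rwa [hi])] with s h1 h2 h3
    have h4 : X m s / X o s = Y m s / Y o s := congrFun h1 m
    rwa [div_eq_div_iff h2 h3] at h4
  have hF : Differentiable ℂ fun t => X m t * Y o t := (hX m).mul (hY o)
  have hG : Differentiable ℂ fun t => Y m t * X o t := (hY m).mul (hX o)
  refine congrFun (AnalyticOnNhd.eq_of_frequently_eq (z₀ := (0 : ℂ))
    (hF.differentiableOn.analyticOnNhd isOpen_univ) (hG.differentiableOn.analyticOnNhd isOpen_univ) ?_) t
  have hmap : Filter.Tendsto (fun s : ℝ => (s : ℂ)) (nhdsWithin 0 {0}ᶜ) (nhdsWithin 0 {0}ᶜ) := by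
    refine tendsto_nhdsWithin_iff.2 ⟨?_, ?_⟩
    · exact (continuous_ofReal.tendsto' 0 0 (by simp)).mono_left nhdsWithin_le_nhds
    · filter_upwards [self_mem_nhdsWithin] with s hs
      simpa using hs
  exact hmap.frequently (hreal.filter_mono nhdsWithin_le_nhds).frequently

theorem exists_even_quadruple {a d : ThetaChar 3} (had : chp a d = 0) :
    ∃ r, chq r = 0 ∧ chq (r + a) = 0 ∧ chq (r + d) = 0 ∧ chq (r + a + d) = 0 := by
  obtain ⟨a, ha, rfl⟩ := exists_binChar a
  obtain ⟨d, hd, rfl⟩ := exists_binChar d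
  have key : ∀ a < 64, ∀ d < 64, binPair a d = false →
      ∃ r < 64, binOdd r = false ∧ binOdd (r ^^^ a) = false ∧ binOdd (r ^^^ d) = false ∧
        binOdd (r ^^^ a ^^^ d) = false := by
    decide +kernel
  obtain ⟨r, -, h⟩ := key a ha d hd (by
    rw [chp_binChar] at had
    simpa using had)
  refine ⟨binChar r, ?_⟩
  simpa only [← binChar_xor, chq_binChar, ite_eq_right_iff, one_ne_zero, imp_false,
    Bool.not_eq_true] using h

theorem exists_even_pair (a : ThetaChar 3) : ∃ r, chq r = 0 ∧ chq (r + a) = 0 := by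
  obtain ⟨r, h1, h2, -⟩ := exists_even_quadruple (a := a) (d := 0) (chp_zero_right a)
  exact ⟨r, h1, h2⟩

/-- A vector killed by all odd theta gradients is zero. -/
theorem IsSiegel.eq_zero_of_thetaD_eq_zero {τ : Matrix (Fin 3) (Fin 3) ℂ} (hτ : IsSiegel τ)
    (hev : ∀ m, chq m = 0 → thetaC τ m 0 ≠ 0) {u : Fin 3 → ℂ}
    (hu : ∀ n, chq n = 1 → thetaD τ n u 0 = 0) : u = 0 := by
  have hu' : ∀ n, thetaD τ n u 0 = 0 := fun n =>
    (zmod_two_cases (chq n)).elim (fun h => thetaD_zero_of_even hτ h u) (hu n)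
  have hW : ∀ m n x, thetaD τ m u x * thetaC τ n x - thetaC τ m x * thetaD τ n u x = 0 := by
    intro m n x
    obtain ⟨r, h1, h2⟩ := exists_even_pair (m + n)
    obtain ⟨d, hd⟩ := riemann_relation_deriv_one (m + n) n r
    have h3 := hd τ hτ x u
    rw [show n + (m + n) = m by rw [add_left_comm, char_add_self, add_zero]] at h3
    simp only [hu', zero_mul, mul_zero, add_zero, Finset.sum_const_zero] at h3
    exact (mul_eq_zero.1 h3).resolve_right (mul_ne_zero (hev _ h2) (hev _ h1))
  have hprop : ∀ (c : ℂ) m n x, thetaC τ m x * (1 * thetaC τ n (x + c • u)) =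
      thetaC τ n x * (1 * thetaC τ m (x + c • u)) := by
    intro c m n x
    obtain ⟨o, ho⟩ := exists_thetaC_ne_zero hτ (hev 0 chq_zero) x
    have key : ∀ m, thetaC τ m (x + c • u) * thetaC τ o x =
        thetaC τ m x * thetaC τ o (x + c • u) := fun m =>
      eq_of_quadratic_wronskian (κ := Unit) (X := fun m t => thetaC τ m (x + t • u))
        (Y := fun m _ => thetaC τ m x) (o := o)
        (fun m => fun t => (hasDerivAt_thetaC_line hτ m x u t).differentiableAt)
        (fun m => differentiable_const _) (by simpa using ho) (by simp) (fun _ _ => 0)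
        (fun m _ => m) (fun m _ => m)
        (fun m t => by
          rw [(hasDerivAt_thetaC_line hτ m x u t).deriv, (hasDerivAt_thetaC_line hτ o x u t).deriv,
            hW]
          simp)
        (fun m t => by simp) m c
    refine mul_right_cancel₀ ho ?_
    linear_combination thetaC τ m x * key n - thetaC τ n x * key m
  have hlat : ∀ c : ℂ, ∃ k l : Fin 3 → ℤ, c • u = latticePoint τ k l := fun c =>
    hτ.exists_eq_latticePoint (hev 0 chq_zero) (fun _ => one_ne_zero) (hprop c)
  choose k l hkl using hlat
  by_contra hne
  have hinj : Function.Injective fun c : ℂ => (k c, l c) := by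
    intro c c' h
    simp only [Prod.mk.injEq] at h
    have h1 : c • u = c' • u := by rw [hkl, hkl, h.1, h.2]
    exact smul_left_injective ℂ hne h1
  have := hinj.countable
  exact not_countable_complex Set.countable_univ

namespace IsFrame

variable {ρ a b l₁ l₂ g₁ g₂ : ThetaChar 3}

theorem parity (F : IsFrame ρ a b l₁ l₂ g₁ g₂) {y : ThetaChar 3}
    (hy : y ∈ ({0, l₁ + g₁, l₁ + g₂, l₁ + g₁ + g₂} : Finset (ThetaChar 3))) :
    chq (ρ + y) = 0 ∧ chq (ρ + y + a) = 0 ∧ chq (ρ + b + y + a) = 0 ∧ chq (ρ + b + y) = 1 := by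
  rw [Finset.mem_insert] at hy
  rcases hy with rfl | hy
  · have h := F.chq_left 0 0
    have h1 := h 0 0
    have h2 := h 0 1
    have h3 := h 1 1
    have h4 := h 1 0
    simp only [zero_smul, one_smul, zero_add, add_zero, mul_zero, ← add_assoc] at h1 h2 h3 h4 ⊢
    exact ⟨h1, h2, h3.trans (by decide), h4⟩
  · obtain ⟨e₁, e₂, rfl, he⟩ : ∃ e₁ e₂ : ZMod 2, y = l₁ + e₁ • g₁ + e₂ • g₂ ∧
        e₁ + e₂ + e₁ * e₂ = 1 := by
      simp only [Finset.mem_insert, Finset.mem_singleton] at hy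
      rcases hy with rfl | rfl | rfl
      · exact ⟨1, 0, by simp, by decide⟩
      · exact ⟨0, 1, by simp, by decide⟩
      · exact ⟨1, 1, by simp, by decide⟩
    have h : ∀ e₃ e₄ : ZMod 2, chq (ρ + e₃ • b + (l₁ + e₁ • g₁ + e₂ • g₂) + e₄ • a) =
        e₃ + e₃ * e₄ := by
      intro e₃ e₄
      have := F.chq_right e₁ e₂ e₃ e₄
      rw [show ρ + e₃ • b + (l₁ + e₁ • g₁ + e₂ • g₂) + e₄ • a =
        ρ + l₁ + (e₁ • g₁ + e₂ • g₂ + e₃ • b + e₄ • a) by abel, this, add_assoc 1 e₁, add_assoc 1,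
        he, show (1 + 1 : ZMod 2) = 0 from rfl, zero_add]
    have h1 := h 0 0
    have h2 := h 0 1
    have h3 := h 1 1
    have h4 := h 1 0
    simp only [zero_smul, one_smul, add_zero, mul_zero, zero_mul, mul_one] at h1 h2 h3 h4
    exact ⟨h1, h2, h3.trans (by decide), h4⟩

theorem sum_eq (F : IsFrame ρ a b l₁ l₂ g₁ g₂) (f : ThetaChar 3 → ℂ) :
    ∑ y ∈ ({0, l₁ + g₁, l₁ + g₂, l₁ + g₁ + g₂} : Finset (ThetaChar 3)), f y =
      f 0 + (f (l₁ + g₁) + (f (l₁ + g₂) + f (l₁ + g₁ + g₂))) := by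
  have h0 : ∀ x y, chp l₂ x ≠ chp l₂ y → x ≠ y := fun x y h e => h (by rw [e])
  have h1 : ∀ x y, chp g₁ x ≠ chp g₁ y → x ≠ y := fun x y h e => h (by rw [e])
  have h2 : ∀ x y, chp g₂ x ≠ chp g₂ y → x ≠ y := fun x y h e => h (by rw [e])
  have c1 : chp g₁ l₁ = 0 := by rw [chp_comm, F.l₁g₁]
  have c2 : chp g₂ l₁ = 0 := by rw [chp_comm, F.l₁g₂]
  have c3 : chp l₂ l₁ = 1 := by rw [chp_comm, F.l₁l₂]
  have c4 : chp g₂ g₁ = 1 := by rw [chp_comm, F.g₁g₂]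
  rw [Finset.sum_insert, Finset.sum_insert, Finset.sum_insert, Finset.sum_singleton]
  · simp only [Finset.mem_singleton]
    exact h2 _ _ (by simp [chp_add_right, c2, c4, chp_self])
  · simp only [Finset.mem_insert, Finset.mem_singleton, not_or]
    exact ⟨h1 _ _ (by simp [chp_add_right, c1, F.g₁g₂, chp_self]),
      h1 _ _ (by simp [chp_add_right, c1, F.g₁g₂, chp_self])⟩
  · simp only [Finset.mem_insert, Finset.mem_singleton, not_or]
    refine ⟨h0 _ _ ?_, h0 _ _ ?_, h0 _ _ ?_⟩ <;>
      simp [chp_add_right, chp_zero_right, c3, F.l₂g₁, F.l₂g₂]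

/-- Three of the four gradients in a frame relation have no common zero. -/
theorem eq_zero_of_thetaD (F : IsFrame ρ a b l₁ l₂ g₁ g₂) {τ : Matrix (Fin 3) (Fin 3) ℂ}
    (hτ : IsSiegel τ) (hev : ∀ m, chq m = 0 → thetaC τ m 0 ≠ 0) {u : Fin 3 → ℂ}
    (h₁ : thetaD τ (ρ + b + (l₁ + g₁)) u 0 = 0) (h₂ : thetaD τ (ρ + b + (l₁ + g₂)) u 0 = 0)
    (h₃ : thetaD τ (ρ + b + (l₁ + g₁ + g₂)) u 0 = 0) : u = 0 := by
  have closed : FrameClosed fun n => thetaD τ n u 0 = 0 := by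
    intro ρ a b l₁ l₂ g₁ g₂ F h₁ h₂ h₃
    obtain ⟨k, hk, hrel⟩ := F.exists_relation
    have h := hrel τ hτ u
    obtain ⟨p1, p2, p3, -⟩ := F.parity (y := 0) (by simp)
    rw [F.sum_eq] at h
    simp only [h₁, h₂, h₃, mul_zero, add_zero, mul_eq_zero, hk, false_or] at h p1 p2 p3 ⊢
    simpa [hev _ p1, hev _ p2, hev _ p3] using h
  refine hτ.eq_zero_of_thetaD_eq_zero hev (F.frameClosed closed fun y hy => ?_)
  simp only [Finset.mem_insert, Finset.mem_singleton] at hy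
  rcases hy with rfl | rfl | rfl | rfl
  · simpa using closed _ _ _ _ _ _ _ F h₁ h₂ h₃
  · exact h₁
  · exact h₂
  · exact h₃

/-- Three of the four gradients in a frame relation are linearly independent. -/
theorem eq_zero_of_sum_thetaD (F : IsFrame ρ a b l₁ l₂ g₁ g₂) {τ : Matrix (Fin 3) (Fin 3) ℂ}
    (hτ : IsSiegel τ) (hev : ∀ m, chq m = 0 → thetaC τ m 0 ≠ 0) {c₁ c₂ c₃ : ℂ}
    (h : ∀ v, c₁ * thetaD τ (ρ + b + (l₁ + g₁)) v 0 + (c₂ * thetaD τ (ρ + b + (l₁ + g₂)) v 0 +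
      c₃ * thetaD τ (ρ + b + (l₁ + g₁ + g₂)) v 0) = 0) : c₁ = 0 ∧ c₂ = 0 ∧ c₃ = 0 := by
  let D : ThetaChar 3 → (Fin 3 → ℂ) →ₗ[ℂ] ℂ := fun n => (fderiv ℂ (thetaC τ n) 0).toLinearMap
  let L : (Fin 3 → ℂ) →ₗ[ℂ] (Fin 3 → ℂ) := LinearMap.pi
    ![D (ρ + b + (l₁ + g₁)), D (ρ + b + (l₁ + g₂)), D (ρ + b + (l₁ + g₁ + g₂))]
  have hL : Function.Injective L := by
    rw [injective_iff_map_eq_zero]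
    intro u hu
    exact F.eq_zero_of_thetaD hτ hev (congrFun hu 0) (congrFun hu 1) (congrFun hu 2)
  have hs := LinearMap.injective_iff_surjective.1 hL
  have key : ∀ w : Fin 3 → ℂ, c₁ * w 0 + (c₂ * w 1 + c₃ * w 2) = 0 := by
    intro w
    obtain ⟨v, rfl⟩ := hs w
    exact h v
  refine ⟨?_, ?_, ?_⟩
  · simpa using key (Pi.single 0 1)
  · simpa using key (Pi.single 1 1)
  · simpa using key (Pi.single 2 1)

end IsFrame

/-- Search for a frame at a given pair of even characteristics. -/
def binHasFrame (ρ a : ℕ) : Bool :=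
  (List.range 64).any fun b => binOdd (ρ ^^^ b) && (binPair a b &&
    (List.range 64).any fun l₁ => binOdd (ρ ^^^ l₁) && (!binPair a l₁ && (!binPair b l₁ &&
      (List.range 64).any fun l₂ => binPair l₁ l₂ && (binOdd (ρ ^^^ l₂) && (!binPair a l₂ &&
        (!binPair b l₂ &&
          (List.range 64).any fun g₁ => !binPair l₁ g₁ && (!binPair l₂ g₁ &&
            (binOdd (ρ ^^^ g₁) && (!binPair a g₁ && (!binPair b g₁ &&
              (List.range 64).any fun g₂ => binFrame ρ a b l₁ l₂ g₁ g₂))))))))))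

theorem exists_frame {ρ a : ThetaChar 3} (ha : a ≠ 0) (h1 : chq ρ = 0) (h2 : chq (ρ + a) = 0) :
    ∃ b l₁ l₂ g₁ g₂, IsFrame ρ a b l₁ l₂ g₁ g₂ := by
  obtain ⟨ρ, hρ, rfl⟩ := exists_binChar ρ
  obtain ⟨a, ha', rfl⟩ := exists_binChar a
  have key : ∀ ρ < 64, ∀ a < 64,
      binOdd ρ || (binOdd (ρ ^^^ a) || (a == 0 || binHasFrame ρ a)) := by
    decide +kernel
  have h := key ρ hρ a ha'
  rw [← binChar_xor] at h2
  simp only [chq_binChar, ite_eq_right_iff, one_ne_zero, imp_false, Bool.not_eq_true] at h1 h2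
  have ha0 : (a == 0) = false := by
    rw [beq_eq_false_iff_ne]
    rintro rfl
    exact ha (by ext i <;> simp [binChar])
  rw [h1, h2, ha0, Bool.false_or, Bool.false_or, Bool.false_or] at h
  simp only [binHasFrame, List.any_eq_true, Bool.and_eq_true] at h
  obtain ⟨b, -, -, -, l₁, -, -, -, -, l₂, -, -, -, -, -, g₁, -, -, -, -, -, -, g₂, -, h⟩ := h
  exact ⟨_, _, _, _, _, isFrame_binChar h⟩

/-- `φ` compares the even theta constants and the odd theta gradients of `τ` and `τ'`. -/
structure IsComparison (τ τ' : Matrix (Fin 3) (Fin 3) ℂ) (φ : ThetaChar 3 → ℂ) : Prop where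
  siegel : IsSiegel τ
  siegel' : IsSiegel τ'
  even_ne_zero : ∀ m, chq m = 0 → thetaC τ m 0 ≠ 0
  ne_zero : ∀ m, φ m ≠ 0
  thetaC_eq : ∀ m, thetaC τ' m 0 = φ m * thetaC τ m 0
  thetaD_eq : ∀ m v, thetaD τ' m v 0 = φ m * thetaD τ m v 0

namespace IsFrame

variable {ρ a b l₁ l₂ g₁ g₂ : ThetaChar 3}

theorem swap (F : IsFrame ρ a b l₁ l₂ g₁ g₂) : IsFrame ρ a b l₂ l₁ g₁ g₂ :=
  { F with
    ql₁ := F.ql₂, ql₂ := F.ql₁, l₁l₂ := by rw [chp_comm, F.l₁l₂]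
    al₁ := F.al₂, al₂ := F.al₁, bl₁ := F.bl₂, bl₂ := F.bl₁
    l₁g₁ := F.l₂g₁, l₁g₂ := F.l₂g₂, l₂g₁ := F.l₁g₁, l₂g₂ := F.l₁g₂ }

theorem flip (F : IsFrame ρ a b l₁ l₂ g₁ g₂) : IsFrame ρ a b g₁ g₂ l₁ l₂ :=
  { qρ := F.qρ, qa := F.qa, qb := F.qb, ab := F.ab
    ql₁ := F.qg₁, ql₂ := F.qg₂, qg₁ := F.ql₁, qg₂ := F.ql₂, l₁l₂ := F.g₁g₂, g₁g₂ := F.l₁l₂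
    al₁ := F.ag₁, al₂ := F.ag₂, ag₁ := F.al₁, ag₂ := F.al₂
    bl₁ := F.bg₁, bl₂ := F.bg₂, bg₁ := F.bl₁, bg₂ := F.bl₂
    l₁g₁ := by rw [chp_comm, F.l₁g₁], l₁g₂ := by rw [chp_comm, F.l₂g₁]
    l₂g₁ := by rw [chp_comm, F.l₁g₂], l₂g₂ := by rw [chp_comm, F.l₂g₂] }

theorem addLeft (F : IsFrame ρ a b l₁ l₂ g₁ g₂) : IsFrame ρ a b (l₁ + l₂) l₂ g₁ g₂ :=
  { F with
    ql₁ := by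
      have := F.chq_left 1 1 0 0
      simp only [one_smul, zero_smul, add_zero, mul_zero] at this
      exact this.trans (by decide)
    l₁l₂ := by rw [chp_add_left, F.l₁l₂, chp_self, add_zero]
    al₁ := by rw [chp_add_right, F.al₁, F.al₂, add_zero]
    bl₁ := by rw [chp_add_right, F.bl₁, F.bl₂, add_zero]
    l₁g₁ := by rw [chp_add_left, F.l₁g₁, F.l₂g₁, add_zero]
    l₁g₂ := by rw [chp_add_left, F.l₁g₂, F.l₂g₂, add_zero] }

/-- Replacing the vector `b` of a frame. -/
theorem change (F : IsFrame ρ a b l₁ l₂ g₁ g₂) {b' : ThetaChar 3} (hb : chq (ρ + b') = 1)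
    (hab : chp a b' = 1) : IsFrame ρ a b' (l₁ + chp b' l₁ • a) (l₂ + chp b' l₂ • a)
      (g₁ + chp b' g₁ • a) (g₂ + chp b' g₂ • a) := by
  have hba : chp b' a = 1 := by rw [chp_comm, hab]
  have hρa : chq a + chp ρ a = 0 := by
    have := F.qa
    rwa [chq_add, F.qρ, zero_add] at this
  have hq : ∀ l, chp a l = 0 → ∀ e : ZMod 2, chq (ρ + (l + e • a)) = chq (ρ + l) := by
    intro l hl e
    rw [← add_assoc, chq_add (ρ + l), chq_smul, chp_smul_right, chp_add_left, chp_comm l a, hl]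
    linear_combination e * hρa
  have ha : ∀ l, chp a l = 0 → ∀ e : ZMod 2, chp a (l + e • a) = 0 := by
    intro l hl e
    rw [chp_add_right, hl, chp_smul_right, chp_self, mul_zero, add_zero]
  have hb' : ∀ l, chp b' (l + chp b' l • a) = 0 := by
    intro l
    rw [chp_add_right, chp_smul_right, hba, mul_one, CharTwo.add_self_eq_zero]
  have hp : ∀ l l', chp a l = 0 → chp a l' = 0 → ∀ e e' : ZMod 2,
      chp (l + e • a) (l' + e' • a) = chp l l' := by
    intro l l' hl hl' e e'
    rw [chp_add_left, chp_add_right, chp_smul_right, chp_comm l a, hl, chp_smul_left, ha l' hl']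
    ring
  exact
    { qρ := F.qρ, qa := F.qa, qb := hb, ab := hab
      ql₁ := by rw [hq _ F.al₁, F.ql₁]
      ql₂ := by rw [hq _ F.al₂, F.ql₂]
      qg₁ := by rw [hq _ F.ag₁, F.qg₁]
      qg₂ := by rw [hq _ F.ag₂, F.qg₂]
      l₁l₂ := by rw [hp _ _ F.al₁ F.al₂, F.l₁l₂]
      g₁g₂ := by rw [hp _ _ F.ag₁ F.ag₂, F.g₁g₂]
      al₁ := ha _ F.al₁ _, al₂ := ha _ F.al₂ _, ag₁ := ha _ F.ag₁ _, ag₂ := ha _ F.ag₂ _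
      bl₁ := hb' _, bl₂ := hb' _, bg₁ := hb' _, bg₂ := hb' _
      l₁g₁ := by rw [hp _ _ F.al₁ F.ag₁, F.l₁g₁]
      l₁g₂ := by rw [hp _ _ F.al₁ F.ag₂, F.l₁g₂]
      l₂g₁ := by rw [hp _ _ F.al₂ F.ag₁, F.l₂g₁]
      l₂g₂ := by rw [hp _ _ F.al₂ F.ag₂, F.l₂g₂] }

variable {τ τ' : Matrix (Fin 3) (Fin 3) ℂ} {φ : ThetaChar 3 → ℂ}

/-- The coefficients of the frame relations for `τ` and `τ'` are proportional. -/
theorem comparison (F : IsFrame ρ a b l₁ l₂ g₁ g₂) (C : IsComparison τ τ' φ) {y : ThetaChar 3}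
    (hy : y ∈ ({0, l₁ + g₁, l₁ + g₂, l₁ + g₁ + g₂} : Finset (ThetaChar 3))) :
    φ (ρ + y) * φ (ρ + y + a) * (φ (ρ + b + y + a) * φ (ρ + b + y)) =
      φ ρ * φ (ρ + a) * (φ (ρ + b + a) * φ (ρ + b)) := by
  obtain ⟨k, hk, hrel⟩ := F.exists_relation
  set A : ThetaChar 3 → ℂ := fun y => k y * (thetaC τ (ρ + y) 0 * thetaC τ (ρ + y + a) 0 *
    thetaC τ (ρ + b + y + a) 0)
  set R : ThetaChar 3 → ℂ := fun y =>
    φ (ρ + y) * φ (ρ + y + a) * (φ (ρ + b + y + a) * φ (ρ + b + y))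
  have h1 : ∀ v, A 0 * thetaD τ (ρ + b + 0) v 0 + (A (l₁ + g₁) * thetaD τ (ρ + b + (l₁ + g₁)) v 0 +
      (A (l₁ + g₂) * thetaD τ (ρ + b + (l₁ + g₂)) v 0 +
        A (l₁ + g₁ + g₂) * thetaD τ (ρ + b + (l₁ + g₁ + g₂)) v 0)) = 0 := by
    intro v
    rw [← F.sum_eq fun y => A y * thetaD τ (ρ + b + y) v 0, ← hrel τ C.siegel v]
    exact Finset.sum_congr rfl fun y _ => by simp only [A]; ring
  have h2 : ∀ v, R 0 * (A 0 * thetaD τ (ρ + b + 0) v 0) +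
      (R (l₁ + g₁) * (A (l₁ + g₁) * thetaD τ (ρ + b + (l₁ + g₁)) v 0) +
      (R (l₁ + g₂) * (A (l₁ + g₂) * thetaD τ (ρ + b + (l₁ + g₂)) v 0) +
        R (l₁ + g₁ + g₂) * (A (l₁ + g₁ + g₂) * thetaD τ (ρ + b + (l₁ + g₁ + g₂)) v 0))) = 0 := by
    intro v
    rw [← F.sum_eq fun y => R y * (A y * thetaD τ (ρ + b + y) v 0), ← hrel τ' C.siegel' v]
    refine Finset.sum_congr rfl fun y _ => ?_
    simp only [A, R, C.thetaC_eq, C.thetaD_eq]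
    ring
  obtain ⟨c1, c2, c3⟩ := F.eq_zero_of_sum_thetaD C.siegel C.even_ne_zero
    (c₁ := (R (l₁ + g₁) - R 0) * A (l₁ + g₁)) (c₂ := (R (l₁ + g₂) - R 0) * A (l₁ + g₂))
    (c₃ := (R (l₁ + g₁ + g₂) - R 0) * A (l₁ + g₁ + g₂))
    fun v => by linear_combination h2 v - R 0 * h1 v
  have hA : ∀ y ∈ ({0, l₁ + g₁, l₁ + g₂, l₁ + g₁ + g₂} : Finset (ThetaChar 3)), A y ≠ 0 := by
    intro y hy
    obtain ⟨p1, p2, p3, -⟩ := F.parity hy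
    exact mul_ne_zero (hk y) (mul_ne_zero (mul_ne_zero (C.even_ne_zero _ p1)
      (C.even_ne_zero _ p2)) (C.even_ne_zero _ p3))
  have hR : R y = R 0 := by
    have hy' := hy
    simp only [Finset.mem_insert, Finset.mem_singleton] at hy'
    rcases hy' with rfl | rfl | rfl | rfl
    · rfl
    · exact sub_eq_zero.1 ((mul_eq_zero.1 c1).resolve_right (hA _ hy))
    · exact sub_eq_zero.1 ((mul_eq_zero.1 c2).resolve_right (hA _ hy))
    · exact sub_eq_zero.1 ((mul_eq_zero.1 c3).resolve_right (hA _ hy))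
  simpa only [R, add_zero] using hR

theorem comparison_of_orthogonal (F : IsFrame ρ a b l₁ l₂ g₁ g₂) (C : IsComparison τ τ' φ)
    {d : ThetaChar 3} (had : chp a d = 0) (hbd : chp b d = 0) (hd : chq (ρ + d) = 0) :
    φ (ρ + d) * φ (ρ + d + a) * (φ (ρ + b + d + a) * φ (ρ + b + d)) =
      φ ρ * φ (ρ + a) * (φ (ρ + b + a) * φ (ρ + b)) := by
  obtain ⟨e₁, e₂, f₁, f₂, rfl⟩ : ∃ e₁ e₂ f₁ f₂ : ZMod 2,
      d = e₁ • l₁ + e₂ • l₂ + (f₁ • g₁ + f₂ • g₂) := by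
    refine ⟨chp d l₂, chp d l₁, chp d g₂, chp d g₁,
      eq_of_char_add_eq_zero (F.eq_zero ?_ ?_ ?_ ?_ ?_ ?_)⟩
    · simp only [chp_comm _ a, chp_add_right, chp_smul_right, had, F.al₁, F.al₂, F.ag₁, F.ag₂,
        mul_zero, add_zero]
    · simp only [chp_comm _ b, chp_add_right, chp_smul_right, hbd, F.bl₁, F.bl₂, F.bg₁, F.bg₂,
        mul_zero, add_zero]
    all_goals
      simp only [chp_add_left, chp_smul_left, F.l₁l₂, F.g₁g₂, F.l₁g₁, F.l₁g₂, F.l₂g₁, F.l₂g₂,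
        chp_self, chp_comm l₂ l₁, chp_comm g₁ l₁, chp_comm g₁ l₂, chp_comm g₂ l₁, chp_comm g₂ l₂,
        chp_comm g₂ g₁, mul_zero, mul_one, add_zero, zero_add, CharTwo.add_self_eq_zero]
  have key : ∀ {l l' : ThetaChar 3}, IsFrame ρ a b l l' g₁ g₂ →
      chq (ρ + (l + (f₁ • g₁ + f₂ • g₂))) = 0 →
      φ (ρ + (l + (f₁ • g₁ + f₂ • g₂))) * φ (ρ + (l + (f₁ • g₁ + f₂ • g₂)) + a) *
        (φ (ρ + b + (l + (f₁ • g₁ + f₂ • g₂)) + a) * φ (ρ + b + (l + (f₁ • g₁ + f₂ • g₂)))) =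
      φ ρ * φ (ρ + a) * (φ (ρ + b + a) * φ (ρ + b)) := by
    intro l l' F hl
    have h := F.chq_right f₁ f₂ 0 0
    simp only [zero_smul, add_zero, zero_mul] at h
    rw [← add_assoc, h] at hl
    have hf : f₁ = 1 ∧ f₂ = 0 ∨ f₁ = 0 ∧ f₂ = 1 ∨ f₁ = 1 ∧ f₂ = 1 := by
      clear * - hl
      revert f₁ f₂
      decide
    refine F.comparison C ?_
    rcases hf with ⟨rfl, rfl⟩ | ⟨rfl, rfl⟩ | ⟨rfl, rfl⟩ <;> simp [← add_assoc]
  rcases zmod_two_cases e₁ with rfl | rfl <;> rcases zmod_two_cases e₂ with rfl | rfl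
  · have h := F.flip.chq_left f₁ f₂ 0 0
    simp only [zero_smul, add_zero, zero_mul, zero_add] at h hd ⊢
    rw [h] at hd
    obtain ⟨rfl, rfl⟩ : f₁ = 0 ∧ f₂ = 0 := by
      clear * - hd
      revert f₁ f₂
      decide
    simp
  · rw [zero_smul, one_smul, zero_add] at hd ⊢
    exact key F.swap hd
  · rw [zero_smul, one_smul, add_zero] at hd ⊢
    exact key F hd
  · rw [one_smul, one_smul] at hd ⊢
    exact key F.addLeft hd

end IsFrame

theorem chp_eq_of_even {g : ℕ} {ρ a : ThetaChar g} (h : chq ρ = chq (ρ + a)) :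
    chp a ρ = chq a := by
  rw [chq_add, chp_comm] at h
  linear_combination -h - CharTwo.add_self_eq_zero (chq a)

/-- The products `φ x φ (x + a)` on pairs of even characteristics and on pairs of mixed parity
vary inversely to each other. -/
theorem IsComparison.mul_eq_mul {τ τ' : Matrix (Fin 3) (Fin 3) ℂ} {φ : ThetaChar 3 → ℂ}
    (C : IsComparison τ τ' φ) {a d ρ κ : ThetaChar 3} (ha : a ≠ 0) (had : chp a d = 0)
    (h1 : chq ρ = 0) (h2 : chq (ρ + a) = 0) (h3 : chq (ρ + d) = 0)
    (hκ : chq κ ≠ chq (κ + a)) :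
    φ ρ * φ (ρ + a) * (φ κ * φ (κ + a)) =
      φ (ρ + d) * φ (ρ + d + a) * (φ (κ + d) * φ (κ + d + a)) := by
  wlog hκ1 : chq κ = 1 generalizing κ
  · have h4 := this (κ := κ + a) (by rwa [add_assoc, char_add_self, add_zero, ne_comm])
      (by
        rcases zmod_two_cases (chq (κ + a)) with h | h
        · exact absurd ((zmod_two_cases (chq κ)).resolve_right hκ1) (by rw [← h]; exact hκ)
        · exact h)
    rw [add_assoc κ a a, char_add_self, add_zero, add_right_comm κ a d, add_assoc (κ + d) a a,
      char_add_self, add_zero] at h4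
    rw [mul_comm (φ κ), h4, mul_comm (φ (κ + d + a))]
  have hκ0 : chq (κ + a) = 0 := by
    rcases zmod_two_cases (chq (κ + a)) with h | h
    · exact h
    · exact absurd (hκ1.trans h.symm) hκ
  have eb : ρ + (ρ + κ) = κ := by rw [← add_assoc, char_add_self, zero_add]
  have hab : chp a (ρ + κ) = 1 := by
    rw [chp_add_right, chp_eq_of_even (h1.trans h2.symm)]
    rw [chq_add, hκ1, chp_comm] at hκ0
    linear_combination hκ0 - CharTwo.add_self_eq_zero (1 : ZMod 2)
  obtain ⟨b, l₁, l₂, g₁, g₂, F⟩ := exists_frame ha h1 h2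
  have F' := F.change (b' := ρ + κ) (by rw [eb, hκ1]) hab
  rcases zmod_two_cases (chp (ρ + κ) d) with h | h
  · have := F'.comparison_of_orthogonal C had h h3
    rw [eb] at this
    linear_combination -this
  · have h5 : chq (ρ + (d + a)) = 0 := by
      rw [← add_assoc, chq_add, h3, chp_add_left, chp_comm d a, had, zero_add, add_zero]
      have := chq_add ρ a
      rw [h1, h2, zero_add] at this
      exact this.symm
    have := F'.comparison_of_orthogonal C (d := d + a)
      (by rw [chp_add_right, had, chp_self, add_zero])
      (by rw [chp_add_right, h, chp_comm, hab]; rfl) h5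
    rw [eb] at this
    simp only [← add_assoc] at this
    rw [add_assoc (ρ + d) a a, add_assoc (κ + d) a a, char_add_self, add_zero, add_zero] at this
    linear_combination -this

theorem exists_even_square {x y : ThetaChar 3} (hx : chq x = 0) (hy : chq y = 0) :
    ∃ z, chq z = 0 ∧ chq (x + y + z) = 0 ∧ z ≠ x ∧ z ≠ y := by
  obtain ⟨x, hx', rfl⟩ := exists_binChar x
  obtain ⟨y, hy', rfl⟩ := exists_binChar y
  have key : ∀ x < 64, ∀ y < 64, (binOdd x = false ∧ binOdd y = false) →
      ∃ z < 64, binOdd z = false ∧ binOdd (x ^^^ y ^^^ z) = false ∧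
        ((List.range 64).any fun w => binPair w (z ^^^ x)) = true ∧
        ((List.range 64).any fun w => binPair w (z ^^^ y)) = true := by
    decide +kernel
  simp only [chq_binChar, ite_eq_right_iff, one_ne_zero, imp_false, Bool.not_eq_true] at hx hy
  obtain ⟨z, -, h1, h2, h3, h4⟩ := key x hx' y hy' ⟨hx, hy⟩
  obtain ⟨w, -, hw⟩ := List.any_eq_true.1 h3
  obtain ⟨w', -, hw'⟩ := List.any_eq_true.1 h4
  refine ⟨binChar z, by rw [chq_binChar, h1]; rfl,
    by rw [← binChar_xor, ← binChar_xor, chq_binChar, h2]; rfl, fun h => ?_, fun h => ?_⟩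
  · have := chp_binChar w (z ^^^ x)
    rw [binChar_xor, h, char_add_self, chp_zero_right, hw] at this
    exact zero_ne_one this
  · have := chp_binChar w' (z ^^^ y)
    rw [binChar_xor, h, char_add_self, chp_zero_right, hw'] at this
    exact zero_ne_one this

theorem exists_odd_even_even {a b : ThetaChar 3} (ha : a ≠ 0) (hb : b ≠ 0) (hab : a ≠ b) :
    ∃ k, chq k = 1 ∧ chq (k + a) = 0 ∧ chq (k + b) = 0 := by
  obtain ⟨a, ha', rfl⟩ := exists_binChar a
  obtain ⟨b, hb', rfl⟩ := exists_binChar b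
  have key : ∀ a < 64, ∀ b < 64, (a ≠ 0 ∧ b ≠ 0 ∧ a ≠ b) →
      ∃ k < 64, binOdd k = true ∧ binOdd (k ^^^ a) = false ∧ binOdd (k ^^^ b) = false := by
    decide +kernel
  obtain ⟨k, -, h1, h2, h3⟩ := key a ha' b hb'
    ⟨by rintro rfl; exact ha (by ext i <;> simp [binChar]),
      by rintro rfl; exact hb (by ext i <;> simp [binChar]), by rintro rfl; exact hab rfl⟩
  refine ⟨binChar k, ?_, ?_, ?_⟩ <;> simp only [← binChar_xor, chq_binChar, h1, h2, h3] <;> rfl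

theorem exists_even_even_even (a b : ThetaChar 3) :
    ∃ r, chq r = 0 ∧ chq (r + a) = 0 ∧ chq (r + b) = 0 := by
  obtain ⟨a, ha', rfl⟩ := exists_binChar a
  obtain ⟨b, hb', rfl⟩ := exists_binChar b
  have key : ∀ a < 64, ∀ b < 64,
      ∃ k < 64, binOdd k = false ∧ binOdd (k ^^^ a) = false ∧ binOdd (k ^^^ b) = false := by
    decide +kernel
  obtain ⟨k, -, h1, h2, h3⟩ := key a ha' b hb'
  refine ⟨binChar k, ?_, ?_, ?_⟩ <;> simp only [← binChar_xor, chq_binChar, h1, h2, h3] <;> rfl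

theorem exists_even_shift_of_odd {p a : ThetaChar 3} (hp : chq p = 1) (hpa : chq (p + a) = 1) :
    ∃ b, chp a b = 0 ∧ chq (p + b) = 0 ∧ chq (p + a + b) = 0 := by
  obtain ⟨p, hp', rfl⟩ := exists_binChar p
  obtain ⟨a, ha', rfl⟩ := exists_binChar a
  have key : ∀ p < 64, ∀ a < 64, (binOdd p = true ∧ binOdd (p ^^^ a) = true) →
      ∃ b < 64, binPair a b = false ∧ binOdd (p ^^^ b) = false ∧ binOdd (p ^^^ a ^^^ b) = false := by
    decide +kernel
  rw [← binChar_xor] at hpa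
  simp only [chq_binChar, ite_eq_left_iff, zero_ne_one, imp_false, Bool.not_eq_true,
    Bool.not_eq_false] at hp hpa
  obtain ⟨k, -, h1, h2, h3⟩ := key p hp' a ha' ⟨hp, hpa⟩
  refine ⟨binChar k, ?_, ?_, ?_⟩ <;>
    simp only [← binChar_xor, chq_binChar, chp_binChar, h1, h2, h3] <;> rfl

theorem chp_of_mixed {g : ℕ} {κ a : ThetaChar g} (h : chq κ ≠ chq (κ + a)) :
    chp a κ = chq a + 1 := by
  rw [chq_add, chp_comm, add_assoc, ne_eq, left_eq_add] at h
  have := (zmod_two_cases _).resolve_left h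
  linear_combination this - CharTwo.add_self_eq_zero (chq a)

theorem mixed_of_chp {g : ℕ} {κ a : ThetaChar g} (h : chp a κ = chq a + 1) :
    chq κ ≠ chq (κ + a) := by
  rw [chq_add, chp_comm, h, add_assoc, ← add_assoc (chq a), CharTwo.add_self_eq_zero, zero_add]
  intro h
  rw [left_eq_add] at h
  exact one_ne_zero h

theorem exists_mixed {g : ℕ} {a : ThetaChar g} (ha : a ≠ 0) : ∃ κ, chq κ ≠ chq (κ + a) := by
  obtain ⟨y, hy⟩ : ∃ y, chp a y ≠ 0 := by
    by_contra! h
    exact ha (eq_zero_of_chp_eq_zero h)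
  have hy := (zmod_two_cases _).resolve_left hy
  refine ⟨(chq a + 1) • y, mixed_of_chp ?_⟩
  rw [chp_smul_right, hy, mul_one]

theorem char_add_cancel {g : ℕ} (x y : ThetaChar g) : x + (x + y) = y := by
  rw [← add_assoc, char_add_self, zero_add]

namespace IsComparison

variable {τ τ' : Matrix (Fin 3) (Fin 3) ℂ} {φ : ThetaChar 3 → ℂ}

theorem even_sq_eq (C : IsComparison τ τ' φ) {a x z : ThetaChar 3} (ha : a ≠ 0)
    (h1 : chq x = 0) (h2 : chq (x + a) = 0) (h3 : chq z = 0) (h4 : chq (z + a) = 0) :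
    (φ x * φ (x + a)) ^ 2 = (φ z * φ (z + a)) ^ 2 := by
  obtain ⟨κ, hκ⟩ := exists_mixed ha
  have had : chp a (x + z) = 0 := by
    rw [chp_add_right, chp_eq_of_even (h1.trans h2.symm), chp_eq_of_even (h3.trans h4.symm),
      CharTwo.add_self_eq_zero]
  have e1 := C.mul_eq_mul ha had h1 h2 (by rwa [char_add_cancel]) hκ
  have e2 := C.mul_eq_mul ha had h3 h4 (by rwa [add_comm x, char_add_cancel]) hκ
  have hz' : z + (x + z) = x := by rw [add_comm x, char_add_cancel]
  rw [char_add_cancel] at e1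
  rw [hz'] at e2
  have hne := mul_ne_zero (C.ne_zero κ) (C.ne_zero (κ + a))
  refine mul_right_cancel₀ hne ?_
  linear_combination (φ x * φ (x + a)) * e1 - (φ z * φ (z + a)) * e2

theorem mixed_sq_eq (C : IsComparison τ τ' φ) {a x z : ThetaChar 3} (ha : a ≠ 0)
    (hx : chq x ≠ chq (x + a)) (hz : chq z ≠ chq (z + a)) :
    (φ x * φ (x + a)) ^ 2 = (φ z * φ (z + a)) ^ 2 := by
  have had : chp a (x + z) = 0 := by
    rw [chp_add_right, chp_of_mixed hx, chp_of_mixed hz, CharTwo.add_self_eq_zero]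
  obtain ⟨ρ, h1, h2, h3, -⟩ := exists_even_quadruple had
  have e1 := C.mul_eq_mul ha had h1 h2 h3 hx
  have e2 := C.mul_eq_mul ha had h1 h2 h3 hz
  have hz' : z + (x + z) = x := by rw [add_comm x, char_add_cancel]
  rw [char_add_cancel] at e1
  rw [hz'] at e2
  have hne := mul_ne_zero (C.ne_zero ρ) (C.ne_zero (ρ + a))
  refine mul_right_cancel₀ hne ?_
  linear_combination (φ x * φ (x + a)) * e1 - (φ z * φ (z + a)) * e2

theorem sq_mul_sq_eq (C : IsComparison τ τ' φ) {x y z w : ThetaChar 3} (hx : chq x = 0)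
    (hy : chq y = 0) (hz : chq z = 0) (hw : chq w = 0) (h : x + y = z + w) (hne : x ≠ y) :
    φ x ^ 2 * φ y ^ 2 = φ z ^ 2 * φ w ^ 2 := by
  have hxy : x + y ≠ 0 := fun h => hne (eq_of_char_add_eq_zero h)
  have e1 : x + (x + y) = y := char_add_cancel x y
  have e2 : z + (x + y) = w := by rw [h, char_add_cancel]
  have := C.even_sq_eq hxy hx (by rwa [e1]) hz (by rwa [e2])
  rw [e1, e2] at this
  linear_combination this

theorem pow_four_eq (C : IsComparison τ τ' φ) {x y : ThetaChar 3} (hx : chq x = 0)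
    (hy : chq y = 0) : φ x ^ 4 = φ y ^ 4 := by
  obtain ⟨z, hz, hw, hzx, hzy⟩ := exists_even_square hx hy
  have e1 := C.sq_mul_sq_eq hx hz hy hw (by
    rw [add_comm x y, add_assoc, char_add_cancel]) hzx.symm
  have e2 := C.sq_mul_sq_eq hy hz hx hw (by
    rw [add_assoc, char_add_cancel]) hzy.symm
  have hne := mul_ne_zero (pow_ne_zero 2 (C.ne_zero z)) (pow_ne_zero 2 (C.ne_zero (x + y + z)))
  refine mul_right_cancel₀ hne ?_
  linear_combination (φ x ^ 2 * φ (x + y + z) ^ 2) * e1 - (φ y ^ 2 * φ (x + y + z) ^ 2) * e2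

theorem mixed_eq_const_mul_even (C : IsComparison τ τ' φ) :
    ∃ s : ℂ, s ≠ 0 ∧ ∀ a k r : ThetaChar 3, a ≠ 0 → chq k ≠ chq (k + a) → chq r = 0 →
      chq (r + a) = 0 → (φ k * φ (k + a)) ^ 2 = s ^ 2 * (φ r * φ (r + a)) ^ 2 := by
  have key : ∀ a k r a' k' r' : ThetaChar 3, a ≠ 0 → chq k ≠ chq (k + a) → chq r = 0 →
      chq (r + a) = 0 → a' ≠ 0 → chq k' ≠ chq (k' + a') → chq r' = 0 → chq (r' + a') = 0 →
      (φ k * φ (k + a)) ^ 2 * (φ r' * φ (r' + a')) ^ 2 =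
        (φ k' * φ (k' + a')) ^ 2 * (φ r * φ (r + a)) ^ 2 := by
    intro a k r a' k' r' ha hk hr hra ha' hk' hr' hra'
    by_cases haa : a = a'
    · subst haa
      rw [C.mixed_sq_eq ha hk hk', C.even_sq_eq ha hr hra hr' hra']
    · obtain ⟨κ, h1, h2, h3⟩ := exists_odd_even_even ha ha' haa
      obtain ⟨ρ, h4, h5, h6⟩ := exists_even_even_even a a'
      rw [C.mixed_sq_eq (z := κ) ha hk (by rw [h1, h2]; exact one_ne_zero),
        C.mixed_sq_eq (z := κ) ha' hk' (by rw [h1, h3]; exact one_ne_zero),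
        C.even_sq_eq (z := ρ) ha hr hra h4 h5, C.even_sq_eq (z := ρ) ha' hr' hra' h4 h6]
      have e : φ (κ + a) ^ 2 * φ (ρ + a') ^ 2 = φ (κ + a') ^ 2 * φ (ρ + a) ^ 2 := by
        by_cases hne : κ + a = ρ + a'
        · have hne' : κ + a' = ρ + a := by
            have h7 : κ = ρ + a' + a := by rw [← hne, add_assoc, char_add_self, add_zero]
            rw [h7, add_right_comm _ a a', add_assoc ρ a' a', char_add_self, add_zero]
          rw [← hne, ← hne']
          linear_combination C.pow_four_eq h2 h3
        · exact C.sq_mul_sq_eq h2 h6 h3 h5 (by abel) hne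
      linear_combination (φ κ * φ ρ) ^ 2 * e
  have h0 : binChar 1 ≠ 0 := by
    intro h
    have := congrFun (congrArg Prod.fst h) 0
    simp [binChar] at this
  obtain ⟨k₀, hk₀⟩ := exists_mixed h0
  obtain ⟨r₀, hr₀, hr₀'⟩ := exists_even_pair (binChar 1)
  have hne := mul_ne_zero (C.ne_zero r₀) (C.ne_zero (r₀ + binChar 1))
  refine ⟨φ k₀ * φ (k₀ + binChar 1) / (φ r₀ * φ (r₀ + binChar 1)),
    div_ne_zero (mul_ne_zero (C.ne_zero _) (C.ne_zero _)) hne, fun a k r ha hk hr hra => ?_⟩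
  have := key a k r _ k₀ r₀ ha hk hr hra h0 hk₀ hr₀ hr₀'
  rw [div_pow, div_mul_eq_mul_div, eq_div_iff (pow_ne_zero 2 hne), this]

end IsComparison

/-- The multipliers `φ`, rescaled by `s⁻¹` on the odd characteristics. -/
noncomputable def oddScaled {g : ℕ} (φ : ThetaChar g → ℂ) (s : ℂ) (m : ThetaChar g) : ℂ :=
  if chq m = 0 then φ m else φ m / s

namespace IsComparison

variable {τ τ' : Matrix (Fin 3) (Fin 3) ℂ} {φ : ThetaChar 3 → ℂ}

theorem odd_pair_eq (C : IsComparison τ τ' φ) {s : ℂ}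
    (hs : ∀ a k r : ThetaChar 3, a ≠ 0 → chq k ≠ chq (k + a) → chq r = 0 →
      chq (r + a) = 0 → (φ k * φ (k + a)) ^ 2 = s ^ 2 * (φ r * φ (r + a)) ^ 2)
    {a h r : ThetaChar 3} (ha : chq a = 1) (hh : chq h ≠ chq (h + a)) (hr : chq r = 0)
    (hra : chq (r + a) = 0) (hp : chq (r + h) = 1) (hpa : chq (r + h + a) = 1) :
    φ (r + h) * φ (r + h + a) * (φ h * φ (h + a)) =
      s ^ 2 * (φ 0 * φ a) * (φ r * φ (r + a)) := by
  have ha0 : a ≠ 0 := by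
    rintro rfl
    rw [chq_zero] at ha
    exact zero_ne_one ha
  obtain ⟨b, hab, hpb, hpab⟩ := exists_even_shift_of_odd hp hpa
  have hb0 : b ≠ 0 := by
    rintro rfl
    rw [add_zero, hp] at hpb
    exact one_ne_zero hpb
  obtain ⟨ρ, h1, h2, h3, h4⟩ := exists_even_quadruple hab
  have hah : chp a h = 0 := by rw [chp_of_mixed hh, ha, CharTwo.add_self_eq_zero]
  have E1 := C.mul_eq_mul (ρ := ρ) (κ := r + h) hb0 (chp_comm a b ▸ hab) h1 h3 h2
    (by rw [hp, hpb]; exact one_ne_zero)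
  have S1 := hs b (r + h + a) (ρ + a) hb0 (by rw [hpa, hpab]; exact one_ne_zero) h2 h4
  have E2 := C.mul_eq_mul (ρ := r) (d := h + b) (κ := 0) ha0
    (by rw [chp_add_right, hah, hab, add_zero]) hr hra (by rwa [← add_assoc])
    (by rw [chq_zero, zero_add, ha]; exact zero_ne_one)
  have E3 := C.mul_eq_mul (ρ := ρ) (d := b) (κ := h) ha0 hab h1 h2 h3 hh
  have h5 : chq (r + h + b + a) = 0 := by rwa [add_right_comm]
  have E4 := C.even_sq_eq ha0 h1 h2 hpb h5
  have E5 := C.pow_four_eq h1 h2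
  have E6 := C.pow_four_eq h1 h4
  rw [← add_assoc, zero_add, zero_add] at E2
  rw [add_right_comm (r + h) a b] at E1 S1
  rw [add_right_comm ρ a b] at E1 S1 E6
  have n := C.ne_zero
  refine mul_right_cancel₀ (mul_ne_zero (mul_ne_zero (mul_ne_zero (n ρ) (n (ρ + a)))
    (mul_ne_zero (n (ρ + b)) (n (ρ + b + a)))) (mul_ne_zero (n (r + h + b))
      (n (r + h + b + a)))) ?_
  generalize φ ρ = A at *
  generalize φ (ρ + a) = A' at *
  generalize φ (ρ + b) = B at *
  generalize φ (ρ + b + a) = B' at *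
  generalize φ (r + h) = P at *
  generalize φ (r + h + a) = P' at *
  generalize φ (r + h + b) = Q at *
  generalize φ (r + h + b + a) = Q' at *
  generalize φ (h + b) * φ (h + b + a) = K at *
  generalize φ h * φ (h + a) = H at *
  generalize φ r * φ (r + a) = R at *
  generalize φ 0 * φ a = Z at *
  have F1 : P * P' * (Q * Q') * (A * A') * (B * B') = s ^ 2 * (A * A') ^ 4 := by
    linear_combination A' * B' * P' * Q' * E1 + (A' * B') ^ 2 * S1 -
      s ^ 2 * (A' ^ 4) * E6
  have F2 : Z * R * (Q * Q') * (A * A') * (B * B') = (A * A') ^ 4 * H := by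
    linear_combination (Q * Q') * (A * A') * (B * B') * E2 - (Q * Q') ^ 2 * (A * A') * E3 -
      (A * A') ^ 2 * H * E4
  linear_combination H * F1 - s ^ 2 * F2

theorem oddScaled_mul_eq (C : IsComparison τ τ' φ) {s : ℂ} (hs0 : s ≠ 0)
    (hs : ∀ a k r : ThetaChar 3, a ≠ 0 → chq k ≠ chq (k + a) → chq r = 0 →
      chq (r + a) = 0 → (φ k * φ (k + a)) ^ 2 = s ^ 2 * (φ r * φ (r + a)) ^ 2)
    {a h r : ThetaChar 3} (ha0 : a ≠ 0) (hh : chq h ≠ chq (h + a)) (hr : chq r = 0)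
    (hra : chq (r + a) = 0) :
    s * (oddScaled φ s a * oddScaled φ s 0) * (φ r * φ (r + a)) =
      φ h * φ (h + a) * (oddScaled φ s (r + h) * oddScaled φ s (r + h + a)) := by
  have har : chp a r = chq a := chp_eq_of_even (hr.trans hra.symm)
  have hah := chp_of_mixed hh
  have hap : chp a (r + h) = 1 := by
    rw [chp_add_right, har, hah, ← add_assoc, CharTwo.add_self_eq_zero, zero_add]
  have hz : oddScaled φ s 0 = φ 0 := if_pos chq_zero
  rw [hz]
  rcases zmod_two_cases (chq a) with ha | ha
  · have hA : oddScaled φ s a = φ a := if_pos ha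
    have E := C.mul_eq_mul (ρ := 0) (d := r) (κ := h) ha0 (har.trans ha) chq_zero
      (by rwa [zero_add]) (by rwa [zero_add]) hh
    have S := hs a h r ha0 hh hr hra
    have hmix : chq (r + h) ≠ chq (r + h + a) := mixed_of_chp (by rw [hap, ha, zero_add])
    have hP : oddScaled φ s (r + h) * oddScaled φ s (r + h + a) =
        φ (r + h) * φ (r + h + a) / s := by
      rcases zmod_two_cases (chq (r + h)) with h1 | h1
      · have h2 : chq (r + h + a) ≠ 0 := fun h2 => hmix (h1.trans h2.symm)
        rw [oddScaled, if_pos h1, oddScaled, if_neg h2]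
        ring
      · have h2 : chq (r + h + a) = 0 :=
          (zmod_two_cases _).resolve_right fun h2 => hmix (h1.trans h2.symm)
        rw [oddScaled, if_neg (by rw [h1]; exact one_ne_zero), oddScaled, if_pos h2]
        ring
    rw [hP, hA]
    rw [zero_add, zero_add, add_comm h r] at E
    refine mul_right_cancel₀ (mul_ne_zero (C.ne_zero r) (C.ne_zero (r + a))) ?_
    field_simp
    linear_combination (φ h * φ (h + a)) * E - (φ a * φ 0) * S
  · have ha1 : chq a ≠ 0 := by rw [ha]; exact one_ne_zero
    have hA : oddScaled φ s a = φ a / s := if_neg ha1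
    have hpar : chq (r + h) = chq (r + h + a) := by
      rw [chq_add (r + h), ha, chp_comm, hap, add_assoc, CharTwo.add_self_eq_zero, add_zero]
    rw [hA]
    rcases zmod_two_cases (chq (r + h)) with h1 | h1
    · have E := C.mul_eq_mul (ρ := r) (d := h) (κ := 0) ha0
        (by rw [hah, ha, CharTwo.add_self_eq_zero]) hr hra h1
        (by rw [chq_zero, zero_add, ha]; exact zero_ne_one)
      rw [zero_add, zero_add] at E
      rw [oddScaled, if_pos h1, oddScaled, if_pos (hpar ▸ h1)]
      field_simp
      linear_combination E
    · have h2 : chq (r + h + a) = 1 := hpar ▸ h1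
      have E := C.odd_pair_eq hs ha hh hr hra h1 h2
      rw [oddScaled, if_neg (by rw [h1]; exact one_ne_zero), oddScaled,
        if_neg (by rw [h2]; exact one_ne_zero)]
      field_simp
      linear_combination -E

end IsComparison

namespace IsComparison

variable {τ τ' : Matrix (Fin 3) (Fin 3) ℂ} {φ : ThetaChar 3 → ℂ}

theorem wronskian_zero (C : IsComparison τ τ' φ) {s : ℂ} (hs0 : s ≠ 0)
    (hs : ∀ a k r : ThetaChar 3, a ≠ 0 → chq k ≠ chq (k + a) → chq r = 0 →
      chq (r + a) = 0 → (φ k * φ (k + a)) ^ 2 = s ^ 2 * (φ r * φ (r + a)) ^ 2)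
    (m : ThetaChar 3) (v : Fin 3 → ℂ) :
    ∃ (c : ThetaChar 3 → ℂ) (p q : ThetaChar 3 → ThetaChar 3),
      (∀ x, thetaD τ' m v x * thetaC τ' 0 x - thetaC τ' m x * thetaD τ' 0 v x =
        ∑ h, c h * (thetaC τ' (p h) x * thetaC τ' (q h) x)) ∧
      ∀ x, s * (oddScaled φ s m * oddScaled φ s 0) *
          (thetaD τ m v x * thetaC τ 0 x - thetaC τ m x * thetaD τ 0 v x) =
        ∑ h, c h * (oddScaled φ s (p h) * thetaC τ (p h) x *
          (oddScaled φ s (q h) * thetaC τ (q h) x)) := by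
  by_cases hm : m = 0
  · subst hm
    exact ⟨fun _ => 0, id, id, fun x => by simp [mul_comm], fun x => by simp [mul_comm]⟩
  obtain ⟨r, h1, h2⟩ := exists_even_pair m
  obtain ⟨d, hd⟩ := riemann_relation_deriv_one m 0 r
  have hK := mul_ne_zero (C.even_ne_zero _ h2) (C.even_ne_zero _ h1)
  have hM := mul_ne_zero (C.ne_zero r) (C.ne_zero (r + m))
  refine ⟨fun h => d h * (φ h * φ (h + m)) * (thetaD τ (h + m) v 0 * thetaC τ h 0 +
      thetaC τ (h + m) 0 * thetaD τ h v 0) /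
      (φ r * φ (r + m) * (thetaC τ (r + m) 0 * thetaC τ r 0)),
    fun h => r + h + m, fun h => r + h, fun x => ?_, fun x => ?_⟩
  · have e := hd τ' C.siegel' x v
    simp only [zero_add] at e
    rw [C.thetaC_eq, C.thetaC_eq] at e
    refine mul_right_cancel₀ (mul_ne_zero hM hK) ?_
    rw [Finset.sum_mul]
    rw [show φ r * φ (r + m) * (thetaC τ (r + m) 0 * thetaC τ r 0) =
      φ (r + m) * thetaC τ (r + m) 0 * (φ r * thetaC τ r 0) by ring, e]
    refine Finset.sum_congr rfl fun h _ => ?_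
    beta_reduce
    rw [show φ (r + m) * thetaC τ (r + m) 0 * (φ r * thetaC τ r 0) =
      φ r * φ (r + m) * (thetaC τ (r + m) 0 * thetaC τ r 0) by ring,
      C.thetaC_eq, C.thetaC_eq, C.thetaD_eq, C.thetaD_eq]
    rw [div_mul_eq_mul_div, div_mul_cancel₀ _ (mul_ne_zero hM hK)]
    ring
  · have e := hd τ C.siegel x v
    simp only [zero_add] at e
    refine mul_right_cancel₀ (mul_ne_zero hM hK) ?_
    rw [Finset.sum_mul, show ∀ A B D E : ℂ, A * B * (D * E) = A * D * (B * E) by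
      intros; ring, e, Finset.mul_sum]
    refine Finset.sum_congr rfl fun h _ => ?_
    beta_reduce
    rw [div_mul_eq_mul_div, div_mul_cancel₀ _ (mul_ne_zero hM hK)]
    by_cases hh : chq h = chq (h + m)
    · have hE : thetaD τ (h + m) v 0 * thetaC τ h 0 + thetaC τ (h + m) 0 * thetaD τ h v 0 = 0 := by
        rcases zmod_two_cases (chq h) with h3 | h3
        · rw [thetaD_zero_of_even C.siegel h3, thetaD_zero_of_even C.siegel (hh ▸ h3)]
          ring
        · rw [thetaC_zero_of_odd h3, thetaC_zero_of_odd (hh ▸ h3)]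
          ring
      rw [hE]
      ring
    · have e2 := C.oddScaled_mul_eq hs0 hs hm hh h1 h2
      linear_combination (d h * (thetaC τ (r + h + m) x * thetaC τ (r + h) x *
        (thetaD τ (h + m) v 0 * thetaC τ h 0 + thetaC τ (h + m) 0 * thetaD τ h v 0))) * e2

theorem thetaC_mul_eq (C : IsComparison τ τ' φ) {s : ℂ} (hs0 : s ≠ 0)
    (hs : ∀ a k r : ThetaChar 3, a ≠ 0 → chq k ≠ chq (k + a) → chq r = 0 →
      chq (r + a) = 0 → (φ k * φ (k + a)) ^ 2 = s ^ 2 * (φ r * φ (r + a)) ^ 2)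
    (m n : ThetaChar 3) (z : Fin 3 → ℂ) :
    oddScaled φ s m * thetaC τ m (s • z) * thetaC τ' n z =
      oddScaled φ s n * thetaC τ n (s • z) * thetaC τ' m z := by
  have hz : oddScaled φ s 0 = φ 0 := if_pos chq_zero
  have key : ∀ m (z : Fin 3 → ℂ), oddScaled φ s m * thetaC τ m (s • z) * thetaC τ' 0 z =
      thetaC τ' m z * (oddScaled φ s 0 * thetaC τ 0 (s • z)) := by
    intro m z
    choose c p q hY hX using fun m => C.wronskian_zero hs0 hs m z
    have dX : ∀ m t, HasDerivAt (fun t : ℂ => oddScaled φ s m * thetaC τ m (t • (s • z)))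
        (oddScaled φ s m * (s * thetaD τ m z (t • (s • z)))) t := fun m t => by
      have := (hasDerivAt_thetaC_line C.siegel m 0 (s • z) t).const_mul (oddScaled φ s m)
      simpa [thetaD] using this
    have dY : ∀ m t, HasDerivAt (fun t : ℂ => thetaC τ' m (t • z)) (thetaD τ' m z (t • z)) t :=
      fun m t => by simpa using hasDerivAt_thetaC_line C.siegel' m 0 z t
    have := eq_of_quadratic_wronskian (o := 0)
      (X := fun m t => oddScaled φ s m * thetaC τ m (t • (s • z)))
      (Y := fun m t => thetaC τ' m (t • z)) (fun m t => (dX m t).differentiableAt)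
      (fun m t => (dY m t).differentiableAt)
      (by
        simp only [zero_smul, hz]
        exact mul_ne_zero (C.ne_zero 0) (C.even_ne_zero 0 chq_zero))
      (fun m => by
        simp only [zero_smul, C.thetaC_eq]
        rcases zmod_two_cases (chq m) with h | h
        · rw [oddScaled, if_pos h]
        · rw [thetaC_zero_of_odd h, mul_zero, mul_zero])
      c p q
      (fun m t => by
        rw [(dX m t).deriv, (dX 0 t).deriv, ← hX m (t • (s • z))]
        ring)
      (fun m t => by rw [(dY m t).deriv, (dY 0 t).deriv, hY m (t • z)]) m 1
    simpa only [one_smul] using this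
  have hd : ∀ m, Differentiable ℂ fun z : Fin 3 → ℂ => thetaC τ m (s • z) := fun m =>
    (differentiable_thetaC C.siegel m).comp
      (differentiable_id.const_smul s)
  have hd' := fun m => differentiable_thetaC C.siegel' m
  refine sub_eq_zero.1 (eq_zero_of_mul_eq_zero_entire (hd' 0)
    ((((hd m).const_mul (oddScaled φ s m)).mul (hd' n)).sub
      (((hd n).const_mul (oddScaled φ s n)).mul (hd' m))) (fun z => ?_) (z₀ := 0) ?_ z)
  · simp only [Pi.sub_apply, Pi.mul_apply]
    linear_combination thetaC τ' n z * key m z - thetaC τ' m z * key n z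
  · rw [C.thetaC_eq]
    exact mul_ne_zero (C.ne_zero 0) (C.even_ne_zero 0 chq_zero)

end IsComparison

theorem eq_of_forall_exists_int_mul {E : Type*} [TopologicalSpace E] [PreconnectedSpace E]
    {G : E → ℂ} (hG : Continuous G) {c : ℂ} (hc : c ≠ 0) (h : ∀ z, ∃ n : ℤ, G z = n * c)
    (x y : E) : G x = G y := by
  choose n hn using h
  have h1 : ∀ z, ((n z : ℤ) : ℝ) = (G z / c).re := fun z => by
    rw [hn, mul_div_cancel_right₀ _ hc, Complex.intCast_re]
  have h2 : Continuous n := by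
    refine Int.isClosedEmbedding_coe_real.isInducing.continuous_iff.2 ?_
    rw [show ((fun k : ℤ => (k : ℝ)) ∘ n) = fun z => (G z / c).re from funext h1]
    exact Complex.continuous_re.comp (hG.div_const c)
  rw [hn, hn, PreconnectedSpace.constant ‹_› h2 (x := x) (y := y)]

theorem sum_mul_latticePoint_sub {g : ℕ} {τ : Matrix (Fin g) (Fin g) ℂ} (hτ : τ.IsSymm)
    (k l k₁ l₁ : Fin g → ℤ) :
    ∑ i, (k i : ℂ) * latticePoint τ k₁ l₁ i - ∑ i, (k₁ i : ℂ) * latticePoint τ k l i =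
      ((k ⬝ᵥ l₁ - k₁ ⬝ᵥ l : ℤ) : ℂ) := by
  have h : ∑ i, ∑ j, (k i : ℂ) * (τ i j * k₁ j) = ∑ i, ∑ j, (k₁ i : ℂ) * (τ i j * k j) := by
    rw [Finset.sum_comm]
    refine Finset.sum_congr rfl fun i _ => Finset.sum_congr rfl fun j _ => ?_
    rw [hτ.apply]
    ring
  simp only [latticePoint, mul_add, Finset.sum_add_distrib, Finset.mul_sum, dotProduct,
    Int.cast_sub, Int.cast_sum, Int.cast_mul]
  linear_combination h

theorem intCast_eq_of_thetaSign_eq {g : ℕ} {k l k₁ l₁ : Fin g → ℤ}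
    (h : ∀ m : ThetaChar g, chq m = 0 → thetaSign m k l = thetaSign m k₁ l₁) (i : Fin g) :
    (k i : ZMod 2) = k₁ i ∧ (l i : ZMod 2) = l₁ i := by
  have hinj : ∀ x y : ZMod 2, sgn x = sgn y → x = y := by
    intro x y
    rcases zmod_two_cases x with rfl | rfl <;> rcases zmod_two_cases y with rfl | rfl <;>
      norm_num [sgn_zero, sgn_one]
  constructor
  · have := hinj _ _ (h (0, Pi.single i 1) (by simp [chq]))
    simpa using this
  · have := hinj _ _ (h (Pi.single i 1, 0) (by simp [chq]))
    simpa using this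

/-- If the even theta constants of `τ'` do not vanish and the theta functions of `τ` and `τ'` agree
projectively after multiplication by `s`, then `s` induces a symplectic map of period lattices which
is trivial mod 2. -/
theorem exists_latticeMap {g : ℕ} {τ τ' : Matrix (Fin g) (Fin g) ℂ} {ψ : ThetaChar g → ℂ} {s : ℂ}
    (hτ : IsSiegel τ) (hτ' : IsSiegel τ') (h0 : thetaC τ 0 0 ≠ 0)
    (hev : ∀ m, chq m = 0 → thetaC τ' m 0 ≠ 0) (hψ : ∀ m, ψ m ≠ 0) (hs : s ≠ 0)
    (h : ∀ m n z, ψ m * thetaC τ m (s • z) * thetaC τ' n z =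
      ψ n * thetaC τ n (s • z) * thetaC τ' m z) :
    ∃ K L : (Fin g → ℤ) → (Fin g → ℤ) → Fin g → ℤ,
      (∀ k l, s • latticePoint τ' k l = latticePoint τ (K k l) (L k l)) ∧
      (∀ k l i, (K k l i : ZMod 2) = k i ∧ (L k l i : ZMod 2) = l i) ∧
      ∀ k l k₁ l₁, K k l ⬝ᵥ L k₁ l₁ - K k₁ l₁ ⬝ᵥ L k l = k ⬝ᵥ l₁ - k₁ ⬝ᵥ l := by
  have h0' := hev 0 chq_zero
  obtain ⟨f, hf, hf0, hfe⟩ := exists_entire_ratio (X := thetaC τ')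
    (Y := fun m z => ψ m * thetaC τ m (s • z)) (differentiable_thetaC hτ')
    (fun m => ((differentiable_thetaC hτ m).comp (by fun_prop)).const_mul _)
    (exists_thetaC_ne_zero hτ' h0')
    (fun z => (exists_thetaC_ne_zero hτ h0 (s • z)).imp fun m hm => mul_ne_zero (hψ m) hm)
    (fun m n z => by linear_combination h n m z)
  have hlat : ∀ k l, ∃ k₁ l₁, s • latticePoint τ' k l = latticePoint τ k₁ l₁ := by
    intro k l
    refine hτ.exists_eq_latticePoint h0 (ε := fun m => thetaSign m k l)
      (fun m => thetaSign_ne_zero m k l) fun m n z => ?_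
    have e : ∀ m, ψ m * (thetaSign m k l * thetaC τ m (z + s • latticePoint τ' k l)) *
        f (s⁻¹ • z) = f (s⁻¹ • z + latticePoint τ' k l) * thetaFactor τ' k (s⁻¹ • z) *
          (ψ m * thetaC τ m z) := by
      intro m
      have h1 := hfe m (s⁻¹ • z + latticePoint τ' k l)
      have h2 := hfe m (s⁻¹ • z)
      rw [smul_add, smul_inv_smul₀ hs, thetaC_add_lattice hτ'] at h1
      rw [smul_inv_smul₀ hs] at h2
      linear_combination thetaSign m k l * f (s⁻¹ • z) * h1 -
        f (s⁻¹ • z + latticePoint τ' k l) * thetaFactor τ' k (s⁻¹ • z) * h2 +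
        f (s⁻¹ • z) * f (s⁻¹ • z + latticePoint τ' k l) * thetaFactor τ' k (s⁻¹ • z) *
          thetaC τ' m (s⁻¹ • z) * thetaSign_mul_self m k l
    refine mul_left_cancel₀ (mul_ne_zero (mul_ne_zero (hψ m) (hψ n)) (hf0 (s⁻¹ • z))) ?_
    linear_combination (ψ m * thetaC τ m z) * e n - (ψ n * thetaC τ n z) * e m
  choose K L hKL using hlat
  have hper : ∀ k l m z, thetaC τ' m z ≠ 0 →
      f (z + latticePoint τ' k l) * thetaSign m k l * thetaFactor τ' k z =
        thetaSign m (K k l) (L k l) * thetaFactor τ (K k l) (s • z) * f z := by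
    intro k l m z hm
    have h1 := hfe m (z + latticePoint τ' k l)
    have h2 := hfe m z
    rw [smul_add, hKL, thetaC_add_lattice hτ', thetaC_add_lattice hτ] at h1
    refine mul_right_cancel₀ hm ?_
    linear_combination thetaSign m (K k l) (L k l) * thetaFactor τ (K k l) (s • z) * h2 - h1
  have hsign1 : ∀ k l, thetaSign (0 : ThetaChar g) k l = 1 := fun k l => by simp [thetaSign]
  have hsign : ∀ k l (m : ThetaChar g), chq m = 0 →
      thetaSign m (K k l) (L k l) = thetaSign m k l := by
    intro k l m hm
    have h1 := hper k l m 0 (hev m hm)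
    have h2 := hper k l 0 0 h0'
    rw [hsign1, hsign1] at h2
    refine (mul_right_cancel₀ (mul_ne_zero (hf0 (0 + latticePoint τ' k l))
      (thetaFactor_ne_zero τ' k 0)) ?_).symm
    linear_combination h1 - thetaSign m (K k l) (L k l) * h2
  have hmod := fun k l => intCast_eq_of_thetaSign_eq (hsign k l)
  have hsign' : ∀ k l m, thetaSign m (K k l) (L k l) = thetaSign m k l := fun k l m => by
    simp only [thetaSign, funext fun i => (hmod k l i).1, funext fun i => (hmod k l i).2]
  have hper' : ∀ k l z, f (z + latticePoint τ' k l) * thetaFactor τ' k z =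
      thetaFactor τ (K k l) (s • z) * f z := by
    intro k l z
    obtain ⟨m, hm⟩ := exists_thetaC_ne_zero hτ' h0' z
    have h1 := hper k l m z hm
    rw [hsign'] at h1
    refine mul_left_cancel₀ (thetaSign_ne_zero m k l) ?_
    linear_combination h1
  obtain ⟨H, hHc, hH⟩ := exists_continuous_log hf.continuous hf0
  have hlin : ∀ k l z, H (z + latticePoint τ' k l) - H z - (H (latticePoint τ' k l) - H 0) =
      2 * Real.pi * I * (∑ i, (k i : ℂ) * z i - ∑ i, (K k l i : ℂ) * (s • z) i) := by
    intro k l z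
    have key := eq_of_forall_exists_int_mul (E := Fin g → ℂ)
      (G := fun z => H (z + latticePoint τ' k l) +
        (-(Real.pi * I * ∑ i, ∑ j, (k i : ℂ) * τ' i j * k j) -
          2 * Real.pi * I * ∑ i, (k i : ℂ) * z i) -
        ((-(Real.pi * I * ∑ i, ∑ j, (K k l i : ℂ) * τ i j * K k l j) -
          2 * Real.pi * I * ∑ i, (K k l i : ℂ) * (s • z) i) + H z))
      (by
        have : Continuous fun z : Fin g → ℂ => s • z := continuous_const_smul s
        fun_prop) Complex.two_pi_I_ne_zero (fun z => by
        have h1 := hper' k l z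
        rw [hH, hH, thetaFactor, thetaFactor, ← Complex.exp_add, ← Complex.exp_add] at h1
        obtain ⟨n, hn⟩ := Complex.exp_eq_exp_iff_exists_int.1 h1
        exact ⟨n, by rw [hn]; ring⟩) z 0
    simp only [smul_zero, Pi.zero_apply, mul_zero, Finset.sum_const_zero, zero_add] at key
    linear_combination key
  refine ⟨K, L, hKL, hmod, fun k l k₁ l₁ => ?_⟩
  have h1 := hlin k l (latticePoint τ' k₁ l₁)
  have h2 := hlin k₁ l₁ (latticePoint τ' k l)
  rw [add_comm (latticePoint τ' k₁ l₁), hKL] at h1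
  rw [hKL] at h2
  have h3 := sum_mul_latticePoint_sub hτ'.1 k l k₁ l₁
  have h4 := sum_mul_latticePoint_sub hτ.1 (K k l) (L k l) (K k₁ l₁) (L k₁ l₁)
  have h5 : ((K k l ⬝ᵥ L k₁ l₁ - K k₁ l₁ ⬝ᵥ L k l : ℤ) : ℂ) = (k ⬝ᵥ l₁ - k₁ ⬝ᵥ l : ℤ) := by
    rw [← h3, ← h4]
    refine mul_left_cancel₀ Complex.two_pi_I_ne_zero ?_
    linear_combination h1 - h2
  exact_mod_cast h5

theorem isSymplectic_of_mul_transpose {g : ℕ} {a b c d : Matrix (Fin g) (Fin g) ℤ}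
    (hab : a * bᵀ = b * aᵀ) (had : a * dᵀ - b * cᵀ = 1) (hcd : c * dᵀ = d * cᵀ) :
    IsSymplectic a b c d := by
  have hJ : Jmat g ℤ = -Matrix.J (Fin g) ℤ := by
    simp [Jmat, Matrix.J, Matrix.fromBlocks_neg]
  have hda : d * aᵀ - c * bᵀ = 1 := by
    have := congrArg Matrix.transpose had
    simpa using this
  have h : Matrix.fromBlocks a b c d ∈ Matrix.symplecticGroup (Fin g) ℤ := by
    rw [SymplecticGroup.mem_iff, Matrix.J, Matrix.fromBlocks_transpose,
      Matrix.fromBlocks_multiply, Matrix.fromBlocks_multiply]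
    simp only [mul_zero, mul_one, mul_neg, zero_add, add_zero, neg_mul]
    congr 1
    · rw [hab, add_neg_cancel]
    · rw [← had]; abel
    · rw [hcd, add_neg_cancel]
  rw [IsSymplectic, hJ, mul_neg, neg_mul, SymplecticGroup.mem_iff'.1 h]

theorem exists_symplectic_of_latticeMap {g : ℕ} {τ τ' : Matrix (Fin g) (Fin g) ℂ} {s : ℂ}
    (hτ : IsSiegel τ) (hτ' : IsSiegel τ') (hs : s ≠ 0)
    {K L : (Fin g → ℤ) → (Fin g → ℤ) → Fin g → ℤ}
    (hKL : ∀ k l, s • latticePoint τ' k l = latticePoint τ (K k l) (L k l))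
    (hmod : ∀ k l i, (K k l i : ZMod 2) = k i ∧ (L k l i : ZMod 2) = l i)
    (hpair : ∀ k l k₁ l₁, K k l ⬝ᵥ L k₁ l₁ - K k₁ l₁ ⬝ᵥ L k l = k ⬝ᵥ l₁ - k₁ ⬝ᵥ l) :
    ∃ a b c d : Matrix (Fin g) (Fin g) ℤ, IsSymplectic a b c d ∧
      (Matrix.fromBlocks a b c d).map (Int.cast : ℤ → ZMod 2) = 1 ∧
      IsUnit (c.map (Int.cast : ℤ → ℂ) * τ + d.map (Int.cast : ℤ → ℂ)) ∧
      τ' = (a.map (Int.cast : ℤ → ℂ) * τ + b.map (Int.cast : ℤ → ℂ)) *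
        (c.map (Int.cast : ℤ → ℂ) * τ + d.map (Int.cast : ℤ → ℂ))⁻¹ := by
  set a : Matrix (Fin g) (Fin g) ℤ := Matrix.of fun j => K (Pi.single j 1) 0 with ha
  set b : Matrix (Fin g) (Fin g) ℤ := Matrix.of fun j => L (Pi.single j 1) 0 with hb
  set c : Matrix (Fin g) (Fin g) ℤ := Matrix.of fun j => K 0 (Pi.single j 1) with hc
  set d : Matrix (Fin g) (Fin g) ℤ := Matrix.of fun j => L 0 (Pi.single j 1) with hd
  have hentry : ∀ (K₁ L₁ : Matrix (Fin g) (Fin g) ℤ) (i j : Fin g),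
      (K₁.map (Int.cast : ℤ → ℂ) * τ + L₁.map (Int.cast : ℤ → ℂ)) j i =
        latticePoint τ (K₁ j) (L₁ j) i := by
    intro K₁ L₁ i j
    rw [Matrix.add_apply, Matrix.mul_apply, latticePoint]
    simp only [Matrix.map_apply]
    congr 1
    refine Finset.sum_congr rfl fun k _ => ?_
    rw [hτ.1.apply, mul_comm]
  have hcd : c.map (Int.cast : ℤ → ℂ) * τ + d.map (Int.cast : ℤ → ℂ) = s • 1 := by
    ext j i
    rw [hentry]
    have := congrFun (hKL 0 (Pi.single j 1)) i
    rw [show c j = K 0 (Pi.single j 1) from rfl, show d j = L 0 (Pi.single j 1) from rfl, ← this]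
    simp [latticePoint, Pi.single_apply, Matrix.one_apply, eq_comm]
  have hab : a.map (Int.cast : ℤ → ℂ) * τ + b.map (Int.cast : ℤ → ℂ) = s • τ' := by
    ext j i
    rw [hentry]
    have := congrFun (hKL (Pi.single j 1) 0) i
    rw [show a j = K (Pi.single j 1) 0 from rfl, show b j = L (Pi.single j 1) 0 from rfl, ← this]
    simp [latticePoint, Pi.single_apply, hτ'.1.apply]
  have hunit : IsUnit (s • (1 : Matrix (Fin g) (Fin g) ℂ)) :=
    (Matrix.isUnit_iff_isUnit_det _).2 (by simp [hs])
  refine ⟨a, b, c, d, isSymplectic_of_mul_transpose ?_ ?_ ?_, ?_, hcd ▸ hunit, ?_⟩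
  · ext i j
    have := hpair (Pi.single i 1) 0 (Pi.single j 1) 0
    simp only [dotProduct_zero, sub_zero] at this
    rw [Matrix.mul_apply', Matrix.mul_apply', ← sub_eq_zero, ← this]
    congr 1
    exact dotProduct_comm _ _
  · ext i j
    have := hpair (Pi.single i 1) 0 0 (Pi.single j 1)
    simp only [dotProduct_zero, sub_zero, single_dotProduct, one_mul] at this
    rw [Matrix.sub_apply, Matrix.mul_apply', Matrix.mul_apply', Matrix.one_apply,
      ← Pi.single_apply]
    refine Eq.trans ?_ (this.trans ?_)
    · congr 1
      exact dotProduct_comm _ _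
    · simp [Pi.single_apply, eq_comm]
  · ext i j
    have := hpair 0 (Pi.single i 1) 0 (Pi.single j 1)
    simp only [zero_dotProduct, sub_zero] at this
    rw [Matrix.mul_apply', Matrix.mul_apply', ← sub_eq_zero, ← this]
    congr 1
    exact dotProduct_comm _ _
  · rw [Matrix.fromBlocks_map, ← Matrix.fromBlocks_one]
    congr 1 <;> ext i j <;> simp [ha, hb, hc, hd, hmod, Pi.single_apply, Matrix.one_apply, eq_comm]
  · rw [hab, hcd, Matrix.inv_eq_right_inv (B := s⁻¹ • (1 : Matrix (Fin g) (Fin g) ℂ))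
      (by rw [smul_mul_smul_comm, mul_inv_cancel₀ hs, one_smul, one_mul]), smul_mul_smul_comm,
      mul_inv_cancel₀ hs, one_smul, mul_one]

theorem charParity_eq_sgn {g : ℕ} (m : ThetaChar g) : (charParity m : ℂ) = sgn (chq m) := by
  have h : chq m = ((charDot m : ℤ) : ZMod 2) := by
    simp [charDot, chq, dotProduct]
  rw [h, sgn_intCast, mul_comm, Complex.exp_int_mul, Complex.exp_pi_mul_I]
  simp [charParity]

theorem isEvenChar_iff {g : ℕ} (m : ThetaChar g) : IsEvenChar m ↔ chq m = 0 := by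
  rw [IsEvenChar, ← Int.cast_inj (α := ℂ), charParity_eq_sgn]
  rcases zmod_two_cases (chq m) with h | h <;> norm_num [h, sgn_zero, sgn_one]

theorem isOddChar_iff {g : ℕ} (m : ThetaChar g) : IsOddChar m ↔ chq m = 1 := by
  rw [IsOddChar, ← Int.cast_inj (α := ℂ), charParity_eq_sgn]
  rcases zmod_two_cases (chq m) with h | h <;> norm_num [h, sgn_zero, sgn_one]

theorem thetaD_zero_eq_sum {g : ℕ} (τ : Matrix (Fin g) (Fin g) ℂ) (m : ThetaChar g)
    (v : Fin g → ℂ) : thetaD τ m v 0 = ∑ j, v j * thetaGrad (charLift m) τ j := by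
  rw [thetaD]
  conv_lhs => rw [pi_eq_sum_univ' v]
  simp only [map_sum, map_smul, smul_eq_mul]
  rfl

theorem exists_isComparison {τ τ' : Matrix (Fin 3) (Fin 3) ℂ} (hτ : IsSiegel τ)
    (hτ' : IsSiegel τ')
    (hev : ∀ m : ThetaChar 3, IsEvenChar m →
      theta (charLift m) τ 0 ≠ 0 ∧ theta (charLift m) τ' 0 ≠ 0)
    (hbit : ∀ n : ThetaChar 3, IsOddChar n → ∃ lam : ℂ, lam ≠ 0 ∧
      thetaGrad (charLift n) τ' = lam • thetaGrad (charLift n) τ) :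
    ∃ φ, IsComparison τ τ' φ := by
  have key : ∀ m : ThetaChar 3, ∃ c : ℂ, c ≠ 0 ∧ thetaC τ' m 0 = c * thetaC τ m 0 ∧
      ∀ v, thetaD τ' m v 0 = c * thetaD τ m v 0 := by
    intro m
    rcases zmod_two_cases (chq m) with h | h
    · obtain ⟨h1, h2⟩ := hev m ((isEvenChar_iff m).2 h)
      refine ⟨thetaC τ' m 0 / thetaC τ m 0, div_ne_zero h2 h1, (div_mul_cancel₀ _ h1).symm,
        fun v => ?_⟩
      rw [thetaD_zero_of_even hτ h, thetaD_zero_of_even hτ' h, mul_zero]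
    · obtain ⟨c, hc, hgrad⟩ := hbit m ((isOddChar_iff m).2 h)
      refine ⟨c, hc, by rw [thetaC_zero_of_odd h, thetaC_zero_of_odd h, mul_zero], fun v => ?_⟩
      rw [thetaD_zero_eq_sum, thetaD_zero_eq_sum, hgrad, Finset.mul_sum]
      refine Finset.sum_congr rfl fun j _ => ?_
      rw [Pi.smul_apply, smul_eq_mul]
      ring
  choose φ h1 h2 h3 using key
  exact ⟨φ, hτ, hτ', fun m hm => (hev m ((isEvenChar_iff m).2 hm)).1, h1, h2, h3⟩

/-- If two points of the Siegel upper half-space of degree 3, at which no even theta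
constant vanishes, have proportional odd theta gradients (i.e. the corresponding
quartics have the same 28 bitangents), then they are equivalent under `Γ₃(2)`. -/
theorem same_bitangents_implies_Gamma2_equivalent
    (τ τ' : Matrix (Fin 3) (Fin 3) ℂ) (hτ : IsSiegel τ) (hτ' : IsSiegel τ')
    (hev : ∀ m : ThetaChar 3, IsEvenChar m →
      theta (charLift m) τ 0 ≠ 0 ∧ theta (charLift m) τ' 0 ≠ 0)
    (hbit : ∀ n : ThetaChar 3, IsOddChar n → ∃ lam : ℂ, lam ≠ 0 ∧
      thetaGrad (charLift n) τ' = lam • thetaGrad (charLift n) τ) :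
    ∃ a b c d : Matrix (Fin 3) (Fin 3) ℤ,
      IsSymplectic a b c d ∧
      (Matrix.fromBlocks a b c d).map (Int.cast : ℤ → ZMod 2) = 1 ∧
      IsUnit (c.map (Int.cast : ℤ → ℂ) * τ + d.map (Int.cast : ℤ → ℂ)) ∧
      τ' = (a.map (Int.cast : ℤ → ℂ) * τ + b.map (Int.cast : ℤ → ℂ)) *
        (c.map (Int.cast : ℤ → ℂ) * τ + d.map (Int.cast : ℤ → ℂ))⁻¹ := by
  obtain ⟨φ, C⟩ := exists_isComparison hτ hτ' hev hbit
  obtain ⟨s, hs0, hs⟩ := C.mixed_eq_const_mul_even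
  have hψ : ∀ m, oddScaled φ s m ≠ 0 := fun m => by
    rw [oddScaled]
    split_ifs
    exacts [C.ne_zero m, div_ne_zero (C.ne_zero m) hs0]
  obtain ⟨K, L, hKL, hmod, hpair⟩ := exists_latticeMap hτ hτ' (C.even_ne_zero 0 chq_zero)
    (fun m hm => (hev m ((isEvenChar_iff m).2 hm)).2) hψ hs0 (C.thetaC_mul_eq hs0 hs)
  exact exists_symplectic_of_latticeMap hτ hτ' hs0 hKL hmod hpair
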